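/- Let G be a finitely generated group such that there exists c > 0 with a_n(G) ≥ c·n for all n ≥ 1, and assume hypothesis (★) holds with α ≥ 2. Fix a real x > 0. Then the variance Var(K_{G,n}) := E[K_{G,n}²] − (E[K_{G,n}])² satisfies the asymptotic equivalence Var(K_{G,n}) ∼ (1/(α(α−1))) · α^{−(m−1)/α} · (x·𝒦)^{1/α} · n^{(α−1)/α} · (ln n)^{(m−1)/α} as n → ∞. -/

import Mathlib

open scoped BigOperators

/-- `a_n(G)`: the number of subgroups of `G` of index exactly `n`. -/
noncomputable def aCount (G : Type*) [Group G] (n : ℕ) : ℕ :=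
  Nat.card {H : Subgroup G // H.index = n}

/-- `c(φ)`: the number of orbits of the action of `G` on `Fin n` induced by
`φ : G →* Equiv.Perm (Fin n)` (equivalently, the orbits of the range of `φ`). -/
noncomputable def numOrbits {G : Type*} [Group G] {n : ℕ} (φ : G →* Equiv.Perm (Fin n)) : ℕ :=
  Nat.card (Quotient (MulAction.orbitRel φ.range (Fin n)))

/-- The expectation `E[f(K_{G,n})]` for the `x`-biased measure on `Hom(G, S_n)`. -/
noncomputable def expVal (G : Type*) [Group G] (n : ℕ) (x : ℝ) (f : ℝ → ℝ) : ℝ :=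
  (∑ᶠ φ : G →* Equiv.Perm (Fin n), f (numOrbits φ) * x ^ numOrbits φ) /
    (∑ᶠ φ : G →* Equiv.Perm (Fin n), x ^ numOrbits φ)

section

open MeasureTheory Filter Topology Complex

open FourierTransform in
theorem exists_kernel (N : ℕ) : ∃ (φ : ℝ → ℝ) (k : ℝ → ℂ), Continuous φ ∧ (∀ v, 0 ≤ φ v) ∧
    Continuous k ∧ HasCompactSupport k ∧ (∀ v : ℝ, (φ v : ℂ) = ∫ t : ℝ, k t * cexp (I * v * t)) ∧
    Integrable (fun v => (1 + |v|) ^ N * φ v) ∧ ∫ v, φ v = 1 := by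
  let b : ContDiffBump (0 : ℝ) := ⟨1, 2, by norm_num, by norm_num⟩
  let g : ℝ → ℂ := fun t => (b t : ℂ)
  have hgc : ContDiff ℝ (⊤ : ℕ∞) g := Complex.ofRealCLM.contDiff.comp b.contDiff
  have hgs : HasCompactSupport g := by
    have := b.hasCompactSupport
    exact this.comp_left (g := fun x : ℝ => (x : ℂ)) (by simp)
  let G : SchwartzMap ℝ ℂ := hgs.toSchwartzMap hgc
  let F : SchwartzMap ℝ ℂ := 𝓕 G
  have hF : ∀ v, F v = ∫ t : ℝ, cexp (↑(-2 * Real.pi * t * v) * I) * g t := by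
    intro v
    change (𝓕 G) v = _
    rw [SchwartzMap.fourier_coe, Real.fourier_eq']
    simp [G, mul_assoc, mul_comm, mul_left_comm]
  have hreal : ∀ v, (starRingEnd ℂ) (F v) = F v := by
    intro v
    rw [hF, ← integral_conj, ← integral_neg_eq_self]
    refine integral_congr_ae (Eventually.of_forall fun t => ?_)
    have : g (-t) = g t := by simp [g, b.neg]
    simp only [map_mul, this, ← Complex.exp_conj]
    congr 1
    · rw [Complex.conj_ofReal, Complex.conj_I]
      push_cast
      ring_nf
    · simp [g]
  have hre : ∀ v, (((F v).re : ℝ) : ℂ) = F v := fun v => Complex.conj_eq_iff_re.1 (hreal v)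
  let φ₀ : ℝ → ℝ := fun v => (F v).re ^ 2
  let k₀ : ℝ → ℂ := convolution g g (ContinuousLinearMap.mul ℂ ℂ) volume
  have hgi : Integrable g := hgc.continuous.integrable_of_hasCompactSupport hgs
  have hφ₀c : Continuous φ₀ := (Complex.continuous_re.comp F.continuous).pow 2
  have hk₀c : Continuous k₀ :=
    hgs.continuous_convolution_right _ hgi.locallyIntegrable hgc.continuous
  have hk₀s : HasCompactSupport k₀ := hgs.convolution _ hgs
  have hφk : ∀ v : ℝ, (φ₀ v : ℂ) = ∫ t : ℝ, cexp (↑(-2 * Real.pi * t * v) * I) * k₀ t := by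
    intro v
    have h1 := Real.fourier_mul_convolution_eq hgi hgi v
    rw [Real.fourier_eq'] at h1
    have h2 : 𝓕 g v = F v := rfl
    rw [h2] at h1
    have h3 : (φ₀ v : ℂ) = F v * F v := by
      rw [← sq, ← hre v, ← ofReal_pow]
    rw [h3, ← h1]
    refine integral_congr_ae (Eventually.of_forall fun t => ?_)
    simp [k₀, mul_assoc, mul_comm, mul_left_comm]
  obtain ⟨C, hC⟩ : ∃ C, ∀ v, ‖F v‖ ≤ C := by
    obtain ⟨C, hC⟩ := F.decay 0 0
    exact ⟨C, fun v => by simpa using hC.2 v⟩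
  have hintg : Integrable (fun v => (1 + |v|) ^ N * φ₀ v) := by
    have hb : Integrable (fun v => 2 ^ N * C * (‖v‖ ^ 0 * ‖F v‖ + ‖v‖ ^ N * ‖F v‖)) :=
      ((F.integrable_pow_mul volume 0).add (F.integrable_pow_mul volume N)).const_mul _
    refine hb.mono' (by fun_prop) (Eventually.of_forall fun v => ?_)
    have h1 : (1 + |v|) ^ N ≤ 2 ^ N * (1 + |v| ^ N) := by
      calc (1 + |v|) ^ N ≤ 2 ^ (N - 1) * (1 ^ N + |v| ^ N) := add_pow_le zero_le_one (abs_nonneg v) N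
        _ ≤ 2 ^ N * (1 + |v| ^ N) := by
          rw [one_pow]
          gcongr
          · norm_num
          · omega
    have h2 : φ₀ v ≤ C * ‖F v‖ := by
      have : |(F v).re| ≤ ‖F v‖ := Complex.abs_re_le_norm _
      calc φ₀ v = |(F v).re| * |(F v).re| := by simp only [φ₀]; rw [← sq, sq_abs]
        _ ≤ C * ‖F v‖ := by gcongr; exact (norm_nonneg _).trans (hC v); exact this.trans (hC v)
    have h3 : 0 ≤ φ₀ v := sq_nonneg _
    rw [Real.norm_of_nonneg (by positivity)]
    calc (1 + |v|) ^ N * φ₀ v ≤ (2 ^ N * (1 + |v| ^ N)) * (C * ‖F v‖) := by gcongr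
      _ = _ := by rw [Real.norm_eq_abs, pow_zero]; ring
  have hi0 : Integrable φ₀ := by
    refine hintg.mono' (by fun_prop) (Eventually.of_forall fun v => ?_)
    have h3 : 0 ≤ φ₀ v := sq_nonneg _
    rw [Real.norm_of_nonneg h3]
    exact le_mul_of_one_le_left h3 (one_le_pow₀ (by linarith [abs_nonneg v]))
  have hpos : 0 < ∫ v, φ₀ v := by
    refine integral_pos_of_integrable_nonneg_nonzero (x := 0) hφ₀c hi0 (fun v => sq_nonneg _) ?_
    refine pow_ne_zero 2 ?_
    have : F 0 = ((∫ t, b t : ℝ) : ℂ) := by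
      rw [hF, ← integral_complex_ofReal]
      simp [g]
    rw [this, ofReal_re]
    exact b.integral_pos.ne'
  set Z := ∫ v, φ₀ v with hZ
  refine ⟨fun v => Z⁻¹ * φ₀ v, fun t => (Z⁻¹ : ℝ) * (((2 * Real.pi)⁻¹ : ℝ) * k₀ (-(2 * Real.pi)⁻¹ * t)),
    by fun_prop, fun v => mul_nonneg (by positivity) (sq_nonneg _), by fun_prop, ?_, ?_, ?_, ?_⟩
  · have h0 : (-(2 * Real.pi)⁻¹ : ℝ) ≠ 0 := by simp [Real.pi_ne_zero]
    have := hk₀s.comp_homeomorph (Homeomorph.mulLeft₀ _ h0)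
    exact (this.mul_left (f := fun _ => (((2 * Real.pi)⁻¹ : ℝ) : ℂ))).mul_left
      (f := fun _ => ((Z⁻¹ : ℝ) : ℂ))
  · intro v
    have h := Measure.integral_comp_mul_left (fun t => cexp (↑(-2 * Real.pi * t * v) * I) * k₀ t)
      (-(2 * Real.pi)⁻¹)
    rw [← hφk v, inv_neg, inv_inv, abs_neg, abs_of_pos (by positivity)] at h
    have h' : (φ₀ v : ℂ) = ((2 * Real.pi)⁻¹ : ℝ) * ∫ x : ℝ,
        cexp (↑(-2 * Real.pi * (-(2 * Real.pi)⁻¹ * x) * v) * I) * k₀ (-(2 * Real.pi)⁻¹ * x) := by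
      rw [h, real_smul, ← mul_assoc, ← ofReal_mul, inv_mul_cancel₀ (by positivity)]
      simp
    rw [ofReal_mul, h', ← integral_const_mul, ← integral_const_mul]
    refine integral_congr_ae (Eventually.of_forall fun t => ?_)
    have : -2 * Real.pi * (-(2 * Real.pi)⁻¹ * t) * v = v * t := by
      field_simp [Real.pi_ne_zero]
    simp only [this]
    rw [show (↑(v * t) : ℂ) * I = I * v * t by push_cast; ring]
    ring
  · refine (hintg.const_mul Z⁻¹).congr (Eventually.of_forall fun v => ?_)
    simp only
    ring
  · rw [integral_const_mul, inv_mul_cancel₀ hpos.ne']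

/-- The Dirichlet series with coefficients `a` (shifted by one) converges absolutely to the right of
`α` and equals a polar part of order at most `M + 1` plus a function continuous up to the line. -/
structure HasPolarPart (a : ℕ → ℝ) (α : ℝ) (M : ℕ) (μ : ℕ → ℂ) (Φ : ℂ → ℂ) : Prop where
  nonneg : ∀ δ, 0 ≤ a δ
  continuousOn : ContinuousOn Φ {s : ℂ | α ≤ s.re}
  summable : ∀ s : ℂ, α < s.re → Summable fun δ : ℕ => ‖(a δ : ℂ) * ((δ + 1 : ℕ) : ℂ) ^ (-s)‖
  tsum_eq : ∀ s : ℂ, α < s.re → ∑' δ : ℕ, (a δ : ℂ) * ((δ + 1 : ℕ) : ℂ) ^ (-s) =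
    (∑ j ∈ Finset.range (M + 1), μ j / (s - (α : ℂ)) ^ (j + 1)) + Φ s

/-- A nonnegative function whose Fourier transform `k` is continuous and compactly supported, with
finite absolute moments up to order `M`. -/
structure IsKernel (M : ℕ) (ψ : ℝ → ℝ) (k : ℝ → ℂ) : Prop where
  nonneg : ∀ v, 0 ≤ ψ v
  continuous_fourier : Continuous k
  hasCompactSupport : HasCompactSupport k
  eq_integral : ∀ v : ℝ, (ψ v : ℂ) = ∫ t : ℝ, k t * cexp (I * v * t)
  integrable : Integrable fun v => (1 + |v|) ^ M * ψ v

theorem natCast_cpow_neg_add_mul_I (δ : ℕ) (σ t : ℝ) :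
    ((δ + 1 : ℕ) : ℂ) ^ (-((σ : ℂ) + t * I)) =
      (((δ : ℝ) + 1) ^ (-σ) : ℝ) * cexp (I * (-Real.log (δ + 1) : ℝ) * t) := by
  have h : (0 : ℝ) < δ + 1 := by positivity
  have h' : ((δ + 1 : ℕ) : ℂ) = ((δ + 1 : ℝ) : ℂ) := by push_cast; rfl
  rw [h', neg_add, Complex.cpow_add _ _ (by exact_mod_cast h.ne'), Complex.ofReal_cpow h.le]
  congr 1
  · push_cast; rfl
  · rw [Complex.cpow_def_of_ne_zero (by exact_mod_cast h.ne'), ← Complex.ofReal_log h.le]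
    congr 1
    push_cast
    ring

theorem summable_rpow_of_polar {a : ℕ → ℝ} {α : ℝ} {M : ℕ} {μ : ℕ → ℂ} {Φ : ℂ → ℂ}
    (H : HasPolarPart a α M μ Φ) {σ : ℝ} (hσ : α < σ) :
    Summable fun δ : ℕ => a δ * ((δ : ℝ) + 1) ^ (-σ) := by
  refine (H.summable σ (by simpa using hσ)).congr fun δ => ?_
  have := natCast_cpow_neg_add_mul_I δ σ 0
  simp only [ofReal_zero, zero_mul, add_zero, mul_zero, Complex.exp_zero, mul_one] at this
  rw [this, norm_mul, Complex.norm_real, Complex.norm_real, Real.norm_of_nonneg (H.nonneg δ),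
    Real.norm_of_nonneg (by positivity)]

theorem IsKernel.hasSum_of_pos {a : ℕ → ℝ} {α : ℝ} {M : ℕ} {μ : ℕ → ℂ} {Φ : ℂ → ℂ}
    (H : HasPolarPart a α M μ Φ) {ψ : ℝ → ℝ} {k : ℝ → ℂ} (K : IsKernel M ψ k) (w : ℝ) {ε : ℝ}
    (hε : 0 < ε) :
    HasSum (fun δ : ℕ => ((a δ * ((δ : ℝ) + 1) ^ (-(α + ε)) * ψ (w - Real.log (δ + 1)) : ℝ) : ℂ))
      (∫ t : ℝ, k t * cexp (I * w * t) *
        ((∑ j ∈ Finset.range (M + 1), μ j / ((ε : ℂ) + t * I) ^ (j + 1)) + Φ ((α + ε : ℝ) + t * I)))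
      := by
  have hki : Integrable k := K.continuous_fourier.integrable_of_hasCompactSupport K.hasCompactSupport
  let F : ℕ → ℝ → ℂ := fun δ t => k t * cexp (I * w * t) *
    ((a δ : ℂ) * ((δ + 1 : ℕ) : ℂ) ^ (-((α + ε : ℝ) + t * I : ℂ)))
  have hF : ∀ δ t, F δ t = ((a δ * ((δ : ℝ) + 1) ^ (-(α + ε)) : ℝ) : ℂ) *
      (k t * cexp (I * (w - Real.log (δ + 1) : ℝ) * t)) := by
    intro δ t
    have : cexp (I * (w - Real.log (δ + 1) : ℝ) * t) =
        cexp (I * w * t) * cexp (I * (-Real.log (δ + 1) : ℝ) * t) := by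
      rw [← Complex.exp_add]; congr 1; push_cast; ring
    simp only [F]
    rw [natCast_cpow_neg_add_mul_I, this]
    push_cast
    ring
  have hnorm : ∀ δ t, ‖F δ t‖ = a δ * ((δ : ℝ) + 1) ^ (-(α + ε)) * ‖k t‖ := by
    intro δ t
    rw [hF, norm_mul, Complex.norm_real, Real.norm_of_nonneg
      (mul_nonneg (H.nonneg δ) (by positivity)), norm_mul,
      show I * (w - Real.log (δ + 1) : ℝ) * t = ((w - Real.log (δ + 1)) * t : ℝ) * I by
        push_cast; ring, Complex.norm_exp_ofReal_mul_I, mul_one]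
  have hcont : ∀ δ, Continuous (F δ) := by
    intro δ
    rw [show F δ = _ from funext (hF δ)]
    have := K.continuous_fourier
    fun_prop
  have key := hasSum_integral_of_summable_integral_norm (E := ℂ) (μ := volume) (F := F) ?_ ?_
  · have h1 : ∀ δ, ∫ t, F δ t = ((a δ * ((δ : ℝ) + 1) ^ (-(α + ε)) *
        ψ (w - Real.log (δ + 1)) : ℝ) : ℂ) := by
      intro δ
      rw [ofReal_mul, K.eq_integral, ← integral_const_mul]
      simp_rw [hF]
    simp_rw [h1] at key
    have h2 : ∀ t : ℝ, ∑' δ, F δ t = k t * cexp (I * w * t) *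
        ((∑ j ∈ Finset.range (M + 1), μ j / ((ε : ℂ) + t * I) ^ (j + 1)) +
          Φ ((α + ε : ℝ) + t * I)) := fun t => ?_
    · simp_rw [h2] at key
      exact key
    simp only [F]
    rw [tsum_mul_left, H.tsum_eq _ (by simpa using hε)]
    rw [show (((α + ε : ℝ) : ℂ) + t * I - α) = ε + t * I by push_cast; ring]
  · intro δ
    refine (hki.norm.const_mul (a δ * ((δ : ℝ) + 1) ^ (-(α + ε)))).mono' (hcont δ).aestronglyMeasurable
      (Eventually.of_forall fun t => (hnorm δ t).le)
  · simp_rw [hnorm, integral_const_mul]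
    exact (summable_rpow_of_polar H (by linarith)).mul_right _

theorem integrableOn_pow_mul_exp_neg (j : ℕ) {ε : ℝ} (hε : 0 < ε) :
    IntegrableOn (fun u : ℝ => u ^ j / j.factorial * Real.exp (-ε * u)) (Set.Ioi 0) := by
  have := (integrableOn_rpow_mul_exp_neg_mul_rpow (s := j) (p := 1) (b := ε)
    (by have : (0 : ℝ) ≤ j := by positivity
        linarith) one_pos hε)
  refine (this.integrable.const_mul (j.factorial : ℝ)⁻¹).congr (Eventually.of_forall fun u => ?_)
  simp only [Real.rpow_natCast, Real.rpow_one]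
  ring

theorem integral_pow_mul_cexp_neg_mul_Ioi (j : ℕ) {s : ℂ} (hs : 0 < s.re) :
    ∫ u in Set.Ioi (0 : ℝ), (u ^ j / j.factorial : ℂ) * cexp (-(s * u)) = 1 / s ^ (j + 1) := by
  have hs0 : s ≠ 0 := by rintro rfl; simp at hs
  have hn : ∀ (j : ℕ) (u : ℝ), 0 ≤ u → ‖(u ^ j / j.factorial : ℂ) * cexp (-(s * u))‖ =
      u ^ j / j.factorial * Real.exp (-s.re * u) := by
    intro j u hu
    rw [norm_mul, Complex.norm_exp]
    simp [abs_of_nonneg hu]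
  have hintg : ∀ j : ℕ, IntegrableOn (fun u : ℝ => (u ^ j / j.factorial : ℂ) * cexp (-(s * u)))
      (Set.Ioi 0) := by
    intro j
    refine (integrableOn_pow_mul_exp_neg j hs).mono' (Continuous.aestronglyMeasurable (by fun_prop)) ?_
    filter_upwards [ae_restrict_mem measurableSet_Ioi] with u hu
    exact (hn j u (le_of_lt hu)).le
  induction j with
  | zero =>
    have := integral_exp_mul_complex_Ioi (a := -s) (by simpa using hs) 0
    simpa [neg_mul] using this
  | succ j ih =>
    have hd : ∀ u ∈ Set.Ici (0 : ℝ), HasDerivAt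
        (fun u : ℝ => (u ^ (j + 1) / (j + 1).factorial : ℂ) * cexp (-(s * u)))
        ((u ^ j / j.factorial : ℂ) * cexp (-(s * u)) -
          s * ((u ^ (j + 1) / (j + 1).factorial : ℂ) * cexp (-(s * u)))) u := by
      intro u _
      have h1 : HasDerivAt (fun z : ℂ => (z ^ (j + 1) / (j + 1).factorial : ℂ) * cexp (-(s * z)))
        ((((j + 1 : ℕ) : ℂ) * (u : ℂ) ^ j / (j + 1).factorial) * cexp (-(s * u)) +
          ((u : ℂ) ^ (j + 1) / (j + 1).factorial) * (cexp (-(s * u)) * (-(s * 1)))) (u : ℂ) := by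
        refine HasDerivAt.mul ?_ (((hasDerivAt_id _).const_mul s).neg.cexp)
        exact (hasDerivAt_pow (j + 1) (u : ℂ)).div_const _
      convert h1.comp_ofReal using 1
      have hf : (j.factorial : ℂ) ≠ 0 := by exact_mod_cast j.factorial_ne_zero
      have hj : ((j : ℂ) + 1) ≠ 0 := by exact_mod_cast j.succ_ne_zero
      rw [Nat.factorial_succ]
      push_cast
      field_simp
      ring
    have ht : Tendsto (fun u : ℝ => (u ^ (j + 1) / (j + 1).factorial : ℂ) * cexp (-(s * u)))
        atTop (𝓝 0) := by
      rw [tendsto_zero_iff_norm_tendsto_zero]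
      have h1 := (tendsto_rpow_mul_exp_neg_mul_atTop_nhds_zero (j + 1 : ℕ) s.re hs).div_const
        ((j + 1).factorial : ℝ)
      rw [zero_div] at h1
      refine h1.congr' ?_
      filter_upwards [eventually_ge_atTop 0] with u hu
      rw [hn _ u hu, Real.rpow_natCast]
      ring
    have := integral_Ioi_of_hasDerivAt_of_tendsto' hd
      ((hintg j).integrable.sub ((hintg (j + 1)).integrable.const_mul s)) ht
    rw [integral_sub (hintg j) ((hintg (j + 1)).integrable.const_mul s), ih, integral_const_mul] at this
    simp only [ofReal_zero, ne_eq, Nat.add_eq_zero_iff, one_ne_zero, and_false, not_false_eq_true,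
      zero_pow, zero_div, zero_mul, sub_zero] at this
    rw [sub_eq_zero] at this
    rw [pow_succ, one_div, mul_inv, ← one_div, this]
    field_simp

theorem IsKernel.integral_polar {M : ℕ} {ψ : ℝ → ℝ} {k : ℝ → ℂ} (K : IsKernel M ψ k) (w : ℝ) {ε : ℝ}
    (hε : 0 < ε) (j : ℕ) :
    ∫ t : ℝ, k t * cexp (I * w * t) * (1 / ((ε : ℂ) + t * I) ^ (j + 1)) =
      ((∫ u in Set.Ioi (0 : ℝ), u ^ j / j.factorial * Real.exp (-ε * u) * ψ (w - u) : ℝ) : ℂ) := by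
  have hki : Integrable k := K.continuous_fourier.integrable_of_hasCompactSupport K.hasCompactSupport
  have h1 : ∀ t : ℝ, (1 / ((ε : ℂ) + t * I) ^ (j + 1)) = ∫ u in Set.Ioi (0 : ℝ),
      (u ^ j / j.factorial : ℂ) * cexp (-((ε + t * I) * u)) := by
    exact fun t => (integral_pow_mul_cexp_neg_mul_Ioi j (by simpa using hε)).symm
  have hui := (integrableOn_pow_mul_exp_neg j hε).integrable
  let f : ℝ → ℝ → ℂ := fun t u => k t * cexp (I * (w - u : ℝ) * t) *
    ((u ^ j / j.factorial * Real.exp (-ε * u) : ℝ) : ℂ)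
  have hf : Integrable (Function.uncurry f) (volume.prod (volume.restrict (Set.Ioi 0))) := by
    refine (hki.mul_prod hui.ofReal).mono ?_ (Eventually.of_forall fun p => ?_)
    · have := K.continuous_fourier
      exact Continuous.aestronglyMeasurable (by simp only [f, Function.uncurry_def]; fun_prop)
    · simp only [f, Function.uncurry_def, norm_mul]
      rw [show I * (w - p.2 : ℝ) * p.1 = ((w - p.2) * p.1 : ℝ) * I by
        push_cast; ring, Complex.norm_exp_ofReal_mul_I, mul_one]
      rfl
  calc _ = ∫ t : ℝ, ∫ u in Set.Ioi (0 : ℝ), f t u := by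
        refine integral_congr_ae (Eventually.of_forall fun t => ?_)
        simp only
        rw [h1, ← integral_const_mul]
        refine integral_congr_ae (Eventually.of_forall fun u => ?_)
        simp only [f]
        have : cexp (I * w * t) * cexp (-((ε + t * I) * u)) =
            cexp (I * (w - u : ℝ) * t) * cexp ((-ε * u : ℝ)) := by
          rw [← Complex.exp_add, ← Complex.exp_add]; congr 1; push_cast; ring
        push_cast at this ⊢
        linear_combination (k t * (u ^ j / j.factorial : ℂ)) * this
    _ = ∫ u in Set.Ioi (0 : ℝ), ∫ t : ℝ, f t u := integral_integral_swap hf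
    _ = _ := by
        rw [← integral_complex_ofReal]
        refine integral_congr_ae (Eventually.of_forall fun u => ?_)
        simp only [f]
        rw [integral_mul_const, ← K.eq_integral]
        push_cast
        ring

/-- The value at `w` of the convolution of the kernel `ψ` with the measure attached to a Dirichlet
series with polar part `μ` and boundary function `Φ`. -/
noncomputable def smoothedSum (α : ℝ) (M : ℕ) (μ : ℕ → ℂ) (Φ : ℂ → ℂ) (ψ : ℝ → ℝ) (k : ℝ → ℂ)
    (w : ℝ) : ℂ :=
  (∑ j ∈ Finset.range (M + 1),
    μ j * ((∫ u in Set.Ioi (0 : ℝ), u ^ j / j.factorial * ψ (w - u) : ℝ) : ℂ)) +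
    ∫ t : ℝ, k t * cexp (I * w * t) * Φ (α + t * I)

theorem IsKernel.continuous {M : ℕ} {ψ : ℝ → ℝ} {k : ℝ → ℂ} (K : IsKernel M ψ k) :
    Continuous ψ := by
  have hki : Integrable k := K.continuous_fourier.integrable_of_hasCompactSupport K.hasCompactSupport
  have h : Continuous fun v : ℝ => ∫ t : ℝ, k t * cexp (I * v * t) := by
    refine continuous_of_dominated (bound := fun t => ‖k t‖) ?_ ?_ hki.norm ?_
    · intro v
      have := K.continuous_fourier
      exact Continuous.aestronglyMeasurable (by fun_prop)
    · refine fun v => Eventually.of_forall fun t => ?_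
      rw [norm_mul, show I * v * t = (v * t : ℝ) * I by push_cast; ring,
        Complex.norm_exp_ofReal_mul_I, mul_one]
    · exact Eventually.of_forall fun t => by fun_prop
  have h2 : ψ = fun v : ℝ => (∫ t : ℝ, k t * cexp (I * v * t)).re := by
    ext v
    rw [← K.eq_integral, ofReal_re]
  rw [h2]
  exact Complex.continuous_re.comp h

theorem IsKernel.pow_mul_le {M : ℕ} {ψ : ℝ → ℝ} {k : ℝ → ℂ} (K : IsKernel M ψ k) {j : ℕ}
    (hj : j ≤ M) (w u : ℝ) :
    ‖u ^ j / j.factorial * ψ (w - u)‖ ≤ (1 + |w|) ^ M * ((1 + |w - u|) ^ M * ψ (w - u)) := by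
  have h0 := K.nonneg (w - u)
  have hf : (1 : ℝ) ≤ j.factorial := by exact_mod_cast Nat.one_le_iff_ne_zero.2 j.factorial_ne_zero
  have hu : |u| ≤ (1 + |w|) * (1 + |w - u|) := by
    have : |u| ≤ |w| + |w - u| := by
      have := abs_sub w (w - u)
      simpa using this
    nlinarith [abs_nonneg w, abs_nonneg (w - u)]
  have h1 : (1 : ℝ) ≤ (1 + |w|) * (1 + |w - u|) := by nlinarith [abs_nonneg w, abs_nonneg (w - u)]
  rw [norm_mul, norm_div, norm_pow, Real.norm_eq_abs, Real.norm_of_nonneg h0, ← mul_assoc,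
    ← mul_pow, Real.norm_natCast]
  gcongr
  calc |u| ^ j / j.factorial ≤ |u| ^ j := div_le_self (by positivity) hf
    _ ≤ ((1 + |w|) * (1 + |w - u|)) ^ j := by gcongr
    _ ≤ ((1 + |w|) * (1 + |w - u|)) ^ M := pow_le_pow_right₀ h1 hj

theorem IsKernel.integrable_comp {M : ℕ} {ψ : ℝ → ℝ} {k : ℝ → ℂ} (K : IsKernel M ψ k) (w : ℝ) :
    Integrable fun u => (1 + |w - u|) ^ M * ψ (w - u) :=
  K.integrable.comp_sub_left w

theorem IsKernel.tendsto_polar {M : ℕ} {ψ : ℝ → ℝ} {k : ℝ → ℂ} (K : IsKernel M ψ k) {j : ℕ}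
    (hj : j ≤ M) (w : ℝ) :
    Tendsto (fun ε : ℝ => ∫ u in Set.Ioi (0 : ℝ), u ^ j / j.factorial * Real.exp (-ε * u) * ψ (w - u))
      (𝓝[>] 0) (𝓝 (∫ u in Set.Ioi (0 : ℝ), u ^ j / j.factorial * ψ (w - u))) := by
  have hc := K.continuous
  refine tendsto_integral_filter_of_dominated_convergence
    (fun u => (1 + |w|) ^ M * ((1 + |w - u|) ^ M * ψ (w - u))) ?_ ?_ ?_ ?_
  · exact Eventually.of_forall fun ε => Continuous.aestronglyMeasurable (by fun_prop)
  · filter_upwards [self_mem_nhdsWithin] with ε hε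
    filter_upwards [ae_restrict_mem measurableSet_Ioi] with u hu
    refine le_trans ?_ (K.pow_mul_le hj w u)
    rw [mul_right_comm, norm_mul _ (Real.exp _)]
    refine mul_le_of_le_one_right (norm_nonneg _) ?_
    rw [Real.norm_of_nonneg (Real.exp_nonneg _), Real.exp_le_one_iff]
    have := mul_pos (Set.mem_Ioi.1 hε) (Set.mem_Ioi.1 hu)
    linarith
  · exact ((K.integrable_comp w).const_mul _).integrableOn
  · refine Eventually.of_forall fun u => ?_
    have : Continuous fun ε : ℝ => u ^ j / j.factorial * Real.exp (-ε * u) * ψ (w - u) := by fun_prop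
    have h := this.tendsto 0
    simp only [neg_zero, zero_mul, Real.exp_zero, mul_one] at h
    exact h.mono_left nhdsWithin_le_nhds

theorem continuous_vertical {α : ℝ} {Φ : ℂ → ℂ} (hΦ : ContinuousOn Φ {s : ℂ | α ≤ s.re}) {ε : ℝ}
    (hε : 0 ≤ ε) : Continuous fun t : ℝ => Φ ((α + ε : ℝ) + t * I) := by
  refine hΦ.comp_continuous (by fun_prop) fun t => ?_
  simp [hε]

theorem IsKernel.tendsto_boundary {M : ℕ} {ψ : ℝ → ℝ} {k : ℝ → ℂ} (K : IsKernel M ψ k)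
    {α : ℝ} {Φ : ℂ → ℂ} (hΦ : ContinuousOn Φ {s : ℂ | α ≤ s.re}) (w : ℝ) :
    Tendsto (fun ε : ℝ => ∫ t : ℝ, k t * cexp (I * w * t) * Φ ((α + ε : ℝ) + t * I))
      (𝓝[>] 0) (𝓝 (∫ t : ℝ, k t * cexp (I * w * t) * Φ (α + t * I))) := by
  have hkc := K.continuous_fourier
  have hki : Integrable k := hkc.integrable_of_hasCompactSupport K.hasCompactSupport
  obtain ⟨B, hB⟩ : ∃ B, ∀ ε ∈ Set.Icc (0 : ℝ) 1, ∀ t ∈ tsupport k,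
      ‖Φ ((α + ε : ℝ) + t * I)‖ ≤ B := by
    have hcomp : IsCompact (Set.Icc (0 : ℝ) 1 ×ˢ tsupport k) :=
      isCompact_Icc.prod K.hasCompactSupport
    have hco : ContinuousOn (fun p : ℝ × ℝ => Φ ((α + p.1 : ℝ) + p.2 * I))
        (Set.Icc (0 : ℝ) 1 ×ˢ tsupport k) := by
      refine hΦ.comp (Continuous.continuousOn (by fun_prop)) fun p hp => ?_
      simpa using hp.1.1
    obtain ⟨B, hB⟩ := hcomp.exists_bound_of_continuousOn hco
    exact ⟨B, fun ε hε t ht => hB (ε, t) ⟨hε, ht⟩⟩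
  refine tendsto_integral_filter_of_dominated_convergence (fun t => ‖k t‖ * B) ?_ ?_ ?_ ?_
  · filter_upwards [self_mem_nhdsWithin] with ε hε
    have := continuous_vertical hΦ (le_of_lt (Set.mem_Ioi.1 hε))
    exact Continuous.aestronglyMeasurable (Continuous.mul (by fun_prop) this)
  · filter_upwards [Ioo_mem_nhdsGT (zero_lt_one' ℝ)] with ε hε
    refine Eventually.of_forall fun t => ?_
    rw [norm_mul, norm_mul, show I * w * t = (w * t : ℝ) * I by push_cast; ring,
        Complex.norm_exp_ofReal_mul_I, mul_one]
    by_cases ht : t ∈ tsupport k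
    · gcongr
      exact hB ε ⟨hε.1.le, hε.2.le⟩ t ht
    · rw [image_eq_zero_of_notMem_tsupport ht]; simp
  · exact hki.norm.mul_const _
  · refine Eventually.of_forall fun t => ?_
    refine Tendsto.const_mul _ ?_
    have h0 : ((α : ℂ) + t * I) ∈ {s : ℂ | α ≤ s.re} := by simp
    refine (hΦ _ h0).tendsto.comp (tendsto_nhdsWithin_iff.2 ⟨?_, ?_⟩)
    · have : Continuous fun ε : ℝ => ((α + ε : ℝ) + t * I : ℂ) := by fun_prop
      have h := this.tendsto 0
      rw [add_zero] at h
      exact h.mono_left nhdsWithin_le_nhds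
    · filter_upwards [self_mem_nhdsWithin] with ε hε
      simpa using le_of_lt (Set.mem_Ioi.1 hε)

theorem IsKernel.hasSum {a : ℕ → ℝ} {α : ℝ} {M : ℕ} {μ : ℕ → ℂ} {Φ : ℂ → ℂ}
    (H : HasPolarPart a α M μ Φ) {ψ : ℝ → ℝ} {k : ℝ → ℂ} (K : IsKernel M ψ k) (w : ℝ) :
    HasSum (fun δ : ℕ => a δ * ((δ : ℝ) + 1) ^ (-α) * ψ (w - Real.log (δ + 1)))
      (smoothedSum α M μ Φ ψ k w).re := by
  have hkc := K.continuous_fourier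
  let S : ℝ → ℂ := fun ε => (∑ j ∈ Finset.range (M + 1), μ j *
    ((∫ u in Set.Ioi (0 : ℝ), u ^ j / j.factorial * Real.exp (-ε * u) * ψ (w - u) : ℝ) : ℂ)) +
    ∫ t : ℝ, k t * cexp (I * w * t) * Φ ((α + ε : ℝ) + t * I)
  let f : ℝ → ℕ → ℝ := fun ε δ => a δ * ((δ : ℝ) + 1) ^ (-(α + ε)) * ψ (w - Real.log (δ + 1))
  have hS : ∀ ε, 0 < ε → HasSum (f ε) (S ε).re := by
    intro ε hε
    have h := K.hasSum_of_pos H w hε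
    have hne : ∀ t : ℝ, (ε : ℂ) + t * I ≠ 0 := fun t h => by
      have := congrArg Complex.re h
      simp at this
      exact hε.ne' this
    have hpi : ∀ j, Integrable (fun t : ℝ => k t * cexp (I * w * t) * (μ j / ((ε : ℂ) + t * I) ^ (j + 1)))
        := by
      intro j
      refine Continuous.integrable_of_hasCompactSupport ?_ ?_
      · refine Continuous.mul (by fun_prop) (continuous_const.div (by fun_prop) fun t => ?_)
        exact pow_ne_zero _ (hne t)
      · exact (K.hasCompactSupport.mul_right).mul_right
    have hΦi : Integrable (fun t : ℝ => k t * cexp (I * w * t) * Φ ((α + ε : ℝ) + t * I)) := by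
      have := continuous_vertical H.continuousOn hε.le
      exact Continuous.integrable_of_hasCompactSupport (Continuous.mul (by fun_prop) this)
        (K.hasCompactSupport.mul_right).mul_right
    have e : (∫ t : ℝ, k t * cexp (I * w * t) *
        ((∑ j ∈ Finset.range (M + 1), μ j / ((ε : ℂ) + t * I) ^ (j + 1)) +
          Φ ((α + ε : ℝ) + t * I))) = S ε := by
      simp_rw [mul_add, Finset.mul_sum]
      rw [integral_add (integrable_finsetSum _ fun j _ => hpi j) hΦi,
        integral_finsetSum _ fun j _ => hpi j]
      simp only [S]
      congr 1
      refine Finset.sum_congr rfl fun j _ => ?_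
      rw [← K.integral_polar w hε j, ← integral_const_mul]
      refine integral_congr_ae (Eventually.of_forall fun t => ?_)
      simp only
      ring
    rw [e] at h
    exact Complex.hasSum_re h
  have hlim : Tendsto (fun ε => (S ε).re) (𝓝[>] 0) (𝓝 (smoothedSum α M μ Φ ψ k w).re) := by
    refine (Complex.continuous_re.tendsto _).comp (Tendsto.add ?_ (K.tendsto_boundary H.continuousOn w))
    refine tendsto_finsetSum _ fun j hj => Tendsto.const_mul _ ?_
    exact (Complex.continuous_ofReal.tendsto _).comp
      (K.tendsto_polar (by simpa [Nat.lt_succ_iff] using hj) w)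
  have hf0 : ∀ ε δ, 0 ≤ f ε δ := fun ε δ =>
    mul_nonneg (mul_nonneg (H.nonneg δ) (by positivity)) (K.nonneg _)
  have hfle : ∀ ε, 0 < ε → ∀ δ, f ε δ ≤ f 0 δ := by
    intro ε hε δ
    have h1 := K.nonneg (w - Real.log (δ + 1))
    have h2 := H.nonneg δ
    have h3 : ((δ : ℝ) + 1) ^ (-(α + ε)) ≤ ((δ : ℝ) + 1) ^ (-(α + 0)) :=
      Real.rpow_le_rpow_of_exponent_le (by linarith [(Nat.cast_nonneg δ : (0 : ℝ) ≤ δ)]) (by linarith)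
    simp only [f]
    gcongr
  have hft : ∀ δ, Tendsto (fun ε => f ε δ) (𝓝[>] 0) (𝓝 (f 0 δ)) := by
    intro δ
    have hp : (0 : ℝ) < δ + 1 := by positivity
    have : Continuous fun ε => f ε δ := by
      simp only [f]
      exact (continuous_const.mul (continuous_const.rpow (by fun_prop) fun _ => Or.inl hp.ne')).mul
        continuous_const
    exact (this.tendsto 0).mono_left nhdsWithin_le_nhds
  have hle : ∀ s : Finset ℕ, ∑ δ ∈ s, f 0 δ ≤ (smoothedSum α M μ Φ ψ k w).re := by
    intro s
    refine le_of_tendsto_of_tendsto (tendsto_finsetSum s fun δ _ => hft δ) hlim ?_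
    filter_upwards [self_mem_nhdsWithin] with ε hε
    exact sum_le_hasSum s (fun δ _ => hf0 ε δ) (hS ε hε)
  have hsum : Summable (f 0) := summable_of_sum_le (hf0 0) hle
  have h1 : ∑' δ, f 0 δ ≤ (smoothedSum α M μ Φ ψ k w).re := hsum.tsum_le_of_sum_le hle
  have h2 : (smoothedSum α M μ Φ ψ k w).re ≤ ∑' δ, f 0 δ := by
    refine le_of_tendsto hlim ?_
    filter_upwards [self_mem_nhdsWithin] with ε hε
    exact hasSum_le (hfle ε hε) (hS ε hε) hsum.hasSum
  have h3 := hsum.hasSum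
  rw [le_antisymm h1 h2] at h3
  simpa [f] using h3

theorem IsKernel.tendsto_smoothedSum {α : ℝ} {M : ℕ} {μ : ℕ → ℂ} {Φ : ℂ → ℂ}
    {ψ : ℝ → ℝ} {k : ℝ → ℂ} (K : IsKernel M ψ k) :
    Tendsto (fun w : ℝ => smoothedSum α M μ Φ ψ k w / (w : ℂ) ^ M) atTop
      (𝓝 (μ M / M.factorial * ((∫ v, ψ v : ℝ) : ℂ))) := by
  have hc := K.continuous
  have hpol : ∀ j ≤ M, Tendsto (fun w : ℝ =>
      (∫ u in Set.Ioi (0 : ℝ), u ^ j / j.factorial * ψ (w - u)) / w ^ M) atTop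
      (𝓝 (if j = M then (∫ v, ψ v) / M.factorial else 0)) := by
    intro j hj
    have h1 : ∀ w : ℝ, (∫ u in Set.Ioi (0 : ℝ), u ^ j / j.factorial * ψ (w - u)) / w ^ M =
        ∫ v, Set.indicator (Set.Iio w) (fun v => (w - v) ^ j / j.factorial * ψ v / w ^ M) v := by
      intro w
      rw [integral_indicator measurableSet_Iio, integral_div, ← integral_indicator measurableSet_Ioi,
        ← integral_indicator measurableSet_Iio, ← integral_sub_left_eq_self _ volume w]
      congr 2 with v
      simp [Set.indicator_apply]
    simp_rw [h1]
    have h2 : (if j = M then (∫ v, ψ v) / M.factorial else 0) =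
        ∫ v, if j = M then ψ v / M.factorial else 0 := by
      split_ifs
      · rw [integral_div]
      · simp
    rw [h2]
    refine tendsto_integral_filter_of_dominated_convergence (fun v => (1 + |v|) ^ M * ψ v) ?_ ?_
      K.integrable ?_
    · refine Eventually.of_forall fun w => ?_
      exact (Continuous.aestronglyMeasurable (by fun_prop)).indicator measurableSet_Iio
    · filter_upwards [eventually_ge_atTop 1] with w hw
      refine Eventually.of_forall fun v => ?_
      have h0 := K.nonneg v
      refine (norm_indicator_le_norm_self _ _).trans ?_
      have hf : (1 : ℝ) ≤ j.factorial := by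
        exact_mod_cast Nat.one_le_iff_ne_zero.2 j.factorial_ne_zero
      rw [norm_div, norm_mul, norm_div, norm_pow, Real.norm_of_nonneg h0, Real.norm_natCast,
        Real.norm_of_nonneg (by positivity : 0 ≤ w ^ M), mul_div_right_comm]
      gcongr
      rw [div_le_iff₀ (by positivity), ← mul_pow]
      have hb : ‖w - v‖ ≤ (1 + |v|) * w := by
        have := norm_sub_le w v
        rw [Real.norm_eq_abs w, abs_of_nonneg (by linarith), Real.norm_eq_abs v] at this
        nlinarith [abs_nonneg v]
      have hb1 : 1 ≤ (1 + |v|) * w := by nlinarith [abs_nonneg v]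
      calc ‖w - v‖ ^ j / j.factorial ≤ ‖w - v‖ ^ j := div_le_self (by positivity) hf
        _ ≤ ((1 + |v|) * w) ^ j := by gcongr
        _ ≤ _ := pow_le_pow_right₀ hb1 hj
    · refine Eventually.of_forall fun v => ?_
      have hq : Tendsto (fun w : ℝ => (w - v) / w) atTop (𝓝 1) := by
        have : Tendsto (fun w : ℝ => 1 - v * w⁻¹) atTop (𝓝 (1 - v * 0)) :=
          tendsto_const_nhds.sub (tendsto_inv_atTop_zero.const_mul v)
        rw [mul_zero, sub_zero] at this
        refine this.congr' ?_
        filter_upwards [eventually_gt_atTop 0] with w hw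
        field_simp
      have hr : Tendsto (fun w : ℝ => ((w ^ (M - j))⁻¹ : ℝ)) atTop (𝓝 (if j = M then 1 else 0)) := by
        split_ifs with h
        · subst h; simp
        · exact tendsto_inv_atTop_zero.comp (tendsto_pow_atTop (by omega))
      have h3 := ((hq.pow j).mul hr).mul_const (ψ v / j.factorial)
      have e : (if j = M then ψ v / M.factorial else 0) =
          1 ^ j * (if j = M then (1 : ℝ) else 0) * (ψ v / j.factorial) := by
        split_ifs with h
        · subst h; simp
        · simp
      rw [e]
      refine h3.congr' ?_
      filter_upwards [eventually_gt_atTop v, eventually_gt_atTop 0] with w hw hw0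
      rw [Set.indicator_of_mem (Set.mem_Iio.2 hw), div_pow]
      have : w ^ M = w ^ j * w ^ (M - j) := by rw [← pow_add]; congr 1; omega
      rw [this]
      field_simp
  have hb : Tendsto (fun w : ℝ => (∫ t : ℝ, k t * cexp (I * w * t) * Φ (α + t * I)) / (w : ℂ) ^ M)
      atTop (𝓝 0) := by
    have hRL : Tendsto (fun w : ℝ => ∫ t : ℝ, k t * cexp (I * w * t) * Φ (α + t * I)) atTop (𝓝 0) := by
      have h := Real.tendsto_integral_exp_smul_cocompact (fun t : ℝ => k t * Φ (α + t * I))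
      have hs : Tendsto (fun w : ℝ => -(2 * Real.pi)⁻¹ * w) atTop (cocompact ℝ) := by
        refine Tendsto.mono_right ?_ atBot_le_cocompact
        exact tendsto_id.const_mul_atTop_of_neg (by simp [Real.pi_pos])
      refine (h.comp hs).congr fun w => ?_
      refine integral_congr_ae (Eventually.of_forall fun t => ?_)
      simp only
      rw [Circle.smul_def, Real.fourierChar_apply, smul_eq_mul,
        show (2 * Real.pi * -(t * (-(2 * Real.pi)⁻¹ * w)) : ℝ) = w * t by
          field_simp [Real.pi_ne_zero]]
      rw [show ((w * t : ℝ) : ℂ) * I = I * w * t by push_cast; ring]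
      ring
    refine squeeze_zero_norm' ?_ (tendsto_zero_iff_norm_tendsto_zero.1 hRL)
    filter_upwards [eventually_ge_atTop 1] with w hw
    rw [norm_div, norm_pow, Complex.norm_real, Real.norm_of_nonneg (by linarith)]
    exact div_le_self (norm_nonneg _) (one_le_pow₀ hw)
  have hsum : Tendsto (fun w : ℝ => ∑ j ∈ Finset.range (M + 1), μ j * (((
      (∫ u in Set.Ioi (0 : ℝ), u ^ j / j.factorial * ψ (w - u)) / w ^ M : ℝ)) : ℂ)) atTop
      (𝓝 (∑ j ∈ Finset.range (M + 1),
        μ j * ((if j = M then (∫ v, ψ v) / M.factorial else 0 : ℝ) : ℂ))) :=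
    tendsto_finsetSum _ fun j hj => Tendsto.const_mul _
      ((Complex.continuous_ofReal.tendsto _).comp (hpol j (by simpa [Nat.lt_succ_iff] using hj)))
  have h := hsum.add hb
  have e : ∑ j ∈ Finset.range (M + 1),
      μ j * ((if j = M then (∫ v, ψ v) / M.factorial else 0 : ℝ) : ℂ) + 0 =
      μ M / M.factorial * ((∫ v, ψ v : ℝ) : ℂ) := by
    rw [add_zero, Finset.sum_eq_single M]
    · rw [if_pos rfl]; push_cast; ring
    · intro j _ hj; simp [hj]
    · simp
  rw [e] at h
  refine h.congr fun w => ?_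
  rw [smoothedSum, add_div, Finset.sum_div]
  congr 1
  refine Finset.sum_congr rfl fun j _ => ?_
  push_cast
  ring

theorem exists_concentrated_kernel (M : ℕ) {η ε : ℝ} (hη : 0 < η) (hε : 0 < ε) :
    ∃ (φ : ℝ → ℝ) (k : ℝ → ℂ), IsKernel M φ k ∧ ∫ v, φ v = 1 ∧
      ∫ v in {v : ℝ | η < |v|}, (1 + |v|) ^ M * φ v ≤ ε := by
  obtain ⟨φ, k, hφc, hφ0, hkc, hks, hφk, hφi, hφ1⟩ := exists_kernel M
  have hms : ∀ c : ℝ, MeasurableSet {v : ℝ | c < |v|} := fun c =>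
    measurableSet_lt measurable_const (by fun_prop)
  have hlim : Tendsto (fun l : ℝ => ∫ v in {v : ℝ | l * η < |v|}, (1 + |v|) ^ M * φ v) atTop (𝓝 0) := by
    have h0 : (0 : ℝ) = ∫ v : ℝ, (0 : ℝ) := by simp
    rw [h0]
    simp_rw [← integral_indicator (hms _)]
    refine tendsto_integral_filter_of_dominated_convergence (fun v => (1 + |v|) ^ M * φ v) ?_ ?_ hφi ?_
    · exact Eventually.of_forall fun l =>
        (Continuous.aestronglyMeasurable (by fun_prop)).indicator (hms _)
    · refine Eventually.of_forall fun l => Eventually.of_forall fun v => ?_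
      refine (norm_indicator_le_norm_self _ _).trans ?_
      rw [Real.norm_of_nonneg (mul_nonneg (by positivity) (hφ0 v))]
    · refine Eventually.of_forall fun v => ?_
      refine tendsto_const_nhds.congr' ?_
      filter_upwards [eventually_ge_atTop (|v| / η)] with l hl
      rw [Set.indicator_of_notMem]
      simpa using (div_le_iff₀ hη).1 hl
  obtain ⟨l, hl1, hl⟩ := ((eventually_ge_atTop (1 : ℝ)).and (hlim.eventually_le_const hε)).exists
  have hl0 : 0 < l := by linarith
  have hcomp : Integrable fun v => l * ((1 + |l * v|) ^ M * φ (l * v)) :=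
    (hφi.comp_mul_left' hl0.ne').const_mul l
  have hle : ∀ v, (1 + |v|) ^ M * (l * φ (l * v)) ≤ l * ((1 + |l * v|) ^ M * φ (l * v)) := by
    intro v
    have h1 := hφ0 (l * v)
    have h2 : |v| ≤ |l * v| := by
      rw [abs_mul, abs_of_pos hl0]
      exact le_mul_of_one_le_left (abs_nonneg v) hl1
    rw [mul_left_comm]
    gcongr
  have hintg : Integrable fun v => (1 + |v|) ^ M * (l * φ (l * v)) := by
    refine hcomp.mono' (Continuous.aestronglyMeasurable (by fun_prop))
      (Eventually.of_forall fun v => ?_)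
    rw [Real.norm_of_nonneg (mul_nonneg (by positivity) (mul_nonneg hl0.le (hφ0 _)))]
    exact hle v
  refine ⟨fun v => l * φ (l * v), fun t => k (l⁻¹ * t), ⟨fun v => mul_nonneg hl0.le (hφ0 _),
    by fun_prop, ?_, ?_, hintg⟩, ?_, ?_⟩
  · exact hks.comp_homeomorph (Homeomorph.mulLeft₀ _ (inv_ne_zero hl0.ne'))
  · intro v
    have h := Measure.integral_comp_mul_left (fun t => k t * cexp (I * (l * v : ℝ) * t)) l⁻¹
    rw [inv_inv, abs_of_pos hl0, ← hφk] at h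
    rw [ofReal_mul, ← real_smul, ← h]
    refine integral_congr_ae (Eventually.of_forall fun t => ?_)
    simp only
    congr 2
    push_cast
    have : (l : ℂ) ≠ 0 := by exact_mod_cast hl0.ne'
    field_simp
  · rw [integral_const_mul, Measure.integral_comp_mul_left, hφ1, abs_of_pos (inv_pos.2 hl0)]
    simp [hl0.ne']
  · refine le_trans ?_ hl
    calc _ ≤ ∫ v in {v : ℝ | η < |v|}, l * ((1 + |l * v|) ^ M * φ (l * v)) :=
          setIntegral_mono hintg.integrableOn hcomp.integrableOn hle
      _ = ∫ v in {v : ℝ | l * η < |v|}, (1 + |v|) ^ M * φ v := by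
          rw [integral_const_mul, ← integral_indicator (hms _), ← integral_indicator (hms _)]
          have h := Measure.integral_comp_mul_left
            (Set.indicator {v : ℝ | l * η < |v|} fun v => (1 + |v|) ^ M * φ v) l
          rw [abs_of_pos (inv_pos.2 hl0), smul_eq_mul] at h
          have h2 : ∀ v : ℝ, Set.indicator {v : ℝ | η < |v|} (fun v => (1 + |l * v|) ^ M * φ (l * v)) v =
              Set.indicator {v : ℝ | l * η < |v|} (fun v => (1 + |v|) ^ M * φ v) (l * v) := by
            intro v
            simp only [Set.indicator_apply, Set.mem_ofPred_eq, abs_mul l v, abs_of_pos hl0,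
              mul_lt_mul_iff_right₀ hl0]
          simp_rw [h2]
          rw [h, ← mul_assoc, mul_inv_cancel₀ hl0.ne', one_mul]

theorem tendsto_div_pow_of_smoothed {H : ℝ → ℝ} {β C A : ℝ} {M : ℕ} (hβ : 0 < β) (hA : 0 ≤ A)
    (hH0 : ∀ w, 0 ≤ H w) (hmono : Monotone fun w => Real.exp (β * w) * H w)
    (hexp : ∀ w, H w ≤ C * Real.exp w)
    (hsm : ∀ (φ : ℝ → ℝ) (k : ℝ → ℂ), IsKernel M φ k → ∫ v, φ v = 1 →
      (∀ w, Integrable fun y => φ y * H (w - y)) ∧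
      Tendsto (fun w => (∫ y, φ y * H (w - y)) / w ^ M) atTop (𝓝 A)) :
    Tendsto (fun w => H w / w ^ M) atTop (𝓝 A) := by
  have hratio : ∀ {w w' η : ℝ}, 0 ≤ η → w ≤ w' → w' ≤ w + 2 * η →
      H w ≤ Real.exp (2 * β * η) * H w' := by
    intro w w' η hη h1 h2
    have h := hmono h1
    simp only at h
    have h3 : H w ≤ Real.exp (β * (w' - w)) * H w' := by
      rw [mul_sub, Real.exp_sub, div_mul_eq_mul_div, le_div_iff₀ (Real.exp_pos _)]
      linarith
    refine h3.trans ?_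
    refine mul_le_mul_of_nonneg_right (Real.exp_le_exp.2 ?_) (hH0 w')
    nlinarith
  have hset : ∀ η : ℝ, {y : ℝ | η < |y|}ᶜ = {y : ℝ | |y| ≤ η} := by
    intro η; ext y; simp
  have hms : ∀ η : ℝ, MeasurableSet {v : ℝ | η < |v|} := fun c =>
    measurableSet_lt measurable_const (by fun_prop)
  have hφint : ∀ {φ : ℝ → ℝ} {k : ℝ → ℂ}, IsKernel M φ k → Integrable φ := by
    intro φ k K
    refine K.integrable.mono' K.continuous.aestronglyMeasurable (Eventually.of_forall fun v => ?_)
    rw [Real.norm_of_nonneg (K.nonneg v)]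
    exact le_mul_of_one_le_left (K.nonneg v) (one_le_pow₀ (by linarith [abs_nonneg v]))
  have hupper : ∀ η ε : ℝ, 0 < η → 0 < ε → ∃ φ : ℝ → ℝ, ∃ k : ℝ → ℂ, IsKernel M φ k ∧
      ∫ v, φ v = 1 ∧ (∫ v in {v : ℝ | η < |v|}, (1 + |v|) ^ M * φ v ≤ ε) ∧
      ∀ w, (1 - ε) * H w ≤ Real.exp (2 * β * η) * ∫ y, φ y * H (w + η - y) := by
    intro η ε hη hε
    obtain ⟨φ, k, K, h1, h2⟩ := exists_concentrated_kernel M hη hε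
    refine ⟨φ, k, K, h1, h2, fun w => ?_⟩
    have hin := (hsm φ k K h1).1 (w + η)
    have hq : 1 - ε ≤ ∫ y in {y : ℝ | |y| ≤ η}, φ y := by
      have h3 := integral_add_compl (hms η) (hφint K)
      rw [h1, hset] at h3
      have h4 : ∫ y in {y : ℝ | η < |y|}, φ y ≤ ∫ v in {v : ℝ | η < |v|}, (1 + |v|) ^ M * φ v := by
        refine setIntegral_mono (hφint K).integrableOn K.integrable.integrableOn fun v => ?_
        exact le_mul_of_one_le_left (K.nonneg v) (one_le_pow₀ (by linarith [abs_nonneg v]))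
      linarith
    calc (1 - ε) * H w ≤ (∫ y in {y : ℝ | |y| ≤ η}, φ y) * H w := by
          have := hH0 w
          gcongr
      _ = ∫ y in {y : ℝ | |y| ≤ η}, φ y * H w := by rw [integral_mul_const]
      _ ≤ ∫ y in {y : ℝ | |y| ≤ η}, Real.exp (2 * β * η) * (φ y * H (w + η - y)) := by
          refine setIntegral_mono_on ((hφint K).mul_const _).integrableOn
            (hin.const_mul _).integrableOn (by rw [← hset]; exact (hms η).compl) fun y hy => ?_
          have hy' := abs_le.1 (show |y| ≤ η from hy)
          have := hratio (w := w) (w' := w + η - y) hη.le (by linarith) (by linarith)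
          have h0 := K.nonneg y
          calc φ y * H w ≤ φ y * (Real.exp (2 * β * η) * H (w + η - y)) := by gcongr
            _ = _ := by ring
      _ ≤ ∫ y, Real.exp (2 * β * η) * (φ y * H (w + η - y)) := by
          refine setIntegral_le_integral (hin.const_mul _) (Eventually.of_forall fun y => ?_)
          exact mul_nonneg (Real.exp_nonneg _) (mul_nonneg (K.nonneg y) (hH0 _))
      _ = _ := integral_const_mul _ _
  have hshift : ∀ c : ℝ, Tendsto (fun w : ℝ => (w + c) ^ M / w ^ M) atTop (𝓝 1) := by
    intro c
    have : Tendsto (fun w : ℝ => (1 + c * w⁻¹) ^ M) atTop (𝓝 ((1 + c * 0) ^ M)) :=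
      (tendsto_const_nhds.add (tendsto_inv_atTop_zero.const_mul c)).pow M
    rw [mul_zero, add_zero, one_pow] at this
    refine this.congr' ?_
    filter_upwards [eventually_gt_atTop 0] with w hw
    rw [← div_pow]
    congr 1
    field_simp
  have hconv : ∀ (φ : ℝ → ℝ) (k : ℝ → ℂ), IsKernel M φ k → ∫ v, φ v = 1 → ∀ c : ℝ,
      Tendsto (fun w => (∫ y, φ y * H (w + c - y)) / w ^ M) atTop (𝓝 A) := by
    intro φ k K h1 c
    have h := ((hsm φ k K h1).2.comp (tendsto_atTop_add_const_right atTop c tendsto_id)).mul (hshift c)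
    rw [mul_one] at h
    refine h.congr' ?_
    filter_upwards [eventually_gt_atTop (-c)] with w hw
    have : w + c ≠ 0 := by linarith
    simp only [Function.comp, id]
    field_simp
  obtain ⟨D, hD0, hD⟩ : ∃ D, 0 ≤ D ∧ ∀ w, H w ≤ D * (1 + |w|) ^ M := by
    obtain ⟨φ, k, K, h1, -, h2⟩ := hupper 1 (1 / 2) one_pos (by norm_num)
    have h3 := (hconv φ k K h1 1).eventually_le_const (lt_add_one A)
    obtain ⟨w₀, hw₀⟩ := eventually_atTop.1 (h3.and (eventually_ge_atTop 1))
    have hC : 0 ≤ C := by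
      have := (hH0 0).trans (hexp 0)
      simpa using this
    refine ⟨max (2 * (Real.exp (2 * β * 1) * (A + 1))) (C * Real.exp w₀), le_max_of_le_right
      (by positivity), fun w => ?_⟩
    rcases le_total w₀ w with hw | hw
    · obtain ⟨h4, h5⟩ := hw₀ w hw
      rw [div_le_iff₀ (by positivity)] at h4
      have h6 := h2 w
      have h7 : w ^ M ≤ (1 + |w|) ^ M := by
        gcongr
        rw [abs_of_nonneg (by linarith)]
        linarith
      calc H w ≤ 2 * (Real.exp (2 * β * 1) * ∫ y, φ y * H (w + 1 - y)) := by linarith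
        _ ≤ 2 * (Real.exp (2 * β * 1) * ((A + 1) * (1 + |w|) ^ M)) := by
            gcongr
            exact h4.trans (by gcongr)
        _ = 2 * (Real.exp (2 * β * 1) * (A + 1)) * (1 + |w|) ^ M := by ring
        _ ≤ _ := by gcongr; exact le_max_left _ _
    · have h8 : (1 : ℝ) ≤ (1 + |w|) ^ M := one_le_pow₀ (by linarith [abs_nonneg w])
      calc H w ≤ C * Real.exp w := hexp w
        _ ≤ C * Real.exp w₀ := by gcongr
        _ ≤ max (2 * (Real.exp (2 * β * 1) * (A + 1))) (C * Real.exp w₀) := le_max_right _ _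
        _ ≤ _ := le_mul_of_one_le_right (le_max_of_le_right (by positivity)) h8
  have hlower : ∀ η ε : ℝ, 0 < η → 0 < ε → ∃ φ : ℝ → ℝ, ∃ k : ℝ → ℂ, IsKernel M φ k ∧
      ∫ v, φ v = 1 ∧
      ∀ w, ∫ y, φ y * H (w - η - y) ≤
        Real.exp (2 * β * η) * H w + D * (1 + η) ^ M * ε * (1 + |w|) ^ M := by
    intro η ε hη hε
    obtain ⟨φ, k, K, h1, h2⟩ := exists_concentrated_kernel M hη hε
    refine ⟨φ, k, K, h1, fun w => ?_⟩
    have hin := (hsm φ k K h1).1 (w - η)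
    rw [← integral_add_compl (hms η) hin, hset, add_comm]
    refine add_le_add ?_ ?_
    · calc _ ≤ ∫ y in {y : ℝ | |y| ≤ η}, φ y * (Real.exp (2 * β * η) * H w) := by
            refine setIntegral_mono_on hin.integrableOn ((hφint K).mul_const _).integrableOn
              (by rw [← hset]; exact (hms η).compl) fun y hy => ?_
            have hy' := abs_le.1 (show |y| ≤ η from hy)
            have := hratio (w := w - η - y) (w' := w) hη.le (by linarith) (by linarith)
            have h0 := K.nonneg y
            gcongr
        _ ≤ ∫ y, φ y * (Real.exp (2 * β * η) * H w) := by
            refine setIntegral_le_integral ((hφint K).mul_const _) (Eventually.of_forall fun y => ?_)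
            exact mul_nonneg (K.nonneg y) (mul_nonneg (Real.exp_nonneg _) (hH0 _))
        _ = _ := by rw [integral_mul_const, h1, one_mul]
    · calc _ ≤ ∫ y in {v : ℝ | η < |v|},
            (D * (1 + η) ^ M * (1 + |w|) ^ M) * ((1 + |y|) ^ M * φ y) := by
            refine setIntegral_mono hin.integrableOn (K.integrable.const_mul _).integrableOn fun y => ?_
            have h0 := K.nonneg y
            have h3 : 1 + |w - η - y| ≤ (1 + η) * (1 + |w|) * (1 + |y|) := by
              have h4 : |w - η - y| ≤ |w| + η + |y| := by
                have e1 := abs_sub (w - η) y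
                have e2 := abs_sub w η
                rw [abs_of_pos hη] at e2
                linarith
              have p1 := mul_nonneg hη.le (abs_nonneg w)
              have p2 := mul_nonneg hη.le (abs_nonneg y)
              have p3 := mul_nonneg (abs_nonneg w) (abs_nonneg y)
              have p4 := mul_nonneg hη.le p3
              nlinarith
            calc φ y * H (w - η - y) ≤ φ y * (D * (1 + |w - η - y|) ^ M) := by gcongr; exact hD _
              _ ≤ φ y * (D * ((1 + η) * (1 + |w|) * (1 + |y|)) ^ M) := by gcongr
              _ = _ := by rw [mul_pow, mul_pow]; ring
        _ = (D * (1 + η) ^ M * (1 + |w|) ^ M) * ∫ v in {v : ℝ | η < |v|}, (1 + |v|) ^ M * φ v :=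
            integral_const_mul _ _
        _ ≤ (D * (1 + η) ^ M * (1 + |w|) ^ M) * ε := by gcongr
        _ = _ := by ring
  rw [tendsto_order]
  constructor
  · intro B hB
    obtain ⟨η, hη0, hη⟩ : ∃ η : ℝ, 0 < η ∧ Real.exp (2 * β * η) * B < A := by
      have : Tendsto (fun η : ℝ => Real.exp (2 * β * η) * B) (𝓝[>] 0) (𝓝 (Real.exp (2 * β * 0) * B)) :=
        ((Continuous.tendsto (by fun_prop) 0)).mono_left nhdsWithin_le_nhds
      rw [mul_zero, Real.exp_zero, one_mul] at this
      obtain ⟨η, h1, h2⟩ := ((this.eventually_lt_const hB).and self_mem_nhdsWithin).exists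
      exact ⟨η, h2, h1⟩
    obtain ⟨ε, hε0, hε⟩ : ∃ ε : ℝ, 0 < ε ∧ Real.exp (2 * β * η) * B + D * (1 + η) ^ M * ε * 1 < A := by
      have : Tendsto (fun ε : ℝ => Real.exp (2 * β * η) * B + D * (1 + η) ^ M * ε * 1) (𝓝[>] 0)
          (𝓝 (Real.exp (2 * β * η) * B + D * (1 + η) ^ M * 0 * 1)) :=
        ((Continuous.tendsto (by fun_prop) 0)).mono_left nhdsWithin_le_nhds
      rw [mul_zero, zero_mul, add_zero] at this
      obtain ⟨η, h1, h2⟩ := ((this.eventually_lt_const hη).and self_mem_nhdsWithin).exists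
      exact ⟨η, h2, h1⟩
    obtain ⟨φ, k, K, h1, h2⟩ := hlower η ε hη0 hε0
    have h3 := (hconv φ k K h1 (-η)).sub ((hshift 1).const_mul (D * (1 + η) ^ M * ε))
    have h4 := h3.eventually_const_lt (lt_sub_iff_add_lt.2 hε)
    filter_upwards [h4, eventually_gt_atTop 0] with w hw hw0
    have h5 := h2 w
    rw [abs_of_pos hw0] at h5
    have hp : 0 < w ^ M := by positivity
    rw [lt_div_iff₀ hp]
    have h6 : Real.exp (2 * β * η) * B * w ^ M < Real.exp (2 * β * η) * H w := by
      rw [mul_div, ← sub_div, lt_div_iff₀ hp] at hw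
      simp only [← sub_eq_add_neg] at hw
      rw [add_comm w 1] at hw
      linarith
    rw [mul_assoc] at h6
    exact lt_of_mul_lt_mul_left h6 (Real.exp_nonneg _)
  · intro B hB
    obtain ⟨η, hη0, hη⟩ : ∃ η : ℝ, 0 < η ∧ Real.exp (2 * β * η) * A < (1 - η) * B ∧ η < 1 := by
      have : Tendsto (fun η : ℝ => (1 - η) * B - Real.exp (2 * β * η) * A) (𝓝[>] 0)
          (𝓝 ((1 - 0) * B - Real.exp (2 * β * 0) * A)) :=
        ((Continuous.tendsto (by fun_prop) 0)).mono_left nhdsWithin_le_nhds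
      rw [mul_zero, Real.exp_zero, one_mul, sub_zero, one_mul] at this
      obtain ⟨η, h1, h2⟩ := ((this.eventually_const_lt (sub_pos.2 hB)).and
        (Ioo_mem_nhdsGT (zero_lt_one' ℝ))).exists
      exact ⟨η, h2.1, sub_pos.1 h1, h2.2⟩
    obtain ⟨φ, k, K, h1, -, h2⟩ := hupper η η hη0 hη0
    have h4 := ((hconv φ k K h1 η).const_mul (Real.exp (2 * β * η))).eventually_lt_const hη.1
    filter_upwards [h4, eventually_gt_atTop 0] with w hw hw0
    have hp : 0 < w ^ M := by positivity
    rw [div_lt_iff₀ hp]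
    rw [mul_div, div_lt_iff₀ hp] at hw
    have h5 := (h2 w).trans_lt hw
    rw [mul_assoc] at h5
    exact lt_of_mul_lt_mul_left h5 (by linarith [hη.2])

theorem IsKernel.integrable_self {M : ℕ} {ψ : ℝ → ℝ} {k : ℝ → ℂ} (K : IsKernel M ψ k) :
    Integrable ψ := by
  refine K.integrable.mono' K.continuous.aestronglyMeasurable (Eventually.of_forall fun v => ?_)
  rw [Real.norm_of_nonneg (K.nonneg v)]
  exact le_mul_of_one_le_left (K.nonneg v) (one_le_pow₀ (by linarith [abs_nonneg v]))

theorem one_add_abs_pow_le (M : ℕ) (v y : ℝ) :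
    (1 + |v|) ^ M ≤ (1 + |y|) ^ M * (1 + |v - y|) ^ M := by
  rw [← mul_pow]
  gcongr
  have h1 := abs_add_le y (v - y)
  rw [add_sub_cancel] at h1
  nlinarith [mul_nonneg (abs_nonneg y) (abs_nonneg (v - y))]

theorem IsKernel.convolve {M : ℕ} {φ : ℝ → ℝ} {k : ℝ → ℂ} (K : IsKernel M φ k) {h : ℝ → ℝ}
    (hc : Continuous h) (h0 : ∀ v, 0 ≤ h v) (hi : Integrable fun v => (1 + |v|) ^ M * h v)
    (hi1 : Integrable h) :
    IsKernel M (fun v => ∫ y, h y * φ (v - y)) (fun t => k t * ∫ y, (h y : ℂ) * cexp (-I * y * t)) := by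
  have hφc := K.continuous
  have hkc := K.continuous_fourier
  have hki : Integrable k := K.continuous_fourier.integrable_of_hasCompactSupport K.hasCompactSupport
  have hnorm : ∀ a b : ℝ, ‖cexp (-I * a * b)‖ = 1 := by
    intro a b
    rw [show -I * a * b = ((-(a * b) : ℝ) : ℂ) * I by push_cast; ring, norm_exp_ofReal_mul_I]
  have hcont : Continuous fun t : ℝ => ∫ y, (h y : ℂ) * cexp (-I * y * t) := by
    refine continuous_of_dominated (bound := h) (fun t => ?_) (fun t => ?_) hi1 ?_
    · exact Continuous.aestronglyMeasurable (by fun_prop)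
    · refine Eventually.of_forall fun y => ?_
      rw [norm_mul, hnorm, norm_real, Real.norm_of_nonneg (h0 y), mul_one]
    · exact Eventually.of_forall fun y => by fun_prop
  refine ⟨fun v => integral_nonneg fun y => mul_nonneg (h0 y) (K.nonneg _), hkc.mul hcont,
    K.hasCompactSupport.mul_right, fun v => ?_, ?_⟩
  · have hprod : Integrable (Function.uncurry fun (y t : ℝ) => (h y : ℂ) *
        (k t * cexp (I * (v - y : ℝ) * t))) (volume.prod volume) := by
      refine ((hi1.mul_prod hki.norm)).mono' (Continuous.aestronglyMeasurable ?_) ?_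
      · simp only [Function.uncurry_def]; fun_prop
      · refine Eventually.of_forall fun p => ?_
        simp only [Function.uncurry]
        rw [norm_mul, norm_mul, norm_real, Real.norm_of_nonneg (h0 _),
          show I * (v - p.1 : ℝ) * p.2 = (((v - p.1) * p.2 : ℝ) : ℂ) * I by push_cast; ring,
          norm_exp_ofReal_mul_I, mul_one]
    rw [← integral_complex_ofReal]
    simp_rw [ofReal_mul, K.eq_integral, ← integral_const_mul]
    rw [integral_integral_swap hprod]
    refine integral_congr_ae (Eventually.of_forall fun t => ?_)
    simp only
    rw [← integral_mul_const]
    refine integral_congr_ae (Eventually.of_forall fun y => ?_)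
    simp only
    rw [show I * (v - y : ℝ) * t = -I * y * t + I * v * t by push_cast; ring, Complex.exp_add]
    ring
  · have hconv := hi.integrable_convolution (ContinuousLinearMap.mul ℝ ℝ) K.integrable
    have hm := (hi1.integrable_convolution (ContinuousLinearMap.mul ℝ ℝ) K.integrable_self)
    refine hconv.mono' ?_ ?_
    · exact (Continuous.aestronglyMeasurable (by fun_prop)).mul hm.aestronglyMeasurable
    · have hae := (hi.convolution_integrand (ContinuousLinearMap.mul ℝ ℝ) K.integrable
        (μ := volume)).prod_right_ae
      filter_upwards [hae] with v hv
      rw [Real.norm_of_nonneg (mul_nonneg (by positivity)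
        (integral_nonneg fun y => mul_nonneg (h0 y) (K.nonneg _))), ← integral_const_mul,
        convolution_def]
      have hle : ∀ y, (1 + |v|) ^ M * (h y * φ (v - y)) ≤
          ((1 + |y|) ^ M * h y) * ((1 + |v - y|) ^ M * φ (v - y)) := by
        intro y
        have h1 := one_add_abs_pow_le M v y
        have h2 := mul_nonneg (h0 y) (K.nonneg (v - y))
        calc _ ≤ ((1 + |y|) ^ M * (1 + |v - y|) ^ M) * (h y * φ (v - y)) := by gcongr
          _ = _ := by ring
      refine integral_mono_of_nonneg (Eventually.of_forall fun y => ?_) hv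
        (Eventually.of_forall fun y => ?_)
      · exact mul_nonneg (by positivity) (mul_nonneg (h0 y) (K.nonneg _))
      · exact hle y

theorem IsKernel.integral_convolve {M : ℕ} {φ : ℝ → ℝ} {k : ℝ → ℂ} (K : IsKernel M φ k) {h : ℝ → ℝ}
    (hi1 : Integrable h) : ∫ v, ∫ y, h y * φ (v - y) = (∫ v, h v) * ∫ v, φ v :=
  integral_convolution (ContinuousLinearMap.mul ℝ ℝ) hi1 K.integrable_self

/-- A Tauberian theorem for convolution sums of a Dirichlet series with a pole of order `M + 1`. -/
theorem HasPolarPart.tendsto_convolution {a : ℕ → ℝ} {α : ℝ} {M : ℕ} {μ : ℕ → ℂ} {Φ : ℂ → ℂ}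
    (H : HasPolarPart a α M μ Φ) {γ : ℝ} (hγ : 0 ≤ γ) (hμ : μ M = γ) {h : ℝ → ℝ} {β C : ℝ}
    (hβ : 0 < β) (hc : Continuous h) (h0 : ∀ v, 0 ≤ h v)
    (hi : Integrable fun v => (1 + |v|) ^ M * h v)
    (hmono : Monotone fun v => Real.exp (β * v) * h v) (hexp : ∀ v, h v ≤ C * Real.exp v) :
    (∀ w, Summable fun δ : ℕ => a δ * ((δ : ℝ) + 1) ^ (-α) * h (w - Real.log (δ + 1))) ∧
    Tendsto (fun w => (∑' δ : ℕ, a δ * ((δ : ℝ) + 1) ^ (-α) * h (w - Real.log (δ + 1))) / w ^ M)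
      atTop (𝓝 (γ / M.factorial * ∫ v, h v)) := by
  have hi1 : Integrable h := by
    refine hi.mono' hc.aestronglyMeasurable (Eventually.of_forall fun v => ?_)
    rw [Real.norm_of_nonneg (h0 v)]
    exact le_mul_of_one_le_left (h0 v) (one_le_pow₀ (by linarith [abs_nonneg v]))
  have hcoef : ∀ δ : ℕ, 0 ≤ a δ * ((δ : ℝ) + 1) ^ (-α) := fun δ =>
    mul_nonneg (H.nonneg δ) (by positivity)
  have hs1 := summable_rpow_of_polar H (σ := α + 1) (by linarith)
  have hterm : ∀ w (δ : ℕ), a δ * ((δ : ℝ) + 1) ^ (-α) * h (w - Real.log (δ + 1)) ≤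
      C * Real.exp w * (a δ * ((δ : ℝ) + 1) ^ (-(α + 1))) := by
    intro w δ
    have hp : (0 : ℝ) < δ + 1 := by positivity
    calc _ ≤ a δ * ((δ : ℝ) + 1) ^ (-α) * (C * Real.exp (w - Real.log (δ + 1))) :=
          mul_le_mul_of_nonneg_left (hexp _) (hcoef δ)
      _ = _ := by
          rw [Real.exp_sub, Real.exp_log hp, neg_add, Real.rpow_add hp, Real.rpow_neg_one]
          field_simp
  have hnn : ∀ w (δ : ℕ), 0 ≤ a δ * ((δ : ℝ) + 1) ^ (-α) * h (w - Real.log (δ + 1)) := fun w δ =>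
    mul_nonneg (hcoef δ) (h0 _)
  have hsummable : ∀ w, Summable fun δ : ℕ =>
      a δ * ((δ : ℝ) + 1) ^ (-α) * h (w - Real.log (δ + 1)) := fun w =>
    Summable.of_nonneg_of_le (hnn w) (hterm w) (hs1.mul_left _)
  refine ⟨hsummable, ?_⟩
  refine tendsto_div_pow_of_smoothed (C := C * ∑' δ : ℕ, a δ * ((δ : ℝ) + 1) ^ (-(α + 1))) hβ
    (mul_nonneg (by positivity) (integral_nonneg h0)) (fun w => tsum_nonneg (hnn w)) ?_ ?_ ?_
  · intro w w' hw
    simp only [← tsum_mul_left]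
    refine ((hsummable w).mul_left _).tsum_le_tsum (fun δ => ?_) ((hsummable w').mul_left _)
    have h1 := hmono (sub_le_sub_right hw (Real.log (δ + 1)))
    simp only [mul_sub, Real.exp_sub] at h1
    rw [div_mul_eq_mul_div, div_mul_eq_mul_div, div_le_div_iff_of_pos_right (Real.exp_pos _)] at h1
    have h2 := mul_le_mul_of_nonneg_left h1 (hcoef δ)
    linarith
  · intro w
    calc _ ≤ ∑' δ : ℕ, C * Real.exp w * (a δ * ((δ : ℝ) + 1) ^ (-(α + 1))) :=
          (hsummable w).tsum_le_tsum (hterm w) (hs1.mul_left _)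
      _ = _ := by rw [tsum_mul_left]; ring
  · intro φ k K hφ1
    have K' := K.convolve hc h0 hi hi1
    have hflip : ∀ u : ℝ, ∫ y, φ y * h (u - y) = ∫ y, h y * φ (u - y) := by
      intro u
      rw [← integral_sub_left_eq_self _ volume u]
      refine integral_congr_ae (Eventually.of_forall fun y => ?_)
      simp only [sub_sub_cancel]
      ring
    have hφint : ∀ u : ℝ, Integrable fun y => φ y * h (u - y) := by
      intro u
      refine (hi1.comp_sub_left u).bdd_mul (c := ∫ t, ‖k t‖) K.continuous.aestronglyMeasurable
        (Eventually.of_forall fun y => ?_)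
      rw [← norm_real, K.eq_integral]
      refine (norm_integral_le_integral_norm _).trans_eq (integral_congr_ae
        (Eventually.of_forall fun t => ?_))
      simp only
      rw [norm_mul, show I * y * t = (y * t : ℝ) * I by push_cast; ring,
        Complex.norm_exp_ofReal_mul_I, mul_one]
    have hsub : ∀ (w y : ℝ) (δ : ℕ), w - y - Real.log (δ + 1) = w - Real.log (δ + 1) - y :=
      fun w y δ => sub_right_comm _ _ _
    have hF_int : ∀ (w : ℝ) (δ : ℕ), Integrable fun y =>
        φ y * (a δ * ((δ : ℝ) + 1) ^ (-α) * h (w - y - Real.log (δ + 1))) := by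
      intro w δ
      simp only [hsub, mul_left_comm (φ _)]
      exact (hφint _).const_mul _
    have hF_val : ∀ (w : ℝ) (δ : ℕ), ∫ y,
        φ y * (a δ * ((δ : ℝ) + 1) ^ (-α) * h (w - y - Real.log (δ + 1))) =
        a δ * ((δ : ℝ) + 1) ^ (-α) * ∫ y, h y * φ (w - Real.log (δ + 1) - y) := by
      intro w δ
      simp only [hsub, mul_left_comm (φ _)]
      rw [integral_const_mul, hflip]
    have hF_nn : ∀ (w : ℝ) (δ : ℕ) (y : ℝ),
        0 ≤ φ y * (a δ * ((δ : ℝ) + 1) ^ (-α) * h (w - y - Real.log (δ + 1))) := fun w δ y =>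
      mul_nonneg (K.nonneg y) (hnn _ _)
    have hsumm := fun w => K'.hasSum H w
    have hF_sum : ∀ w : ℝ, Summable fun δ : ℕ => ∫ y,
        ‖φ y * (a δ * ((δ : ℝ) + 1) ^ (-α) * h (w - y - Real.log (δ + 1)))‖ := by
      intro w
      refine (hsumm w).summable.congr fun δ => ?_
      simp_rw [Real.norm_of_nonneg (hF_nn w δ _)]
      rw [hF_val]
    have hintg : ∀ w : ℝ, HasSum (fun δ : ℕ => a δ * ((δ : ℝ) + 1) ^ (-α) *
        ∫ y, h y * φ (w - Real.log (δ + 1) - y))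
        (∫ y, φ y * ∑' δ : ℕ, a δ * ((δ : ℝ) + 1) ^ (-α) * h (w - y - Real.log (δ + 1))) := by
      intro w
      have h1 := hasSum_integral_of_summable_integral_norm (hF_int w) (hF_sum w)
      simp only [hF_val, tsum_mul_left] at h1
      exact h1
    refine ⟨fun w => ?_, ?_⟩
    · have hfun : (fun y => φ y * ∑' δ : ℕ, a δ * ((δ : ℝ) + 1) ^ (-α) *
          h (w - y - Real.log (δ + 1))) = fun y => ∑' δ : ℕ,
          φ y * (a δ * ((δ : ℝ) + 1) ^ (-α) * h (w - y - Real.log (δ + 1))) := by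
        ext y; rw [tsum_mul_left]
      rw [hfun]
      have hsy : ∀ y, Summable fun δ : ℕ =>
          φ y * (a δ * ((δ : ℝ) + 1) ^ (-α) * h (w - y - Real.log (δ + 1))) := fun y =>
        (hsummable (w - y)).mul_left _
      have hφc := K.continuous
      have hmeas : ∀ δ : ℕ, Measurable fun y =>
          φ y * (a δ * ((δ : ℝ) + 1) ^ (-α) * h (w - y - Real.log (δ + 1))) := fun δ =>
        Continuous.measurable (by fun_prop)
      have hm := measurable_of_tendsto_metrizable (fun n => Finset.measurable_fun_sum (Finset.range n)
        fun δ _ => hmeas δ) (tendsto_pi_nhds.2 fun y => (hsy y).hasSum.tendsto_sum_nat)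
      refine ⟨hm.aestronglyMeasurable, ?_⟩
      rw [hasFiniteIntegral_iff_ofReal (Eventually.of_forall fun y => tsum_nonneg (hF_nn w · y))]
      simp_rw [fun y => ENNReal.ofReal_tsum_of_nonneg (hF_nn w · y) (hsy y)]
      rw [lintegral_tsum fun δ => (hmeas δ).ennreal_ofReal.aemeasurable]
      simp_rw [← fun δ => ofReal_integral_eq_lintegral_ofReal (hF_int w δ)
        (Eventually.of_forall (hF_nn w δ)), hF_val]
      exact (hsumm w).summable.tsum_ofReal_lt_top
    · have hre := (Complex.continuous_re.tendsto _).comp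
        (K'.tendsto_smoothedSum (α := α) (μ := μ) (Φ := Φ))
      have hA : (μ M / M.factorial * ((∫ v, ∫ y, h y * φ (v - y) : ℝ) : ℂ)).re =
          γ / M.factorial * ∫ v, h v := by
        rw [K.integral_convolve hi1, hφ1, mul_one, hμ, ← ofReal_natCast, ← ofReal_div, ← ofReal_mul,
          ofReal_re]
      rw [hA] at hre
      refine hre.congr fun w => ?_
      simp only [Function.comp]
      rw [← ofReal_pow, div_ofReal_re, (hintg w).unique (hsumm w)]

theorem mul_sub_exp_le {s : ℝ} (hs : 0 < s) (x : ℝ) : s * x - Real.exp x ≤ s * Real.log s - s := by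
  have h := Real.add_one_le_exp (x - Real.log s)
  rw [Real.exp_sub, Real.exp_log hs, le_div_iff₀ hs] at h
  linarith

/-- The profile `e^{-βv} exp (-e^{-v})`, whose integral is `Γ(β)`. -/
noncomputable def gumbel (β v : ℝ) : ℝ := Real.exp (-β * v - Real.exp (-v))

theorem continuous_gumbel (β : ℝ) : Continuous (gumbel β) := by
  unfold gumbel; fun_prop

theorem gumbel_le_exp {β : ℝ} (hβ : 0 < β) (v : ℝ) :
    gumbel β v ≤ Real.exp ((β + 1) * Real.log (β + 1) - (β + 1)) * Real.exp v := by
  rw [gumbel, ← Real.exp_add]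
  refine Real.exp_le_exp.2 ?_
  have := mul_sub_exp_le (s := β + 1) (by linarith) (-v)
  linarith

theorem gumbel_le_exp_neg_abs {β : ℝ} (hβ : 0 < β) :
    ∃ C, 0 ≤ C ∧ ∀ v, gumbel β v ≤ C * Real.exp (-β * |v|) := by
  refine ⟨max 1 (Real.exp (2 * β * Real.log (2 * β) - 2 * β)), by positivity, fun v => ?_⟩
  rcases le_total 0 v with hv | hv
  · rw [abs_of_nonneg hv, gumbel, Real.exp_sub]
    refine (div_le_self (Real.exp_nonneg _) (Real.one_le_exp (Real.exp_nonneg _))).trans ?_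
    exact le_mul_of_one_le_left (Real.exp_nonneg _) (le_max_left _ _)
  · rw [abs_of_nonpos hv, gumbel]
    refine le_trans ?_ (mul_le_mul_of_nonneg_right (le_max_right _ _) (Real.exp_nonneg _))
    rw [← Real.exp_add]
    refine Real.exp_le_exp.2 ?_
    have := mul_sub_exp_le (s := 2 * β) (by linarith) (-v)
    linarith

theorem integrable_pow_mul_gumbel (M : ℕ) {β : ℝ} (hβ : 0 < β) :
    Integrable fun v => (1 + |v|) ^ M * gumbel β v := by
  obtain ⟨C, hC0, hC⟩ := gumbel_le_exp_neg_abs hβ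
  have hcg := continuous_gumbel β
  refine (integrable_inv_one_add_sq.const_mul (C * ((M + 2).factorial / β ^ (M + 2) * Real.exp β))).mono'
    (Continuous.aestronglyMeasurable (by fun_prop)) (Eventually.of_forall fun v => ?_)
  have hg0 : 0 ≤ gumbel β v := Real.exp_nonneg _
  rw [Real.norm_of_nonneg (by positivity), ← div_eq_mul_inv, le_div_iff₀ (by positivity)]
  have h1 := Real.pow_div_factorial_le_exp (β * (1 + |v|)) (by positivity) (M + 2)
  rw [mul_pow, div_le_iff₀ (by positivity), mul_add, Real.exp_add, mul_one] at h1
  have h2 : 1 + v ^ 2 ≤ (1 + |v|) ^ 2 := by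
    rw [← sq_abs v]; nlinarith [abs_nonneg v]
  calc (1 + |v|) ^ M * gumbel β v * (1 + v ^ 2)
      ≤ (1 + |v|) ^ M * (C * Real.exp (-β * |v|)) * (1 + |v|) ^ 2 := by gcongr; exact hC v
    _ = C * Real.exp (-β * |v|) / β ^ (M + 2) * (β ^ (M + 2) * (1 + |v|) ^ (M + 2)) := by
        field_simp
        ring
    _ ≤ C * Real.exp (-β * |v|) / β ^ (M + 2) *
        (Real.exp β * Real.exp (β * |v|) * (M + 2).factorial) := by gcongr
    _ = _ := by
        rw [neg_mul, Real.exp_neg]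
        field_simp

theorem integral_gumbel {β : ℝ} (hβ : 0 < β) : ∫ v, gumbel β v = Real.Gamma β := by
  have himg : (fun v : ℝ => Real.exp (-v)) '' Set.univ = Set.Ioi 0 := by
    rw [Set.image_univ]
    ext y
    constructor
    · rintro ⟨v, rfl⟩; exact Real.exp_pos _
    · intro hy
      exact ⟨-Real.log y, by simp [Real.exp_log (show 0 < y from hy)]⟩
  rw [Real.Gamma_eq_integral hβ, ← himg,
    integral_image_eq_integral_abs_deriv_smul (f' := fun v => -Real.exp (-v)) MeasurableSet.univ]
  · rw [setIntegral_univ]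
    refine integral_congr_ae (Eventually.of_forall fun v => ?_)
    simp only [smul_eq_mul]
    rw [abs_neg, abs_of_pos (Real.exp_pos _), ← Real.exp_mul, ← Real.exp_add, ← Real.exp_add, gumbel]
    congr 1
    ring
  · intro v _
    simpa using (hasDerivAt_neg v).exp
  · intro v _ w _ h
    simpa using h

theorem HasPolarPart.tendsto_laplace {a : ℕ → ℝ} {α : ℝ} {M : ℕ} {μ : ℕ → ℂ} {Φ : ℂ → ℂ}
    (H : HasPolarPart a α M μ Φ) {γ : ℝ} (hγ : 0 ≤ γ) (hμ : μ M = γ) {β : ℝ} (hβ : 0 < β) :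
    (∀ τ : ℝ, 0 < τ → Summable fun δ : ℕ =>
      a δ * ((δ : ℝ) + 1) ^ (β - α) * Real.exp (-τ * (δ + 1))) ∧
    Tendsto (fun τ : ℝ => τ ^ β *
        (∑' δ : ℕ, a δ * ((δ : ℝ) + 1) ^ (β - α) * Real.exp (-τ * (δ + 1))) / (-Real.log τ) ^ M)
      (𝓝[>] 0) (𝓝 (γ / M.factorial * Real.Gamma β)) := by
  obtain ⟨h1, h2⟩ := H.tendsto_convolution hγ hμ hβ (continuous_gumbel β)
    (fun v => Real.exp_nonneg _) (integrable_pow_mul_gumbel M hβ) (fun v v' h => by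
      simp only [gumbel, ← Real.exp_add]
      refine Real.exp_le_exp.2 ?_
      have := Real.exp_le_exp.2 (neg_le_neg h)
      linarith) (gumbel_le_exp hβ)
  rw [integral_gumbel hβ] at h2
  have hterm : ∀ (τ : ℝ) (δ : ℕ), 0 < τ →
      a δ * ((δ : ℝ) + 1) ^ (-α) * gumbel β (-Real.log τ - Real.log (δ + 1)) =
      τ ^ β * (a δ * ((δ : ℝ) + 1) ^ (β - α) * Real.exp (-τ * (δ + 1))) := by
    intro τ δ hτ
    have hp : (0 : ℝ) < δ + 1 := by positivity
    have h3 : Real.exp (Real.log τ + Real.log (δ + 1)) = τ * (δ + 1) := by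
      rw [Real.exp_add, Real.exp_log hτ, Real.exp_log hp]
    rw [gumbel, show -(-Real.log τ - Real.log (δ + 1)) = Real.log τ + Real.log (δ + 1) by ring, h3,
      Real.rpow_sub hp, Real.rpow_neg hp.le, Real.rpow_def_of_pos hτ, Real.rpow_def_of_pos hp β,
      show -β * (-Real.log τ - Real.log (δ + 1)) - τ * (δ + 1) =
        Real.log τ * β + (Real.log (δ + 1) * β + -τ * (δ + 1)) by ring, Real.exp_add, Real.exp_add]
    ring
  refine ⟨fun τ hτ => ?_, ?_⟩
  · have h3 := h1 (-Real.log τ)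
    simp_rw [hterm τ _ hτ] at h3
    exact (summable_mul_left_iff (Real.rpow_pos_of_pos hτ β).ne').1 h3
  · have h3 := h2.comp (tendsto_neg_atBot_atTop.comp Real.tendsto_log_nhdsGT_zero)
    refine h3.congr' ?_
    filter_upwards [self_mem_nhdsWithin] with τ hτ
    simp only [Function.comp]
    simp_rw [hterm τ _ hτ, tsum_mul_left]

end

/-- The number of orbits of the permutation action `φ`. -/
noncomputable def orbitCount {G X : Type*} [Group G] (φ : G →* Equiv.Perm X) : ℕ :=
  Nat.card (Quotient (MulAction.orbitRel φ.range X))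

/-- The generating sum of the orbit-counting statistic over all actions of `G` on `X`. -/
noncomputable def homWeight (G X : Type*) [Group G] (x : ℝ) : ℝ :=
  ∑ᶠ φ : G →* Equiv.Perm X, x ^ orbitCount φ

theorem Group.FG.finite_monoidHom (G P : Type*) [Group G] [Group.FG G] [Group P] [Finite P] :
    Finite (G →* P) := by
  obtain ⟨S, hS⟩ := Group.fg_def.1 (inferInstance : Group.FG G)
  refine Finite.of_injective (fun (φ : G →* P) (s : S) => φ s) fun φ ψ h => ?_
  refine MonoidHom.eq_of_eqOn_dense hS fun s hs => ?_
  exact congrFun h ⟨s, hs⟩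

theorem orbitRel_range_iff {G X : Type*} [Group G] (φ : G →* Equiv.Perm X) (y z : X) :
    (MulAction.orbitRel φ.range X) y z ↔ ∃ g, φ g z = y := by
  rw [MulAction.orbitRel_apply, MulAction.mem_orbit_iff]
  constructor
  · rintro ⟨⟨_, g, rfl⟩, h⟩
    exact ⟨g, h⟩
  · rintro ⟨g, h⟩
    exact ⟨⟨φ g, g, rfl⟩, h⟩

theorem orbitCount_congr {G X Y : Type*} [Group G] (φ : G →* Equiv.Perm X) (ψ : G →* Equiv.Perm Y)
    (E : X ≃ Y) (h : ∀ g z, ψ g (E z) = E (φ g z)) : orbitCount φ = orbitCount ψ := by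
  refine Nat.card_congr (Quotient.congr E fun y z => ?_)
  change (MulAction.orbitRel φ.range X) y z ↔ (MulAction.orbitRel ψ.range Y) (E y) (E z)
  rw [orbitRel_range_iff, orbitRel_range_iff]
  simp [h]

theorem homWeight_congr {G X Y : Type*} [Group G] (E : X ≃ Y) (x : ℝ) :
    homWeight G X x = homWeight G Y x := by
  refine finsum_eq_of_bijective (fun φ : G →* Equiv.Perm X => (E.permCongrHom : _ →* _).comp φ)
    ?_ fun φ => ?_
  · refine ⟨fun φ ψ h => ?_, fun ψ => ⟨(E.symm.permCongrHom : _ →* _).comp ψ, ?_⟩⟩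
    · ext g y
      have := congrArg (fun f => E.symm (f g (E y))) h
      simpa using this
    · ext g y
      simp
  · rw [orbitCount_congr _ ((E.permCongrHom : _ →* _).comp φ) E]
    intro g z
    simp

/-- The action on `X ≃ (G ⧸ H) ⊕ Y` which is the coset action on `G ⧸ H` and `ψ` on `Y`. -/
def extendHom {G X Y : Type*} [Group G] {H : Subgroup G} (E : (G ⧸ H) ⊕ Y ≃ X)
    (ψ : G →* Equiv.Perm Y) : G →* Equiv.Perm X :=
  (E.permCongrHom : _ →* _).comp ((Equiv.Perm.sumCongrHom (G ⧸ H) Y).comp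
    ((MulAction.toPermHom G (G ⧸ H)).prod ψ))

theorem extendHom_inl {G X Y : Type*} [Group G] {H : Subgroup G} (E : (G ⧸ H) ⊕ Y ≃ X)
    (ψ : G →* Equiv.Perm Y) (g : G) (k : G ⧸ H) :
    extendHom E ψ g (E (Sum.inl k)) = E (Sum.inl (g • k)) := by
  simp [extendHom]

theorem extendHom_inr {G X Y : Type*} [Group G] {H : Subgroup G} (E : (G ⧸ H) ⊕ Y ≃ X)
    (ψ : G →* Equiv.Perm Y) (g : G) (y : Y) :
    extendHom E ψ g (E (Sum.inr y)) = E (Sum.inr (ψ g y)) := by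
  simp [extendHom]

theorem extendHom_injective {G X Y : Type*} [Group G] {H : Subgroup G} (E : (G ⧸ H) ⊕ Y ≃ X) :
    Function.Injective (extendHom (H := H) E) := by
  intro ψ ψ' h
  ext g y
  have := congrArg (fun f => f g (E (Sum.inr y))) h
  simpa [extendHom_inr] using this

theorem range_extendHom {G X Y : Type*} [Group G] {H : Subgroup G} [Finite (G ⧸ H)] [Finite Y]
    (E : (G ⧸ H) ⊕ Y ≃ X) :
    Set.range (extendHom (H := H) E) =
      {φ | ∀ g : G, φ g (E (Sum.inl (1 : G))) = E (Sum.inl (g : G ⧸ H))} := by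
  ext φ
  constructor
  · rintro ⟨ψ, rfl⟩ g
    rw [extendHom_inl]
    simp
  · intro hφ
    have hφ' : ∀ (g : G) (k : G ⧸ H), φ g (E (Sum.inl k)) = E (Sum.inl (g • k)) := by
      intro g k
      induction k using QuotientGroup.induction_on with
      | H k => rw [← hφ k, ← Equiv.Perm.mul_apply, ← map_mul, hφ (g * k)]; rfl
    have hr : ∀ g, E.symm.permCongrHom (φ g) ∈ (Equiv.Perm.sumCongrHom (G ⧸ H) Y).range := by
      intro g
      refine Equiv.Perm.mem_sumCongrHom_range_of_perm_mapsTo_inl ?_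
      rintro _ ⟨k, rfl⟩
      exact ⟨g • k, by simp [hφ']⟩
    choose p hp using hr
    have hp2 : ∀ g y, φ g (E (Sum.inr y)) = E (Sum.inr ((p g).2 y)) := by
      intro g y
      have := congrArg (fun f => E (f (Sum.inr y))) (hp g)
      simpa using this.symm
    refine ⟨MonoidHom.mk' (fun g => (p g).2) fun g k => ?_, ?_⟩
    · ext y
      have h := hp2 (g * k) y
      rw [map_mul, Equiv.Perm.mul_apply, hp2, hp2] at h
      simpa using h.symm
    · ext g z
      obtain ⟨s, rfl⟩ := E.surjective z
      rcases s with k | y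
      · rw [extendHom_inl, hφ']
      · rw [extendHom_inr, hp2]; rfl

theorem orbitCount_extendHom {G X Y : Type*} [Group G] {H : Subgroup G} [Finite Y]
    (E : (G ⧸ H) ⊕ Y ≃ X) (ψ : G →* Equiv.Perm Y) :
    orbitCount (extendHom E ψ) = orbitCount ψ + 1 := by
  have hr : ∀ y z, (MulAction.orbitRel (extendHom E ψ).range X) (E (Sum.inr y)) (E (Sum.inr z)) ↔
      (MulAction.orbitRel ψ.range Y) y z := by
    intro y z
    rw [orbitRel_range_iff, orbitRel_range_iff]
    simp [extendHom_inr]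
  let f : Option (Quotient (MulAction.orbitRel ψ.range Y)) →
      Quotient (MulAction.orbitRel (extendHom E ψ).range X) := fun o => o.elim
    (Quotient.mk _ (E (Sum.inl (1 : G))))
    (Quotient.map' (fun y => E (Sum.inr y)) fun y z h => (hr y z).2 h)
  have hf : Function.Bijective f := by
    have hne : ∀ y k, ¬ (MulAction.orbitRel (extendHom E ψ).range X) (E (Sum.inl k)) (E (Sum.inr y)) := by
      intro y k h
      rw [orbitRel_range_iff] at h
      obtain ⟨g, h⟩ := h
      rw [extendHom_inr] at h
      simp at h
    constructor
    · rintro (_ | q) (_ | q') h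
      · rfl
      · induction q' using Quotient.inductionOn with
        | h y => exact absurd (Quotient.exact h) (hne y _)
      · induction q using Quotient.inductionOn with
        | h y => exact absurd (Quotient.exact h.symm) (hne y _)
      · induction q using Quotient.inductionOn with
        | h y =>
          induction q' using Quotient.inductionOn with
          | h z => exact congrArg some (Quotient.sound ((hr y z).1 (Quotient.exact h)))
    · intro q
      induction q using Quotient.inductionOn with
      | h z =>
        obtain ⟨s, rfl⟩ := E.surjective z
        rcases s with k | y
        · refine ⟨none, Quotient.sound ?_⟩
          change (MulAction.orbitRel (extendHom E ψ).range X) _ _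
          rw [orbitRel_range_iff]
          induction k using QuotientGroup.induction_on with
          | H k => exact ⟨k⁻¹, by rw [extendHom_inl, MulAction.Quotient.smul_coe, smul_eq_mul,
            inv_mul_cancel]⟩
        · exact ⟨some (Quotient.mk _ y), rfl⟩
  rw [orbitCount, ← Nat.card_eq_of_bijective f hf, Finite.card_option]
  rfl

/-- The actions of `G` on `X` whose orbit map at `e 1` is `e`. -/
abbrev OrbitMapEq (G X : Type*) [Group G] (H : Subgroup G) (e : (G ⧸ H) ↪ X) : Type _ :=
  {φ : G →* Equiv.Perm X // ∀ g : G, φ g (e (1 : G)) = e (g : G ⧸ H)}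

theorem finsum_orbitMapEq {G X : Type*} [Group G] [Finite X] {H : Subgroup G} (e : (G ⧸ H) ↪ X)
    (x : ℝ) : ∑ᶠ φ : OrbitMapEq G X H e, x ^ orbitCount φ.1 =
      x * homWeight G {y // y ∉ Set.range e} x := by
  classical
  have hfin : Finite (G ⧸ H) := Finite.of_injective e e.injective
  let E : (G ⧸ H) ⊕ {y // y ∉ Set.range e} ≃ X :=
    ((Equiv.ofInjective e e.injective).sumCongr (Equiv.refl _)).trans (Equiv.sumCompl _)
  have hE : ∀ k : G ⧸ H, E (Sum.inl k) = e k := fun k => rfl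
  have hr := range_extendHom E
  simp only [hE] at hr
  rw [homWeight, ← smul_eq_mul, smul_finsum]
  symm
  refine finsum_eq_of_bijective (fun ψ => ⟨extendHom E ψ, hr.subset (Set.mem_range_self ψ)⟩) ?_ fun ψ => ?_
  · refine ⟨fun ψ ψ' h => extendHom_injective E (congrArg Subtype.val h), fun φ => ?_⟩
    obtain ⟨ψ, hψ⟩ := hr.superset φ.2
    exact ⟨ψ, Subtype.ext hψ⟩
  · rw [orbitCount_extendHom, pow_succ', smul_eq_mul]

theorem card_mul_homWeight (G X : Type*) [Group G] [Group.FG G] [Finite X]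
    (hfin : ∀ k, 1 ≤ k → Finite {H : Subgroup G // H.index = k}) (x : ℝ) :
    (Nat.card X : ℝ) * homWeight G X x = ∑ k ∈ Finset.range (Nat.card X),
      (Nat.card {H : Subgroup G // H.index = k + 1} : ℝ) *
        ((Nat.card X).descFactorial (k + 1) *
          (x * homWeight G (Fin (Nat.card X - (k + 1))) x)) := by
  classical
  have : ∀ k : Fin (Nat.card X), Finite {H : Subgroup G // H.index = k + 1} := fun k =>
    hfin _ (by omega)
  have h1 := Group.FG.finite_monoidHom G (Equiv.Perm X)
  have h2 : ∀ {k : Fin (Nat.card X)} (H : {H : Subgroup G // H.index = k + 1}),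
      Finite (G ⧸ H.1) := fun H => by
    have : H.1.FiniteIndex := ⟨by rw [H.2]; omega⟩
    infer_instance
  let I := Σ k : Fin (Nat.card X), Σ H : {H : Subgroup G // H.index = k + 1},
    Σ e : (G ⧸ H.1) ↪ X, OrbitMapEq G X H.1 e
  have h3 : ∀ {k : Fin (Nat.card X)} (H : {H : Subgroup G // H.index = k + 1}),
      Finite ((G ⧸ H.1) ↪ X) := fun H => inferInstance
  let F : I → X × (G →* Equiv.Perm X) := fun p => (p.2.2.1 (1 : G), p.2.2.2.1)
  have hF : Function.Bijective F := by
    constructor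
    · rintro ⟨k, ⟨H, hH⟩, e, φ, hφ⟩ ⟨k', ⟨H', hH'⟩, e', φ', hφ'⟩ h
      simp only [F, Prod.mk.injEq] at h
      obtain ⟨h4, rfl⟩ := h
      have h5 : ∀ g : G, e g = e' g := fun g => by rw [← hφ, ← hφ', h4]
      have h6 : H = H' := by
        ext g
        have h7 : ∀ K : Subgroup G, g ∈ K ↔ ((1 : G) : G ⧸ K) = g := fun K => by
          rw [QuotientGroup.eq, inv_one, one_mul]
        rw [h7 H, h7 H', ← e.injective.eq_iff, ← e'.injective.eq_iff, ← h5, ← h5]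
      subst h6
      have h7 : k = k' := Fin.ext (by omega)
      subst h7
      have h8 : e = e' := by
        ext q
        induction q using QuotientGroup.induction_on with
        | H g => exact h5 g
      subst h8
      rfl
    · rintro ⟨x₀, φ⟩
      let A : MulAction G X := MulAction.compHom X φ
      let e : (G ⧸ MulAction.stabilizer G x₀) ↪ X :=
        ⟨MulAction.ofQuotientStabilizer G x₀, MulAction.injective_ofQuotientStabilizer G x₀⟩
      have he : Finite (G ⧸ MulAction.stabilizer G x₀) := Finite.of_injective e e.injective
      have h4 : (MulAction.stabilizer G x₀).index ≤ Nat.card X :=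
        Nat.card_le_card_of_injective e e.injective
      have h5 : 0 < (MulAction.stabilizer G x₀).index := Nat.card_pos
      refine ⟨⟨⟨(MulAction.stabilizer G x₀).index - 1, by omega⟩,
        ⟨MulAction.stabilizer G x₀, by simp only; omega⟩, e, φ, fun g => ?_⟩, ?_⟩
      · change φ g ((1 : G) • x₀) = g • x₀
        rw [one_smul]
        rfl
      · change ((1 : G) • x₀, φ) = (x₀, φ)
        rw [one_smul]
  have : Fintype X := Fintype.ofFinite _
  have : Fintype (G →* Equiv.Perm X) := Fintype.ofFinite _
  have : ∀ k : Fin (Nat.card X), Fintype {H : Subgroup G // H.index = k + 1} := fun k =>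
    Fintype.ofFinite _
  have : ∀ {k : Fin (Nat.card X)} (H : {H : Subgroup G // H.index = k + 1}),
      Fintype ((G ⧸ H.1) ↪ X) := fun H => Fintype.ofFinite _
  have : ∀ {k : Fin (Nat.card X)} (H : {H : Subgroup G // H.index = k + 1}) (e : (G ⧸ H.1) ↪ X),
      Fintype (OrbitMapEq G X H.1 e) := fun H e => Fintype.ofFinite _
  calc (Nat.card X : ℝ) * homWeight G X x
      = ∑ p : X × (G →* Equiv.Perm X), x ^ orbitCount p.2 := by
        rw [Fintype.sum_prod_type]
        simp only
        rw [Finset.sum_const, nsmul_eq_mul, homWeight,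
          finsum_eq_sum_of_fintype, Nat.card_eq_fintype_card, Finset.card_univ]
    _ = ∑ p : I, x ^ orbitCount p.2.2.2.1 :=
        (Fintype.sum_bijective F hF _ _ fun p => rfl).symm
    _ = ∑ k : Fin (Nat.card X), ∑ H : {H : Subgroup G // H.index = k + 1},
          ∑ e : (G ⧸ H.1) ↪ X, x * homWeight G (Fin (Nat.card X - (k + 1))) x := by
        simp only [I, Fintype.sum_sigma]
        refine Finset.sum_congr rfl fun k _ => Finset.sum_congr rfl fun H _ =>
          Finset.sum_congr rfl fun e _ => ?_
        rw [← finsum_eq_sum_of_fintype, finsum_orbitMapEq]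
        congr 1
        refine homWeight_congr (Finite.equivFinOfCardEq ?_) x
        have h6 := h2 H
        have h7 : Nat.card (Set.range e) = k + 1 := by
          rw [Nat.card_range_of_injective e.injective]
          exact H.2
        have h8 := Nat.card_congr (Equiv.sumCompl (· ∈ Set.range e))
        rw [Nat.card_sum] at h8
        change Nat.card (Set.range e) + _ = _ at h8
        omega
    _ = _ := by
        rw [Finset.sum_range]
        refine Finset.sum_congr rfl fun k _ => ?_
        have h6 : ∀ H : {H : Subgroup G // H.index = k + 1},
            (Fintype.card ((G ⧸ H.1) ↪ X)) = (Nat.card X).descFactorial (k + 1) := by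
          intro H
          have h7 := h2 H
          have : Fintype (G ⧸ H.1) := Fintype.ofFinite _
          have h8 : Fintype.card (G ⧸ H.1) = k + 1 := by
            rw [← Nat.card_eq_fintype_card]; exact H.2
          rw [← Nat.card_eq_fintype_card, Nat.card_eq_fintype_card, Fintype.card_embedding_eq, h8,
            ← @Nat.card_eq_fintype_card X]
        simp_rw [Finset.sum_const, Finset.card_univ, h6]
        rw [Finset.sum_const, Finset.card_univ, nsmul_eq_mul, nsmul_eq_mul,
          @Nat.card_eq_fintype_card {H : Subgroup G // H.index = k + 1}]

theorem homWeight_fin_zero (G : Type*) [Group G] (x : ℝ) : homWeight G (Fin 0) x = 1 := by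
  have : Unique (G →* Equiv.Perm (Fin 0)) := ⟨⟨1⟩, fun φ => by ext g z; exact z.elim0⟩
  rw [homWeight, finsum_unique, orbitCount, Nat.card_of_isEmpty, pow_zero]

theorem natCast_mul_homWeight_div_factorial (G : Type*) [Group G] [Group.FG G]
    (hfin : ∀ k, 1 ≤ k → Finite {H : Subgroup G // H.index = k}) (n : ℕ) (x : ℝ) :
    (n : ℝ) * (homWeight G (Fin n) x / n.factorial) =
      x * ∑ k ∈ Finset.range n, (aCount G (k + 1) : ℝ) *
        (homWeight G (Fin (n - (k + 1))) x / (n - (k + 1)).factorial) := by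
  have h := card_mul_homWeight G (Fin n) hfin x
  rw [Nat.card_eq_fintype_card, Fintype.card_fin] at h
  rw [mul_div, h, Finset.sum_div, Finset.mul_sum]
  refine Finset.sum_congr rfl fun k hk => ?_
  have hk' : k + 1 ≤ n := Finset.mem_range.1 hk
  have h1 : (n.factorial : ℝ) = (n - (k + 1)).factorial * n.descFactorial (k + 1) := by
    exact_mod_cast (Nat.factorial_mul_descFactorial hk').symm
  have h2 : (n.descFactorial (k + 1) : ℝ) ≠ 0 := by
    exact_mod_cast (Nat.pos_of_ne_zero (by rw [Ne, Nat.descFactorial_eq_zero_iff_lt]; omega)).ne'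
  rw [h1, aCount]
  field_simp

theorem expVal_id_of_hasDerivAt {G : Type*} [Group G] [Group.FG G] {n : ℕ} {x d : ℝ}
    (hd : HasDerivAt (homWeight G (Fin n)) d x) :
    expVal G n x id = x * d / homWeight G (Fin n) x := by
  have := Group.FG.finite_monoidHom G (Equiv.Perm (Fin n))
  have : Fintype (G →* Equiv.Perm (Fin n)) := Fintype.ofFinite _
  have h1 : homWeight G (Fin n) = fun y => ∑ φ : G →* Equiv.Perm (Fin n), y ^ numOrbits φ := by
    ext y; exact finsum_eq_sum_of_fintype _
  have h2 : HasDerivAt (homWeight G (Fin n))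
      (∑ φ : G →* Equiv.Perm (Fin n), (numOrbits φ : ℝ) * x ^ (numOrbits φ - 1)) x := by
    rw [h1]
    exact HasDerivAt.fun_sum fun φ _ => hasDerivAt_pow _ _
  rw [expVal, hd.unique h2, h1, finsum_eq_sum_of_fintype, finsum_eq_sum_of_fintype, Finset.mul_sum]
  congr 1
  refine Finset.sum_congr rfl fun φ _ => ?_
  rcases numOrbits φ with _ | k
  · simp
  · simp [pow_succ]; ring

theorem expVal_sq_of_hasDerivAt {G : Type*} [Group G] [Group.FG G] {n : ℕ} {x e : ℝ} {d : ℝ → ℝ}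
    (hd : ∀ y, HasDerivAt (homWeight G (Fin n)) (d y) y) (he : HasDerivAt d e x) :
    expVal G n x (fun y => y ^ 2) = (x ^ 2 * e + x * d x) / homWeight G (Fin n) x := by
  have := Group.FG.finite_monoidHom G (Equiv.Perm (Fin n))
  have : Fintype (G →* Equiv.Perm (Fin n)) := Fintype.ofFinite _
  have h1 : homWeight G (Fin n) = fun y => ∑ φ : G →* Equiv.Perm (Fin n), y ^ numOrbits φ := by
    ext y; exact finsum_eq_sum_of_fintype _
  have h2 : d = fun y =>
      ∑ φ : G →* Equiv.Perm (Fin n), (numOrbits φ : ℝ) * y ^ (numOrbits φ - 1) := by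
    ext y
    refine (hd y).unique ?_
    rw [h1]
    exact HasDerivAt.fun_sum fun φ _ => hasDerivAt_pow _ _
  have h3 : HasDerivAt d (∑ φ : G →* Equiv.Perm (Fin n), (numOrbits φ : ℝ) *
      (((numOrbits φ - 1 : ℕ) : ℝ) * x ^ (numOrbits φ - 1 - 1))) x := by
    rw [h2]
    exact HasDerivAt.fun_sum fun φ _ => (hasDerivAt_pow _ _).const_mul _
  rw [expVal, he.unique h3, h2, h1, finsum_eq_sum_of_fintype, finsum_eq_sum_of_fintype,
    Finset.mul_sum, Finset.mul_sum, ← Finset.sum_add_distrib]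
  congr 1
  refine Finset.sum_congr rfl fun φ _ => ?_
  rcases numOrbits φ with _ | _ | k
  · simp
  · simp
  · simp [pow_succ]; ring

section

open MeasureTheory Filter Topology Complex

/-- The Fourier series `∑ b_δ e^{i(δ+1)θ}`. -/
noncomputable def angSum (b : ℕ → ℝ) (θ : ℝ) : ℂ :=
  ∑' δ : ℕ, (b δ : ℂ) * cexp ((((δ : ℝ) + 1) * θ : ℝ) * I)

theorem norm_angSum_term (b : ℕ → ℝ) (hb : ∀ δ, 0 ≤ b δ) (δ : ℕ) (θ : ℝ) :
    ‖(b δ : ℂ) * cexp ((((δ : ℝ) + 1) * θ : ℝ) * I)‖ = b δ := by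
  rw [norm_mul, norm_exp_ofReal_mul_I, mul_one, norm_real, Real.norm_of_nonneg (hb δ)]

theorem summable_of_summable_mul {b : ℕ → ℝ} (hb : ∀ δ, 0 ≤ b δ)
    (hs : Summable fun δ : ℕ => b δ * ((δ : ℝ) + 1)) : Summable b :=
  hs.of_nonneg_of_le hb fun δ =>
    le_mul_of_one_le_right (hb δ) (by linarith [Nat.cast_nonneg (α := ℝ) δ])

theorem summable_angSum {b : ℕ → ℝ} (hb : ∀ δ, 0 ≤ b δ) (hs : Summable b) (θ : ℝ) :
    Summable fun δ : ℕ => (b δ : ℂ) * cexp ((((δ : ℝ) + 1) * θ : ℝ) * I) :=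
  Summable.of_norm (by simpa only [norm_angSum_term b hb] using hs)

theorem continuous_angSum {b : ℕ → ℝ} (hb : ∀ δ, 0 ≤ b δ) (hs : Summable b) :
    Continuous (angSum b) := by
  unfold angSum
  exact continuous_tsum (fun δ => by fun_prop) hs fun δ θ => (norm_angSum_term b hb δ θ).le

theorem norm_angSum_le {b : ℕ → ℝ} (hb : ∀ δ, 0 ≤ b δ) (hs : Summable b) (θ : ℝ) :
    ‖angSum b θ‖ ≤ ∑' δ, b δ :=
  tsum_of_norm_bounded hs.hasSum fun δ => (norm_angSum_term b hb δ θ).le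

theorem hasDerivAt_angSum {b : ℕ → ℝ} (hb : ∀ δ, 0 ≤ b δ)
    (hs : Summable fun δ : ℕ => b δ * ((δ : ℝ) + 1)) (θ : ℝ) :
    HasDerivAt (angSum b) (I * angSum (fun δ => b δ * ((δ : ℝ) + 1)) θ) θ := by
  have h1 : ∀ (δ : ℕ) (θ : ℝ), HasDerivAt
      (fun θ : ℝ => (b δ : ℂ) * cexp ((((δ : ℝ) + 1) * θ : ℝ) * I))
      (I * (((b δ * ((δ : ℝ) + 1) : ℝ) : ℂ) * cexp ((((δ : ℝ) + 1) * θ : ℝ) * I))) θ := by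
    intro δ θ
    have h : HasDerivAt (fun θ : ℝ => ((((δ : ℝ) + 1) * θ : ℝ) : ℂ) * I)
        ((((δ : ℝ) + 1 : ℝ) : ℂ) * I) θ := by
      have := (((hasDerivAt_id θ).const_mul ((δ : ℝ) + 1)).ofReal_comp).mul_const I
      simpa using this
    refine (h.cexp.const_mul (b δ : ℂ)).congr_deriv ?_
    push_cast; ring
  have h2 := hasDerivAt_tsum (y₀ := 0) (u := fun δ : ℕ => b δ * ((δ : ℝ) + 1)) hs h1 (fun δ θ => by
    rw [norm_mul, norm_I, one_mul, norm_angSum_term (fun δ => b δ * ((δ : ℝ) + 1))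
      fun δ => mul_nonneg (hb δ) (by positivity)])
    (summable_angSum hb (summable_of_summable_mul hb hs) 0) θ
  rw [tsum_mul_left] at h2
  exact h2

theorem angSum_eq_tsum_pow (b : ℕ → ℝ) (θ : ℝ) :
    angSum b θ = ∑' δ : ℕ, (b δ : ℂ) * circleMap 0 1 θ ^ (δ + 1) := by
  unfold angSum
  congr 1
  ext δ
  rw [circleMap_zero, ofReal_one, one_mul, ← exp_nat_mul]
  push_cast
  ring_nf

theorem diffContOnCl_tsum_pow {b : ℕ → ℝ} (hb : ∀ δ, 0 ≤ b δ) (hs : Summable b) :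
    DiffContOnCl ℂ (fun z : ℂ => ∑' δ : ℕ, (b δ : ℂ) * z ^ (δ + 1)) (Metric.ball 0 |1|) := by
  have hle : ∀ (δ : ℕ) (z : ℂ), z ∈ Metric.closedBall (0 : ℂ) 1 → ‖(b δ : ℂ) * z ^ (δ + 1)‖ ≤ b δ := by
    intro δ z hz
    rw [norm_mul, norm_pow, norm_real, Real.norm_of_nonneg (hb δ)]
    exact mul_le_of_le_one_right (hb δ) (pow_le_one₀ (norm_nonneg _) (by simpa using hz))
  rw [abs_one]
  constructor
  · exact differentiableOn_tsum_of_summable_norm hs (fun δ => by fun_prop) Metric.isOpen_ball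
      fun δ z hz => hle δ z (Metric.ball_subset_closedBall hz)
  · rw [closure_ball _ one_ne_zero]
    exact continuousOn_tsum (fun δ => by fun_prop) hs hle

/-- The Fourier coefficients of `exp (y * angSum b θ)`. -/
noncomputable def expCoeff (b : ℕ → ℝ) (y : ℝ) (n : ℤ) : ℂ :=
  ∫ θ in (-Real.pi)..Real.pi, cexp ((-(n * θ) : ℝ) * I) * cexp (y * angSum b θ)

theorem expCoeff_neg_natCast {b : ℕ → ℝ} (hb : ∀ δ, 0 ≤ b δ) (hs : Summable b) (y : ℝ) (k : ℕ) :
    expCoeff b y (-(k : ℤ)) = 2 * Real.pi * (0 : ℂ) ^ k := by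
  have hd : DiffContOnCl ℂ (fun z : ℂ => z ^ k * cexp (y * ∑' δ : ℕ, (b δ : ℂ) * z ^ (δ + 1)))
      (Metric.ball 0 |1|) := by
    have h := (diffContOnCl_tsum_pow hb hs)
    refine DiffContOnCl.smul (f := fun z : ℂ => cexp (y * ∑' δ : ℕ, (b δ : ℂ) * z ^ (δ + 1)))
      (c := fun z : ℂ => z ^ k) (by fun_prop : Differentiable ℂ fun z : ℂ => z ^ k).diffContOnCl ?_
    exact (differentiable_exp.comp (differentiable_id.const_mul (y : ℂ))).diffContOnCl.comp h
      (Set.mapsTo_univ _ _)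
  have h1 := hd.circleAverage
  rw [Real.circleAverage_def] at h1
  have h2 : ∀ θ : ℝ, (circleMap 0 1 θ) ^ k *
      cexp (y * ∑' δ : ℕ, (b δ : ℂ) * (circleMap 0 1 θ) ^ (δ + 1)) =
      cexp ((-(((-(k : ℤ) : ℤ) : ℝ) * θ) : ℝ) * I) * cexp (y * angSum b θ) := by
    intro θ
    rw [← angSum_eq_tsum_pow, circleMap_zero, ofReal_one, one_mul, ← exp_nat_mul]
    push_cast
    ring_nf
  have hper : Function.Periodic (fun θ : ℝ => (circleMap 0 1 θ) ^ k *
      cexp (y * ∑' δ : ℕ, (b δ : ℂ) * (circleMap 0 1 θ) ^ (δ + 1))) (2 * Real.pi) := by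
    intro θ
    simp only [periodic_circleMap 0 1 θ]
  have h3 := hper.intervalIntegral_add_eq 0 (-Real.pi)
  rw [zero_add, show -Real.pi + 2 * Real.pi = Real.pi by ring] at h3
  rw [h3] at h1
  simp_rw [h2] at h1
  rw [← expCoeff, inv_smul_eq_iff₀ (by positivity)] at h1
  rw [h1]
  simp

theorem expCoeff_of_neg {b : ℕ → ℝ} (hb : ∀ δ, 0 ≤ b δ) (hs : Summable b) (y : ℝ) {n : ℤ}
    (hn : n < 0) : expCoeff b y n = 0 := by
  obtain ⟨k, rfl⟩ : ∃ k : ℕ, n = -(k : ℤ) := ⟨n.natAbs, by omega⟩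
  rw [expCoeff_neg_natCast hb hs, zero_pow (by omega), mul_zero]

theorem expCoeff_zero {b : ℕ → ℝ} (hb : ∀ δ, 0 ≤ b δ) (hs : Summable b) (y : ℝ) :
    expCoeff b y 0 = 2 * Real.pi := by
  simpa using expCoeff_neg_natCast hb hs y 0

theorem intCast_mul_expCoeff {b : ℕ → ℝ} (hb : ∀ δ, 0 ≤ b δ)
    (hs : Summable fun δ : ℕ => b δ * ((δ : ℝ) + 1)) (y : ℝ) (n : ℤ) :
    (n : ℂ) * expCoeff b y n =
      y * ∑' δ : ℕ, ((b δ * ((δ : ℝ) + 1) : ℝ) : ℂ) * expCoeff b y (n - (δ + 1)) := by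
  set b' : ℕ → ℝ := fun δ => b δ * ((δ : ℝ) + 1) with hb'
  have hb'0 : ∀ δ, 0 ≤ b' δ := fun δ => mul_nonneg (hb δ) (by positivity)
  have hs0 := summable_of_summable_mul hb hs
  have hc := continuous_angSum hb hs0
  have hc' := continuous_angSum hb'0 hs
  set F : ℝ → ℂ := fun θ => cexp ((-(n * θ) : ℝ) * I) * cexp (y * angSum b θ) with hF
  have hFc : Continuous F := by
    have : Continuous fun θ => cexp (y * angSum b θ) := continuous_exp.comp (continuous_const.mul hc)
    exact Continuous.mul (by fun_prop) this
  have hder : ∀ θ, HasDerivAt F (I * (y * (angSum b' θ * F θ) - n * F θ)) θ := by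
    intro θ
    have h1 : HasDerivAt (fun θ : ℝ => ((-(n * θ) : ℝ) : ℂ) * I) (-(n : ℂ) * I) θ := by
      have := ((((hasDerivAt_id θ).const_mul (n : ℝ)).neg).ofReal_comp).mul_const I
      simpa using this
    refine (h1.cexp.fun_mul ((hasDerivAt_angSum hb hs θ).const_mul (y : ℂ)).cexp).congr_deriv ?_
    simp only [hF, hb']
    ring
  have hFper : F Real.pi = F (-Real.pi) := by
    have h1 : ∀ δ : ℕ, cexp ((((δ : ℝ) + 1) * Real.pi : ℝ) * I) =
        cexp ((((δ : ℝ) + 1) * (-Real.pi) : ℝ) * I) := by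
      intro δ
      rw [Complex.exp_eq_exp_iff_exists_int]
      exact ⟨δ + 1, by push_cast; ring⟩
    have h2 : cexp ((-(n * Real.pi) : ℝ) * I) = cexp ((-(n * (-Real.pi)) : ℝ) * I) := by
      rw [Complex.exp_eq_exp_iff_exists_int]
      exact ⟨-n, by push_cast; ring⟩
    simp only [hF, angSum, h1, h2]
  have hintg := intervalIntegral.integral_eq_sub_of_hasDerivAt (a := -Real.pi) (b := Real.pi)
    (fun θ _ => hder θ) (by
      apply Continuous.intervalIntegrable
      exact continuous_const.mul ((continuous_const.mul (hc'.mul hFc)).sub (continuous_const.mul hFc)))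
  rw [hFper, sub_self, intervalIntegral.integral_const_mul, mul_eq_zero, or_iff_right I_ne_zero,
    intervalIntegral.integral_sub (f := fun θ => (y : ℂ) * (angSum b' θ * F θ))
      (g := fun θ => (n : ℂ) * F θ) ((continuous_const.mul (hc'.mul hFc)).intervalIntegrable _ _)
      ((continuous_const.mul hFc).intervalIntegrable _ _), intervalIntegral.integral_const_mul,
    intervalIntegral.integral_const_mul, sub_eq_zero] at hintg
  have hdom := intervalIntegral.hasSum_integral_of_dominated_convergence (μ := volume)
    (a := -Real.pi) (b := Real.pi)
    (F := fun (δ : ℕ) θ => ((b' δ : ℂ) * cexp ((((δ : ℝ) + 1) * θ : ℝ) * I)) * F θ)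
    (f := fun θ => angSum b' θ * F θ) (fun δ θ => b' δ * ‖F θ‖)
    (fun δ => (Continuous.mul (by fun_prop) hFc).aestronglyMeasurable)
    (fun δ => Eventually.of_forall fun θ _ => by rw [norm_mul, norm_angSum_term b' hb'0])
    (Eventually.of_forall fun θ _ => hs.mul_right _)
    (by
      simp_rw [tsum_mul_right]
      exact (continuous_const.mul hFc.norm).intervalIntegrable _ _)
    (Eventually.of_forall fun θ _ => (summable_angSum hb'0 hs θ).hasSum.mul_right _)
  rw [expCoeff, ← hintg, ← hdom.tsum_eq]
  congr 2
  ext δ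
  rw [expCoeff, ← intervalIntegral.integral_const_mul]
  congr 1
  ext θ
  simp only [hF]
  rw [mul_assoc, ← mul_assoc (cexp _) (cexp _), ← exp_add]
  congr 3
  push_cast
  ring_nf

/-- The solution of the recursion `n q_n = y ∑ (k+1) b_k q_{n-k-1}` is given by Cauchy's formula. -/
theorem eq_expCoeff_of_recursion {b : ℕ → ℝ} (hb : ∀ δ, 0 ≤ b δ)
    (hs : Summable fun δ : ℕ => b δ * ((δ : ℝ) + 1)) {y : ℝ} {q : ℕ → ℝ} (h0 : q 0 = 1)
    (hq : ∀ n : ℕ, (n : ℝ) * q n =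
      y * ∑ k ∈ Finset.range n, (b k * ((k : ℝ) + 1)) * q (n - (k + 1))) (n : ℕ) :
    (2 * Real.pi * q n : ℂ) = expCoeff b y n := by
  have hs0 := summable_of_summable_mul hb hs
  induction n using Nat.strong_induction_on with
  | _ n ih =>
  rcases Nat.eq_zero_or_pos n with rfl | hn
  · rw [h0, Nat.cast_zero, expCoeff_zero hb hs0]; simp
  have h1 := intCast_mul_expCoeff hb hs y n
  rw [tsum_eq_sum (s := Finset.range n) (fun k hk => by
    rw [Finset.mem_range, not_lt] at hk
    rw [expCoeff_of_neg hb hs0 y (by omega), mul_zero])] at h1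
  have hn' : ((n : ℤ) : ℂ) ≠ 0 := by exact_mod_cast hn.ne'
  refine mul_left_cancel₀ hn' ?_
  rw [h1]
  have h2 : ((n : ℂ)) * q n =
      y * ∑ k ∈ Finset.range n, ((b k * ((k : ℝ) + 1) : ℝ) : ℂ) * q (n - (k + 1)) := by
    exact_mod_cast congrArg (fun r : ℝ => (r : ℂ)) (hq n)
  rw [Int.cast_natCast, mul_left_comm, h2, Finset.mul_sum, Finset.mul_sum, Finset.mul_sum]
  refine Finset.sum_congr rfl fun k hk => ?_
  have hk' := Finset.mem_range.1 hk
  rw [show (n : ℤ) - ((k : ℤ) + 1) = ((n - (k + 1) : ℕ) : ℤ) by omega,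
    ← ih _ (by omega)]
  ring

theorem angSum_zero (b : ℕ → ℝ) : angSum b 0 = ((∑' δ, b δ : ℝ) : ℂ) := by
  simp [angSum, Complex.ofReal_tsum]

/-- The derivatives of the Fourier coefficients `expCoeff b y n` in `y`. -/
noncomputable def expMoment (b : ℕ → ℝ) (n : ℕ) (j : ℕ) (y : ℝ) : ℂ :=
  ∫ θ in (-Real.pi)..Real.pi, cexp ((-(n * θ) : ℝ) * I) * (angSum b θ ^ j * cexp (y * angSum b θ))

theorem hasDerivAt_expMoment {b : ℕ → ℝ} (hb : ∀ δ, 0 ≤ b δ) (hs : Summable b) (n j : ℕ) (y : ℝ) :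
    HasDerivAt (expMoment b n j) (expMoment b n (j + 1) y) y := by
  have hc := continuous_angSum hb hs
  set B := ∑' δ, b δ
  have hB : 0 ≤ B := tsum_nonneg hb
  have hcont : ∀ (k : ℕ) (z : ℝ), Continuous fun θ : ℝ =>
      cexp ((-(n * θ) : ℝ) * I) * (angSum b θ ^ k * cexp (z * angSum b θ)) := by
    intro k z
    have : Continuous fun θ => cexp (z * angSum b θ) := continuous_exp.comp (continuous_const.mul hc)
    exact Continuous.mul (by fun_prop) ((hc.pow k).mul this)
  have h := intervalIntegral.hasDerivAt_integral_of_dominated_loc_of_deriv_le (𝕜 := ℝ)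
    (μ := volume) (a := -Real.pi) (b := Real.pi) (x₀ := y)
    (F := fun z θ => cexp ((-(n * θ) : ℝ) * I) * (angSum b θ ^ j * cexp (z * angSum b θ)))
    (F' := fun z θ => cexp ((-(n * θ) : ℝ) * I) * (angSum b θ ^ (j + 1) * cexp (z * angSum b θ)))
    (bound := fun _ => B ^ (j + 1) * Real.exp ((|y| + 1) * B))
    (Metric.ball_mem_nhds y one_pos)
    (Eventually.of_forall fun z => (hcont j z).aestronglyMeasurable)
    ((hcont j y).intervalIntegrable _ _)
    (hcont (j + 1) y).aestronglyMeasurable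
    (Eventually.of_forall fun θ _ z hz => by
      rw [norm_mul, norm_exp_ofReal_mul_I, one_mul, norm_mul, norm_pow]
      gcongr
      · exact norm_angSum_le hb hs θ
      · refine (norm_exp_le_exp_norm _).trans (Real.exp_le_exp.2 ?_)
        rw [norm_mul, norm_real]
        gcongr
        · rw [Metric.mem_ball, dist_eq_norm, Real.norm_eq_abs] at hz
          have := abs_sub_abs_le_abs_sub z y
          rw [Real.norm_eq_abs]; linarith
        · exact norm_angSum_le hb hs θ)
    (continuous_const.intervalIntegrable _ _)
    (Eventually.of_forall fun θ _ z hz => by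
      have h1 : HasDerivAt (fun z : ℝ => (z : ℂ) * angSum b θ) (angSum b θ) z := by
        simpa using (hasDerivAt_id z).ofReal_comp.mul_const (angSum b θ)
      refine ((h1.cexp.const_mul (angSum b θ ^ j)).const_mul _).congr_deriv ?_
      ring)
  exact h.2

/-- The moments of the recentred series `angSum b θ - angSum b 0`. -/
noncomputable def centredMoment (b : ℕ → ℝ) (n : ℕ) (x : ℝ) (j : ℕ) : ℂ :=
  ∫ θ in (-Real.pi)..Real.pi, cexp ((-(n * θ) : ℝ) * I) *
    ((angSum b θ - angSum b 0) ^ j * cexp (x * (angSum b θ - angSum b 0)))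

theorem expMoment_eq {b : ℕ → ℝ} (hb : ∀ δ, 0 ≤ b δ) (hs : Summable b) (n : ℕ) (x : ℝ) :
    expMoment b n 0 x = (Real.exp (x * ∑' δ, b δ) : ℝ) * centredMoment b n x 0 ∧
    expMoment b n 1 x = (Real.exp (x * ∑' δ, b δ) : ℝ) *
      ((∑' δ, b δ : ℝ) * centredMoment b n x 0 + centredMoment b n x 1) ∧
    expMoment b n 2 x = (Real.exp (x * ∑' δ, b δ) : ℝ) *
      (((∑' δ, b δ) ^ 2 : ℝ) * centredMoment b n x 0 +
        (2 * ∑' δ, b δ : ℝ) * centredMoment b n x 1 + centredMoment b n x 2) := by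
  have hc := continuous_angSum hb hs
  set B := ∑' δ, b δ with hB
  have hintg : ∀ j : ℕ, IntervalIntegrable (fun θ : ℝ => cexp ((-(n * θ) : ℝ) * I) *
      ((angSum b θ - angSum b 0) ^ j * cexp (x * (angSum b θ - angSum b 0)))) volume
      (-Real.pi) Real.pi := by
    intro j
    apply Continuous.intervalIntegrable
    have h1 : Continuous fun θ => angSum b θ - angSum b 0 := hc.sub continuous_const
    have : Continuous fun θ => cexp (x * (angSum b θ - angSum b 0)) :=
      continuous_exp.comp (continuous_const.mul h1)
    exact Continuous.mul (by fun_prop) ((h1.pow j).mul this)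
  have hexp : ∀ θ, cexp (x * angSum b θ) =
      (Real.exp (x * B) : ℝ) * cexp (x * (angSum b θ - angSum b 0)) := by
    intro θ
    rw [angSum_zero, ← hB, ofReal_exp, ← exp_add]
    push_cast
    ring_nf
  have h0 : angSum b 0 = (B : ℂ) := angSum_zero b
  refine ⟨?_, ?_, ?_⟩
  · rw [expMoment, centredMoment, ← intervalIntegral.integral_const_mul]
    congr 1; ext θ
    rw [hexp]; ring
  · rw [expMoment, centredMoment, centredMoment, ← intervalIntegral.integral_const_mul,
      ← intervalIntegral.integral_add ((hintg 0).const_mul _) (hintg 1),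
      ← intervalIntegral.integral_const_mul]
    congr 1; ext θ
    rw [hexp, h0]; ring
  · rw [expMoment, centredMoment, centredMoment, centredMoment,
      ← intervalIntegral.integral_const_mul, ← intervalIntegral.integral_const_mul,
      ← intervalIntegral.integral_add ((hintg 0).const_mul _) ((hintg 1).const_mul _),
      ← intervalIntegral.integral_add (((hintg 0).const_mul _).add ((hintg 1).const_mul _)) (hintg 2),
      ← intervalIntegral.integral_const_mul]
    congr 1; ext θ
    rw [hexp, h0]; push_cast; ring

/-- The variance in terms of circle integrals. -/
theorem variance_eq_centredMoment (G : Type*) [Group G] [Group.FG G]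
    (hfin : ∀ k, 1 ≤ k → Finite {H : Subgroup G // H.index = k}) (n : ℕ) (x τ : ℝ) {b : ℕ → ℝ}
    (hb : ∀ δ : ℕ, b δ * ((δ : ℝ) + 1) = aCount G (δ + 1) * Real.exp (-τ * (δ + 1)))
    (hs : Summable fun δ : ℕ => (aCount G (δ + 1) : ℝ) * Real.exp (-τ * (δ + 1)))
    (h0 : (centredMoment b n x 0).re ≠ 0) :
    expVal G n x (fun y => y ^ 2) - (expVal G n x id) ^ 2 =
      x ^ 2 * ((centredMoment b n x 2).re / (centredMoment b n x 0).re) +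
      x * ∑' δ, b δ + x * ((centredMoment b n x 1).re / (centredMoment b n x 0).re) -
      x ^ 2 * ((centredMoment b n x 1).re / (centredMoment b n x 0).re) ^ 2 := by
  have hs' : Summable fun δ : ℕ => b δ * ((δ : ℝ) + 1) := by simpa only [hb] using hs
  have hb0 : ∀ δ, 0 ≤ b δ := fun δ => by
    have h1 : (0 : ℝ) < (δ : ℝ) + 1 := by positivity
    have h2 : 0 ≤ b δ * ((δ : ℝ) + 1) := by rw [hb]; positivity
    exact nonneg_of_mul_nonneg_left h2 h1
  have hs0 := summable_of_summable_mul hb0 hs'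
  have hrec : ∀ y, ((2 * Real.pi * (homWeight G (Fin n) y / n.factorial * Real.exp (-τ * n)) : ℝ) : ℂ)
      = expMoment b n 0 y := by
    intro y
    have h := eq_expCoeff_of_recursion hb0 hs' (y := y)
      (q := fun k => homWeight G (Fin k) y / k.factorial * Real.exp (-τ * k))
      (by simp [homWeight_fin_zero]) (fun k => by
        rw [← mul_assoc, natCast_mul_homWeight_div_factorial G hfin, mul_assoc, Finset.sum_mul]
        congr 1
        refine Finset.sum_congr rfl fun i hi => ?_
        have hi' : i + 1 ≤ k := Finset.mem_range.1 hi
        rw [hb, show -τ * (k : ℝ) = -τ * (i + 1) + -τ * (k - (i + 1) : ℕ) by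
          rw [Nat.cast_sub hi']; push_cast; ring, Real.exp_add]
        ring) n
    rw [expMoment]
    rw [expCoeff] at h
    push_cast at h ⊢
    rw [h]
    simp
  set C : ℝ := n.factorial * Real.exp (τ * n) / (2 * Real.pi) with hC
  have hCpos : 0 < C := by positivity
  have hW : homWeight G (Fin n) = fun y => C * (expMoment b n 0 y).re := by
    ext y
    rw [← hrec, ofReal_re, hC, neg_mul, Real.exp_neg]
    have := Real.pi_pos.ne'
    field_simp
  have hre : ∀ (j : ℕ) (y : ℝ), HasDerivAt (fun y => (expMoment b n j y).re)
      (expMoment b n (j + 1) y).re y := fun j y => by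
    simpa [Function.comp_def] using (reCLM.hasFDerivAt.comp_hasDerivAt y (hasDerivAt_expMoment hb0 hs0 n j y))
  have hd : ∀ y, HasDerivAt (homWeight G (Fin n)) (C * (expMoment b n 1 y).re) y := fun y => by
    rw [hW]; exact (hre 0 y).const_mul C
  have he : HasDerivAt (fun y => C * (expMoment b n 1 y).re) (C * (expMoment b n 2 x).re) x :=
    (hre 1 x).const_mul C
  rw [expVal_sq_of_hasDerivAt hd he, expVal_id_of_hasDerivAt (hd x), hW]
  dsimp only
  obtain ⟨e0, e1, e2⟩ := expMoment_eq hb0 hs0 n x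
  rw [e0, e1, e2]
  simp only [re_ofReal_mul, add_re]
  have := Real.exp_pos (x * ∑' δ, b δ)
  field_simp
  ring

theorem norm_cexp_mul_I_sub_one_le (y : ℝ) : ‖cexp (y * I) - 1‖ ≤ |y| := by
  rw [mul_comm]; exact Real.norm_exp_I_mul_ofReal_sub_one_le

theorem norm_cexp_mul_I_sub_one_sub_le (y : ℝ) : ‖cexp (y * I) - 1 - y * I‖ ≤ 3 * y ^ 2 := by
  have hn : ‖(y * I : ℂ)‖ = |y| := by simp
  rcases le_or_gt |y| 1 with h | h
  · refine (norm_exp_sub_one_sub_id_le (by rw [hn]; exact h)).trans ?_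
    rw [hn, sq_abs]; nlinarith [sq_nonneg y]
  · refine (norm_sub_le _ _).trans ?_
    have := norm_cexp_mul_I_sub_one_le y
    rw [hn, ← sq_abs]
    nlinarith

theorem norm_cexp_mul_I_sub_quadratic_le (y : ℝ) :
    ‖cexp (y * I) - 1 - y * I + y ^ 2 / 2‖ ≤ 4 * |y| ^ 3 := by
  have hn : ‖(y * I : ℂ)‖ = |y| := by simp
  rcases le_or_gt |y| 1 with h | h
  · have h1 := exp_bound (x := y * I) (by rw [hn]; exact h) (n := 3) (by norm_num)
    rw [hn] at h1
    have h2 : cexp (y * I) - 1 - y * I + y ^ 2 / 2 =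
        cexp (y * I) - ∑ m ∈ Finset.range 3, (y * I : ℂ) ^ m / m.factorial := by
      simp only [Finset.sum_range_succ, Finset.range_zero, Finset.sum_empty, Nat.factorial]
      push_cast
      ring_nf
      rw [I_sq]; ring
    rw [h2]
    refine h1.trans ?_
    rw [mul_comm]
    gcongr
    norm_num [Nat.factorial]
  · refine (norm_add_le _ _).trans ?_
    have := norm_cexp_mul_I_sub_one_sub_le y
    have h3 : ‖(y ^ 2 / 2 : ℂ)‖ = |y| ^ 2 / 2 := by simp
    rw [h3]
    rw [← sq_abs] at this
    nlinarith [sq_nonneg |y|]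

theorem quadratic_sub_quartic_le_one_sub_cos (y : ℝ) :
    y ^ 2 / 2 - y ^ 4 / 2 ≤ 1 - Real.cos y := by
  rcases le_or_gt |y| 1 with h | h
  · have := (abs_le.1 (Real.cos_bound h)).2
    have h4 : |y| ^ 4 = y ^ 4 := by rw [← abs_pow, abs_of_nonneg (by positivity)]
    rw [h4] at this
    nlinarith [show 0 ≤ y ^ 4 by positivity]
  · have h2 : 1 ≤ y ^ 2 := by rw [← sq_abs]; nlinarith
    have := Real.cos_le_one y
    nlinarith

/-- The power moments `∑ b_δ (δ+1)^j`. -/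
noncomputable def powMoment (b : ℕ → ℝ) (j : ℕ) : ℝ := ∑' δ : ℕ, b δ * ((δ : ℝ) + 1) ^ j

theorem powMoment_nonneg {b : ℕ → ℝ} (hb : ∀ δ, 0 ≤ b δ) (j : ℕ) : 0 ≤ powMoment b j :=
  tsum_nonneg fun δ => mul_nonneg (hb δ) (by positivity)

section

variable {b : ℕ → ℝ}

theorem hasSum_angSum_sub (hb : ∀ δ, 0 ≤ b δ) (hs : Summable b) (θ : ℝ) :
    HasSum (fun δ : ℕ => (b δ : ℂ) * (cexp ((((δ : ℝ) + 1) * θ : ℝ) * I) - 1))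
      (angSum b θ - angSum b 0) := by
  have := (summable_angSum hb hs θ).hasSum.sub (summable_angSum hb hs 0).hasSum
  refine (this.congr_fun ?_)
  intro δ
  simp [mul_sub]

theorem norm_angSum_sub_le (hb : ∀ δ, 0 ≤ b δ) (hs0 : Summable b)
    (hs1 : Summable fun δ : ℕ => b δ * ((δ : ℝ) + 1) ^ 1) (θ : ℝ) :
    ‖angSum b θ - angSum b 0‖ ≤ powMoment b 1 * |θ| := by
  rw [← (hasSum_angSum_sub hb hs0 θ).tsum_eq]
  refine tsum_of_norm_bounded (hs1.hasSum.mul_right |θ|) fun δ => ?_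
  rw [norm_mul, norm_real, Real.norm_of_nonneg (hb δ), mul_assoc]
  refine mul_le_mul_of_nonneg_left ((norm_cexp_mul_I_sub_one_le _).trans ?_) (hb δ)
  rw [abs_mul, abs_of_pos (by positivity), pow_one]

theorem norm_angSum_sub_linear_le (hb : ∀ δ, 0 ≤ b δ) (hs0 : Summable b)
    (hs1 : Summable fun δ : ℕ => b δ * ((δ : ℝ) + 1) ^ 1)
    (hs2 : Summable fun δ : ℕ => b δ * ((δ : ℝ) + 1) ^ 2) (θ : ℝ) :
    ‖angSum b θ - angSum b 0 - (powMoment b 1 * θ : ℝ) * I‖ ≤ powMoment b 2 * (3 * θ ^ 2) := by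
  have h := (hasSum_angSum_sub hb hs0 θ).sub
    ((hasSum_ofReal.2 (hs1.hasSum.mul_right θ)).mul_right I)
  rw [powMoment, ← h.tsum_eq]
  refine tsum_of_norm_bounded (hs2.hasSum.mul_right _) fun δ => ?_
  have e : (b δ : ℂ) * (cexp ((((δ : ℝ) + 1) * θ : ℝ) * I) - 1) -
      ((b δ * ((δ : ℝ) + 1) ^ 1 * θ : ℝ) : ℂ) * I = (b δ : ℂ) *
      (cexp ((((δ : ℝ) + 1) * θ : ℝ) * I) - 1 - (((δ : ℝ) + 1) * θ : ℝ) * I) := by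
    push_cast; ring
  rw [e, norm_mul, norm_real, Real.norm_of_nonneg (hb δ), mul_assoc]
  refine mul_le_mul_of_nonneg_left ((norm_cexp_mul_I_sub_one_sub_le _).trans (le_of_eq ?_)) (hb δ)
  ring

theorem norm_angSum_sub_quadratic_le (hb : ∀ δ, 0 ≤ b δ) (hs0 : Summable b)
    (hs1 : Summable fun δ : ℕ => b δ * ((δ : ℝ) + 1) ^ 1)
    (hs2 : Summable fun δ : ℕ => b δ * ((δ : ℝ) + 1) ^ 2)
    (hs3 : Summable fun δ : ℕ => b δ * ((δ : ℝ) + 1) ^ 3) (θ : ℝ) :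
    ‖angSum b θ - angSum b 0 - (powMoment b 1 * θ : ℝ) * I + (powMoment b 2 * (θ ^ 2 / 2) : ℝ)‖ ≤
      powMoment b 3 * (4 * |θ| ^ 3) := by
  have h := ((hasSum_angSum_sub hb hs0 θ).sub
    ((hasSum_ofReal.2 (hs1.hasSum.mul_right θ)).mul_right I)).add
    (hasSum_ofReal.2 (hs2.hasSum.mul_right (θ ^ 2 / 2)))
  rw [powMoment, powMoment, ← h.tsum_eq]
  refine tsum_of_norm_bounded (hs3.hasSum.mul_right _) fun δ => ?_
  have e : (b δ : ℂ) * (cexp ((((δ : ℝ) + 1) * θ : ℝ) * I) - 1) -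
      ((b δ * ((δ : ℝ) + 1) ^ 1 * θ : ℝ) : ℂ) * I +
      ((b δ * ((δ : ℝ) + 1) ^ 2 * (θ ^ 2 / 2) : ℝ) : ℂ) = (b δ : ℂ) *
      (cexp ((((δ : ℝ) + 1) * θ : ℝ) * I) - 1 - (((δ : ℝ) + 1) * θ : ℝ) * I +
        ((((δ : ℝ) + 1) * θ : ℝ) : ℂ) ^ 2 / 2) := by
    push_cast; ring
  rw [e, norm_mul, norm_real, Real.norm_of_nonneg (hb δ), mul_assoc]
  refine mul_le_mul_of_nonneg_left ((norm_cexp_mul_I_sub_quadratic_le _).trans (le_of_eq ?_)) (hb δ)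
  rw [abs_mul, abs_of_pos (show (0 : ℝ) < (δ : ℝ) + 1 by positivity)]
  ring

theorem hasSum_re_angSum_sub (hb : ∀ δ, 0 ≤ b δ) (hs : Summable b) (θ : ℝ) :
    HasSum (fun δ : ℕ => b δ * (1 - Real.cos (((δ : ℝ) + 1) * θ)))
      (-(angSum b θ - angSum b 0).re) := by
  have := (hasSum_re (hasSum_angSum_sub hb hs θ)).neg
  refine this.congr_fun fun δ => ?_
  rw [re_ofReal_mul, sub_re, exp_ofReal_mul_I_re, one_re]
  ring

theorem re_angSum_sub_le_of_moments (hb : ∀ δ, 0 ≤ b δ) (hs0 : Summable b)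
    (hs2 : Summable fun δ : ℕ => b δ * ((δ : ℝ) + 1) ^ 2)
    (hs4 : Summable fun δ : ℕ => b δ * ((δ : ℝ) + 1) ^ 4) (θ : ℝ) :
    (angSum b θ - angSum b 0).re ≤ -(powMoment b 2 * (θ ^ 2 / 2) - powMoment b 4 * (θ ^ 4 / 2)) := by
  rw [le_neg]
  refine hasSum_le (fun δ => ?_) ((hs2.hasSum.mul_right (θ ^ 2 / 2)).sub
    (hs4.hasSum.mul_right (θ ^ 4 / 2))) (hasSum_re_angSum_sub hb hs0 θ)
  refine le_trans (le_of_eq ?_) (mul_le_mul_of_nonneg_left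
    (quadratic_sub_quartic_le_one_sub_cos (((δ : ℝ) + 1) * θ)) (hb δ))
  ring

end

theorem norm_sq_one_sub_exp (r θ : ℝ) : ‖(1 : ℂ) - r * cexp (θ * I)‖ ^ 2 =
    (1 - r) ^ 2 + 2 * r * (1 - Real.cos θ) := by
  rw [← normSq_eq_norm_sq, normSq_apply]
  simp only [sub_re, one_re, re_ofReal_mul, exp_ofReal_mul_I_re, sub_im, one_im, im_ofReal_mul,
    exp_ofReal_mul_I_im]
  linear_combination r ^ 2 * Real.sin_sq_add_cos_sq θ

theorem hasSum_pow_mul_one_sub_cos {r : ℝ} (h0 : 0 < r) (h1 : r < 1) (θ : ℝ) :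
    HasSum (fun δ : ℕ => r ^ (δ + 1) * (1 - Real.cos (((δ : ℝ) + 1) * θ)))
      (r * (1 - Real.cos θ) * (1 + r) /
        ((1 - r) * ((1 - r) ^ 2 + 2 * r * (1 - Real.cos θ)))) := by
  set z : ℂ := r * cexp (θ * I) with hz
  have hzn : ‖z‖ = r := by
    rw [hz, norm_mul, norm_exp_ofReal_mul_I, norm_real, Real.norm_of_nonneg h0.le, mul_one]
  have g1 := (hasSum_geometric_of_lt_one h0.le h1).mul_left r
  have g2 := hasSum_re ((hasSum_geometric_of_norm_lt_one (hzn.trans_lt h1)).mul_left z)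
  have hval : (z * (1 - z)⁻¹).re =
      (r * Real.cos θ - r ^ 2) / ((1 - r) ^ 2 + 2 * r * (1 - Real.cos θ)) := by
    rw [← div_eq_mul_inv, div_re, normSq_eq_norm_sq, norm_sq_one_sub_exp, ← add_div]
    congr 1
    simp only [hz, sub_re, one_re, re_ofReal_mul, exp_ofReal_mul_I_re, sub_im, one_im, im_ofReal_mul,
      exp_ofReal_mul_I_im]
    linear_combination (-r ^ 2) * Real.sin_sq_add_cos_sq θ
  have hD : 0 < (1 - r) ^ 2 + 2 * r * (1 - Real.cos θ) := by
    have := Real.cos_le_one θ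
    have : 0 ≤ 2 * r * (1 - Real.cos θ) := mul_nonneg (by linarith) (by linarith)
    have : 0 < (1 - r) ^ 2 := by apply pow_pos; linarith
    linarith
  have h1r : 1 - r ≠ 0 := by linarith
  have := g1.sub g2
  rw [hval] at this
  have e : r * (1 - Real.cos θ) * (1 + r) / ((1 - r) * ((1 - r) ^ 2 + 2 * r * (1 - Real.cos θ))) =
      r * (1 - r)⁻¹ -
        (r * Real.cos θ - r ^ 2) / ((1 - r) ^ 2 + 2 * r * (1 - Real.cos θ)) := by
    rw [eq_sub_iff_add_eq, ← div_eq_mul_inv, div_add_div _ _ (mul_ne_zero h1r hD.ne') hD.ne',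
      div_eq_div_iff (mul_ne_zero (mul_ne_zero h1r hD.ne') hD.ne') h1r]
    ring
  rw [e]
  refine this.congr_fun fun δ => ?_
  · have : (z * z ^ δ) = ((r ^ (δ + 1) : ℝ) : ℂ) * cexp ((((δ : ℝ) + 1) * θ : ℝ) * I) := by
      rw [← pow_succ', hz, mul_pow, ← exp_nat_mul]
      push_cast; ring_nf
    rw [this, re_ofReal_mul, exp_ofReal_mul_I_re]
    ring

/-- Away from `θ = 0` the tail bound `κ τ ≤ |θ|` gives a loss of order `τ⁻¹`. -/
theorem exists_le_tsum_one_sub_cos {κ : ℝ} (hκ : 0 < κ) : ∃ K : ℝ, 0 < K ∧ ∀ τ θ : ℝ, 0 < τ →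
    τ ≤ 1 / 2 → κ * τ ≤ |θ| → |θ| ≤ Real.pi → Summable (fun δ : ℕ => Real.exp (-τ * (δ + 1)) *
      (1 - Real.cos (((δ : ℝ) + 1) * θ))) ∧ K / τ ≤ ∑' δ : ℕ, Real.exp (-τ * (δ + 1)) *
      (1 - Real.cos (((δ : ℝ) + 1) * θ)) := by
  set C := Real.pi ^ 2 / (2 * κ ^ 2) with hC
  have hC0 : 0 < C := by have := Real.pi_pos; positivity
  refine ⟨1 / (2 * (C + 2)), by positivity, fun τ θ hτ hτ2 h1 h2 => ?_⟩
  set r := Real.exp (-τ) with hr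
  have hr0 : 0 < r := Real.exp_pos _
  have hr1 : r < 1 := by rw [hr, Real.exp_lt_one_iff]; linarith
  have hr2 : 1 - τ ≤ r := by have := Real.add_one_le_exp (-τ); linarith
  have H := hasSum_pow_mul_one_sub_cos hr0 hr1 θ
  have e : (fun δ : ℕ => Real.exp (-τ * (δ + 1)) * (1 - Real.cos (((δ : ℝ) + 1) * θ))) =
      fun δ : ℕ => r ^ (δ + 1) * (1 - Real.cos (((δ : ℝ) + 1) * θ)) := by
    ext δ
    rw [hr, ← Real.exp_nat_mul]
    push_cast; ring_nf
  rw [e]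
  refine ⟨H.summable, ?_⟩
  rw [H.tsum_eq]
  set q := 1 - Real.cos θ with hq
  have hqb : 2 / Real.pi ^ 2 * θ ^ 2 ≤ q := by
    have := Real.cos_le_one_sub_mul_cos_sq h2
    linarith
  have hpi := Real.pi_pos
  have hqτ : τ ^ 2 ≤ C * q := by
    have h3 : (κ * τ) ^ 2 ≤ θ ^ 2 := by rw [← sq_abs θ]; gcongr
    calc τ ^ 2 = C * (2 / Real.pi ^ 2 * (κ * τ) ^ 2) := by rw [hC]; field_simp
      _ ≤ C * q := by gcongr; refine le_trans ?_ hqb; gcongr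
  have hq0 : 0 < q := by
    by_contra hneg
    nlinarith [pow_pos hτ 2]
  have hb : (1 - r) ^ 2 + 2 * r * q ≤ (C + 2) * q := by
    have : (1 - r) ^ 2 ≤ τ ^ 2 := by
      apply pow_le_pow_left₀ <;> linarith
    nlinarith
  have hpos : 0 < (1 - r) * ((1 - r) ^ 2 + 2 * r * q) := by
    apply mul_pos (by linarith); positivity
  have h3 : (1 - r) * ((1 - r) ^ 2 + 2 * r * q) ≤ τ * ((C + 2) * q) := by
    apply mul_le_mul (by linarith) hb (by positivity) hτ.le
  calc 1 / (2 * (C + 2)) / τ = (1 / 2) * q / (τ * ((C + 2) * q)) := by field_simp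
    _ ≤ r * q * (1 + r) / ((1 - r) * ((1 - r) ^ 2 + 2 * r * q)) := by
      apply div_le_div₀ (by positivity) _ hpos h3
      have : 1 / 2 ≤ r := by linarith
      nlinarith [mul_pos hr0 hq0, mul_pos (mul_pos hr0 hq0) hr0]

/-- The weights `A_δ e^{-τ(δ+1)} / (δ+1)`. -/
noncomputable def tilt (A : ℕ → ℝ) (τ : ℝ) (δ : ℕ) : ℝ :=
  A δ / ((δ : ℝ) + 1) * Real.exp (-τ * (δ + 1))

/-- The integrand of the saddle point integral. -/
noncomputable def saddleIntegrand (b : ℕ → ℝ) (j : ℕ) (θ : ℝ) : ℂ :=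
  cexp ((-(powMoment b 1 * θ) : ℝ) * I) *
    ((angSum b θ - angSum b 0) ^ j * cexp (angSum b θ - angSum b 0))

theorem continuous_saddleIntegrand {b : ℕ → ℝ} (hb : ∀ δ, 0 ≤ b δ) (hs : Summable b) (j : ℕ) :
    Continuous (saddleIntegrand b j) := by
  have h1 : Continuous fun θ => angSum b θ - angSum b 0 :=
    (continuous_angSum hb hs).sub continuous_const
  have : Continuous fun θ => cexp (angSum b θ - angSum b 0) := continuous_exp.comp h1
  exact Continuous.mul (by fun_prop) ((h1.pow j).mul this)

theorem norm_saddleIntegrand (b : ℕ → ℝ) (j : ℕ) (θ : ℝ) : ‖saddleIntegrand b j θ‖ =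
    ‖angSum b θ - angSum b 0‖ ^ j * Real.exp (angSum b θ - angSum b 0).re := by
  rw [saddleIntegrand, norm_mul, norm_exp_ofReal_mul_I, one_mul, norm_mul, norm_pow, norm_exp]

theorem integrable_saddle_bound (C : ℝ) : Integrable fun u : ℝ =>
    C * ((1 + u ^ 2) * Real.exp (-(u ^ 2 / 4)) + (1 + u ^ 2)⁻¹) := by
  refine Integrable.const_mul (Integrable.add ?_ integrable_inv_one_add_sq) C
  have h1 := integrable_exp_neg_mul_sq (b := 1 / 4) (by norm_num)
  have h2 := integrable_rpow_mul_exp_neg_mul_sq (b := 1 / 4) (by norm_num) (s := 2) (by norm_num)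
  refine (h1.add h2).congr (Eventually.of_forall fun u => ?_)
  simp only [Pi.add_apply, Real.rpow_two]
  rw [show -(1 / 4) * u ^ 2 = -(u ^ 2 / 4) by ring]
  ring

set_option maxHeartbeats 1000000 in
theorem tendsto_saddle {A : ℕ → ℝ} {c : ℝ} (hc : 0 < c) (hA : ∀ δ : ℕ, c * ((δ : ℝ) + 1) ≤ A δ)
    (hsum : ∀ τ > 0, ∀ j : ℕ, Summable fun δ : ℕ => tilt A τ δ * ((δ : ℝ) + 1) ^ j)
    {ℓ lam : ℝ}
    (h1 : Tendsto (fun τ => powMoment (tilt A τ) 1 /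
      (√(powMoment (tilt A τ) 0) * √(powMoment (tilt A τ) 2))) (𝓝[>] 0) (𝓝 ℓ))
    (h2 : Tendsto (fun τ => powMoment (tilt A τ) 3 / √(powMoment (tilt A τ) 2) ^ 3)
      (𝓝[>] 0) (𝓝 0))
    (h3 : Tendsto (fun τ => τ ^ 2 * powMoment (tilt A τ) 4 / powMoment (tilt A τ) 2)
      (𝓝[>] 0) (𝓝 lam))
    (h4 : Tendsto (fun τ => powMoment (tilt A τ) 0) (𝓝[>] 0) atTop)
    (h5 : Tendsto (fun τ => powMoment (tilt A τ) 2) (𝓝[>] 0) atTop)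
    (h6 : ∀ K > 0, Tendsto (fun τ => (1 + Real.pi ^ 2 * powMoment (tilt A τ) 2) ^ 2 *
      Real.exp (-(K / τ))) (𝓝[>] 0) (𝓝 0))
    {j : ℕ} (hj : j ≤ 2) :
    Tendsto (fun τ => ((√(powMoment (tilt A τ) 2) / √(powMoment (tilt A τ) 0) ^ j : ℝ) : ℂ) *
      ∫ θ in (-Real.pi)..Real.pi, saddleIntegrand (tilt A τ) j θ) (𝓝[>] 0)
      (𝓝 (∫ u : ℝ, ((ℓ * u : ℝ) * I) ^ j * cexp ((-(u ^ 2 / 2) : ℝ)))) := by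
  have hb : ∀ τ δ, 0 ≤ tilt A τ δ := fun τ δ => by
    have : 0 ≤ A δ := le_trans (by positivity) (hA δ)
    unfold tilt; positivity
  have hbc : ∀ (τ : ℝ) (δ : ℕ), c * Real.exp (-τ * (δ + 1)) ≤ tilt A τ δ := fun τ δ => by
    unfold tilt
    gcongr
    rw [le_div_iff₀ (by positivity)]
    exact hA δ
  have hs0 : ∀ τ > 0, Summable (tilt A τ) := fun τ hτ => by simpa using hsum τ hτ 0
  set T : ℕ → ℝ → ℝ := fun j τ => powMoment (tilt A τ) j with hT
  change Tendsto (fun τ => T 1 τ / (√(T 0 τ) * √(T 2 τ))) (𝓝[>] 0) (𝓝 ℓ) at h1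
  change Tendsto (fun τ => T 3 τ / √(T 2 τ) ^ 3) (𝓝[>] 0) (𝓝 0) at h2
  change Tendsto (fun τ => τ ^ 2 * T 4 τ / T 2 τ) (𝓝[>] 0) (𝓝 lam) at h3
  change Tendsto (fun τ => T 0 τ) (𝓝[>] 0) atTop at h4
  change Tendsto (fun τ => T 2 τ) (𝓝[>] 0) atTop at h5
  change ∀ K > 0, Tendsto (fun τ => (1 + Real.pi ^ 2 * T 2 τ) ^ 2 *
    Real.exp (-(K / τ))) (𝓝[>] 0) (𝓝 0) at h6
  have hpi := Real.pi_pos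
  -- rescaling
  have hrescale : ∀ᶠ τ in 𝓝[>] (0 : ℝ),
      (∫ u : ℝ, (Set.Ioc (-Real.pi * √(T 2 τ)) (Real.pi * √(T 2 τ))).indicator (fun u =>
        ((1 / √(T 0 τ) ^ j : ℝ) : ℂ) * saddleIntegrand (tilt A τ) j (u / √(T 2 τ))) u) =
      ((√(T 2 τ) / √(T 0 τ) ^ j : ℝ) : ℂ) *
        ∫ θ in (-Real.pi)..Real.pi, saddleIntegrand (tilt A τ) j θ := by
    filter_upwards [h5.eventually_gt_atTop 0] with τ hτ
    have hs : 0 < √(T 2 τ) := Real.sqrt_pos.2 hτ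
    rw [integral_indicator measurableSet_Ioc, ← intervalIntegral.integral_of_le (by nlinarith),
      intervalIntegral.integral_const_mul,
      intervalIntegral.integral_comp_div (fun θ => saddleIntegrand (tilt A τ) j θ) hs.ne',
      mul_div_cancel_right₀ _ hs.ne', mul_div_cancel_right₀ _ hs.ne', real_smul]
    push_cast
    ring
  refine Tendsto.congr' hrescale ?_
  set κ : ℝ := 1 / (2 * (|lam| + 1)) with hκ
  have hκ0 : 0 < κ := by positivity
  have hκ1 : κ ≤ 1 / 2 := by
    rw [hκ]; apply one_div_le_one_div_of_le (by norm_num); linarith [abs_nonneg lam]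
  have hκ2 : κ * (|lam| + 1) = 1 / 2 := by rw [hκ]; field_simp
  obtain ⟨K, hK, hKb⟩ := exists_le_tsum_one_sub_cos hκ0
  refine tendsto_integral_filter_of_dominated_convergence
    (fun u => (|ℓ| + 1) ^ j * ((1 + u ^ 2) * Real.exp (-(u ^ 2 / 4)) + (1 + u ^ 2)⁻¹)) ?_ ?_
    (integrable_saddle_bound _) ?_
  · filter_upwards [self_mem_nhdsWithin] with τ hτ
    refine (Continuous.aestronglyMeasurable ?_).indicator measurableSet_Ioc
    exact continuous_const.mul ((continuous_saddleIntegrand (hb τ) (hs0 τ hτ) j).comp (by fun_prop))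
  · have hτ2 : ∀ᶠ τ : ℝ in 𝓝[>] 0, τ ≤ 1 / 2 :=
      nhdsWithin_le_nhds (eventually_le_nhds (by norm_num))
    filter_upwards [self_mem_nhdsWithin, hτ2, h5.eventually_gt_atTop 0, h4.eventually_gt_atTop 0,
      h1.eventually (eventually_le_nhds (lt_of_le_of_lt (le_abs_self ℓ) (lt_add_one _))),
      h3.eventually (eventually_le_nhds (lt_of_le_of_lt (le_abs_self lam) (lt_add_one _))),
      (h6 (c * K) (by positivity)).eventually (eventually_le_nhds one_pos)] with
      τ hτ hτ2 g5 g4 g1 g3 g6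
    have hτ0 : (0 : ℝ) < τ := hτ
    refine Eventually.of_forall fun u => ?_
    have hbound0 : 0 ≤ (|ℓ| + 1) ^ j * ((1 + u ^ 2) * Real.exp (-(u ^ 2 / 4)) + (1 + u ^ 2)⁻¹) := by
      positivity
    by_cases hu : u ∈ Set.Ioc (-Real.pi * √(T 2 τ)) (Real.pi * √(T 2 τ))
    swap
    · rw [Set.indicator_of_notMem hu, norm_zero]; exact hbound0
    rw [Set.indicator_of_mem hu]
    have hs : 0 < √(T 2 τ) := Real.sqrt_pos.2 g5
    have hs' : 0 < √(T 0 τ) := Real.sqrt_pos.2 g4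
    have hss : √(T 2 τ) ^ 2 = T 2 τ := Real.sq_sqrt g5.le
    set θ := u / √(T 2 τ) with hθ
    have huθ : T 2 τ * θ ^ 2 = u ^ 2 := by
      rw [hθ, div_pow, hss]; field_simp
    have hupi : |u| ≤ Real.pi * √(T 2 τ) := abs_le.2 ⟨by linarith [hu.1], hu.2⟩
    have hθpi : |θ| ≤ Real.pi := by
      rw [hθ, abs_div, abs_of_pos hs, div_le_iff₀ hs]; exact hupi
    have hL : ‖angSum (tilt A τ) θ - angSum (tilt A τ) 0‖ / √(T 0 τ) ≤ (|ℓ| + 1) * |u| := by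
      have := norm_angSum_sub_le (hb τ) (hs0 τ hτ) (hsum τ hτ 1) θ
      calc _ ≤ (T 1 τ * |θ|) / √(T 0 τ) := by gcongr
        _ = T 1 τ / (√(T 0 τ) * √(T 2 τ)) * |u| := by
          rw [hθ, abs_div, abs_of_pos hs]; field_simp
        _ ≤ _ := by gcongr
    have hre : Real.exp (angSum (tilt A τ) θ - angSum (tilt A τ) 0).re ≤
        Real.exp (-(u ^ 2 / 4)) + ((1 + u ^ 2) ^ 2)⁻¹ := by
      rcases le_or_gt |θ| (κ * τ) with hθκ | hθκ
      · have hr := re_angSum_sub_le_of_moments (hb τ) (hs0 τ hτ) (hsum τ hτ 2) (hsum τ hτ 4) θ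
        refine le_trans (Real.exp_le_exp.2 (hr.trans ?_)) (le_add_of_nonneg_right (by positivity))
        have hT4 : 0 ≤ T 4 τ := powMoment_nonneg (hb τ) 4
        have e1 : τ ^ 2 * T 4 τ ≤ (|lam| + 1) * T 2 τ := (div_le_iff₀ g5).1 g3
        have e2 : θ ^ 2 ≤ κ ^ 2 * τ ^ 2 := by
          rw [← sq_abs θ, ← mul_pow]; gcongr
        have e3 : T 4 τ * θ ^ 4 ≤ 1 / 2 * u ^ 2 := by
          calc T 4 τ * θ ^ 4 = T 4 τ * θ ^ 2 * θ ^ 2 := by ring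
            _ ≤ T 4 τ * (κ ^ 2 * τ ^ 2) * θ ^ 2 := by gcongr
            _ = κ ^ 2 * (τ ^ 2 * T 4 τ) * θ ^ 2 := by ring
            _ ≤ κ ^ 2 * ((|lam| + 1) * T 2 τ) * θ ^ 2 := by gcongr
            _ = κ * (κ * (|lam| + 1)) * (T 2 τ * θ ^ 2) := by ring
            _ ≤ 1 * (1 / 2) * u ^ 2 := by rw [hκ2, huθ]; gcongr; linarith
            _ = _ := by ring
        change -(T 2 τ * (θ ^ 2 / 2) - T 4 τ * (θ ^ 4 / 2)) ≤ -(u ^ 2 / 4)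
        linarith
      · obtain ⟨k1, k2⟩ := hKb τ θ hτ0 hτ2 hθκ.le hθpi
        have k3 := hasSum_le (fun δ : ℕ => (mul_assoc _ _ _).symm.le.trans
          (mul_le_mul_of_nonneg_right (hbc τ δ)
            (sub_nonneg.2 (Real.cos_le_one (((δ : ℝ) + 1) * θ))))) (k1.hasSum.mul_left c) (hasSum_re_angSum_sub (hb τ) (hs0 τ hτ) θ)
        have k4 : c * K / τ ≤ -(angSum (tilt A τ) θ - angSum (tilt A τ) 0).re := by
          rw [mul_div_assoc]
          exact (mul_le_mul_of_nonneg_left k2 hc.le).trans k3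
        refine le_trans ?_ (le_add_of_nonneg_left (Real.exp_pos _).le)
        refine (Real.exp_le_exp.2 (by linarith : _ ≤ -(c * K / τ))).trans ?_
        have k5 : (1 + u ^ 2) ^ 2 ≤ (1 + Real.pi ^ 2 * T 2 τ) ^ 2 := by
          have : u ^ 2 ≤ Real.pi ^ 2 * T 2 τ := by
            rw [← hss, ← mul_pow, ← sq_abs u]; gcongr
          gcongr
        rw [← one_div, le_div_iff₀ (by positivity), mul_comm]
        exact (mul_le_mul_of_nonneg_right k5 (Real.exp_pos _).le).trans g6
    rw [norm_mul, norm_saddleIntegrand, norm_real, Real.norm_of_nonneg (by positivity)]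
    have hju : |u| ^ j ≤ 1 + u ^ 2 := by
      have h0 := abs_nonneg u
      rw [← sq_abs]
      interval_cases j <;> nlinarith [sq_nonneg (|u| - 1)]
    calc 1 / √(T 0 τ) ^ j * (‖angSum (tilt A τ) θ - angSum (tilt A τ) 0‖ ^ j *
          Real.exp (angSum (tilt A τ) θ - angSum (tilt A τ) 0).re)
        = (‖angSum (tilt A τ) θ - angSum (tilt A τ) 0‖ / √(T 0 τ)) ^ j *
          Real.exp (angSum (tilt A τ) θ - angSum (tilt A τ) 0).re := by rw [div_pow]; ring
      _ ≤ ((|ℓ| + 1) * |u|) ^ j * (Real.exp (-(u ^ 2 / 4)) + ((1 + u ^ 2) ^ 2)⁻¹) := by gcongr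
      _ = (|ℓ| + 1) ^ j * (|u| ^ j * (Real.exp (-(u ^ 2 / 4)) + ((1 + u ^ 2) ^ 2)⁻¹)) := by
        rw [mul_pow, mul_assoc]
      _ ≤ (|ℓ| + 1) ^ j * ((1 + u ^ 2) * (Real.exp (-(u ^ 2 / 4)) + ((1 + u ^ 2) ^ 2)⁻¹)) := by
        gcongr
      _ = _ := by field_simp
  · refine Eventually.of_forall fun u => ?_
    have hsqrt : Tendsto (fun τ => √(T 2 τ)) (𝓝[>] 0) atTop := Real.tendsto_sqrt_atTop.comp h5
    have hsqrt0 : Tendsto (fun τ => √(T 0 τ)) (𝓝[>] 0) atTop := Real.tendsto_sqrt_atTop.comp h4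
    have hmem : ∀ᶠ τ in 𝓝[>] (0 : ℝ),
        u ∈ Set.Ioc (-Real.pi * √(T 2 τ)) (Real.pi * √(T 2 τ)) := by
      filter_upwards [hsqrt.eventually_gt_atTop (|u| / Real.pi)] with τ hτ
      rw [div_lt_iff₀ hpi] at hτ
      have := abs_lt.1 hτ
      exact ⟨by linarith [this.1], by linarith [this.2]⟩
    have hlin : Tendsto (fun τ => (angSum (tilt A τ) (u / √(T 2 τ)) - angSum (tilt A τ) 0) /
        ((√(T 0 τ) : ℝ) : ℂ)) (𝓝[>] 0) (𝓝 ((ℓ * u : ℝ) * I)) := by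
      have hmain : Tendsto (fun τ => ((T 1 τ / (√(T 0 τ) * √(T 2 τ)) * u : ℝ) : ℂ) * I) (𝓝[>] 0)
          (𝓝 ((ℓ * u : ℝ) * I)) :=
        ((continuous_ofReal.tendsto _).comp (h1.mul_const u)).mul_const I
      have herr : Tendsto (fun τ => (angSum (tilt A τ) (u / √(T 2 τ)) - angSum (tilt A τ) 0) /
          ((√(T 0 τ) : ℝ) : ℂ) - ((T 1 τ / (√(T 0 τ) * √(T 2 τ)) * u : ℝ) : ℂ) * I)
          (𝓝[>] 0) (𝓝 0) := by
        refine squeeze_zero_norm' (a := fun τ => 3 * u ^ 2 / √(T 0 τ)) ?_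
          (hsqrt0.const_div_atTop _)
        filter_upwards [self_mem_nhdsWithin, h5.eventually_gt_atTop 0,
          h4.eventually_gt_atTop 0] with τ hτ g5 g4
        have hs : 0 < √(T 2 τ) := Real.sqrt_pos.2 g5
        have hs' : 0 < √(T 0 τ) := Real.sqrt_pos.2 g4
        have hss : √(T 2 τ) ^ 2 = T 2 τ := Real.sq_sqrt g5.le
        have := norm_angSum_sub_linear_le (hb τ) (hs0 τ hτ) (hsum τ hτ 1) (hsum τ hτ 2)
          (u / √(T 2 τ))
        have e : (angSum (tilt A τ) (u / √(T 2 τ)) - angSum (tilt A τ) 0) /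
          ((√(T 0 τ) : ℝ) : ℂ) - ((T 1 τ / (√(T 0 τ) * √(T 2 τ)) * u : ℝ) : ℂ) * I =
          (angSum (tilt A τ) (u / √(T 2 τ)) - angSum (tilt A τ) 0 -
            ((T 1 τ * (u / √(T 2 τ)) : ℝ) : ℂ) * I) / ((√(T 0 τ) : ℝ) : ℂ) := by
          have n1 : ((√(T 0 τ) : ℝ) : ℂ) ≠ 0 := by exact_mod_cast hs'.ne'
          have n2 : ((√(T 2 τ) : ℝ) : ℂ) ≠ 0 := by exact_mod_cast hs.ne'
          push_cast
          field_simp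
        rw [e, norm_div, norm_real, Real.norm_of_nonneg hs'.le]
        gcongr
        refine this.trans (le_of_eq ?_)
        change T 2 τ * (3 * (u / √(T 2 τ)) ^ 2) = 3 * u ^ 2
        rw [div_pow, hss]; field_simp
      simpa using herr.add hmain
    have hexp : Tendsto (fun τ => cexp ((-(T 1 τ * (u / √(T 2 τ))) : ℝ) * I +
        (angSum (tilt A τ) (u / √(T 2 τ)) - angSum (tilt A τ) 0))) (𝓝[>] 0)
        (𝓝 (cexp ((-(u ^ 2 / 2) : ℝ)))) := by
      refine (continuous_exp.tendsto _).comp ?_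
      rw [tendsto_iff_norm_sub_tendsto_zero]
      have hz : Tendsto (fun τ => 4 * |u| ^ 3 * (T 3 τ / √(T 2 τ) ^ 3)) (𝓝[>] 0) (𝓝 0) := by
        simpa using h2.const_mul (4 * |u| ^ 3)
      refine squeeze_zero' (Eventually.of_forall fun _ => norm_nonneg _) ?_ hz
      filter_upwards [self_mem_nhdsWithin, h5.eventually_gt_atTop 0] with τ hτ g5
      have hs : 0 < √(T 2 τ) := Real.sqrt_pos.2 g5
      have hss : √(T 2 τ) ^ 2 = T 2 τ := Real.sq_sqrt g5.le
      have := norm_angSum_sub_quadratic_le (hb τ) (hs0 τ hτ) (hsum τ hτ 1) (hsum τ hτ 2)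
        (hsum τ hτ 3) (u / √(T 2 τ))
      have e1 : T 2 τ * ((u / √(T 2 τ)) ^ 2 / 2) = u ^ 2 / 2 := by
        rw [div_pow, hss]; field_simp
      have e2 : T 3 τ * (4 * |u / √(T 2 τ)| ^ 3) = 4 * |u| ^ 3 * (T 3 τ / √(T 2 τ) ^ 3) := by
        rw [abs_div, abs_of_pos hs, div_pow]; field_simp
      rw [← e2]
      refine le_trans (le_of_eq ?_) this
      congr 1
      change _ = _ - ((T 1 τ * (u / √(T 2 τ)) : ℝ) : ℂ) * I +
        ((T 2 τ * ((u / √(T 2 τ)) ^ 2 / 2) : ℝ) : ℂ)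
      rw [e1]
      push_cast
      ring
    refine ((hlin.pow j).mul hexp).congr' ?_
    filter_upwards [hmem] with τ hu
    rw [Set.indicator_of_mem hu, saddleIntegrand, exp_add, div_pow]
    change _ = _ * (cexp ((-(T 1 τ * (u / √(T 2 τ))) : ℝ) * I) * _)
    push_cast
    ring

end

section

open MeasureTheory Filter Topology

theorem eventually_one_le_neg_log_pow (M : ℕ) : ∀ᶠ τ : ℝ in 𝓝[>] 0, 1 ≤ (-Real.log τ) ^ M := by
  have h : ∀ᶠ τ : ℝ in 𝓝[>] 0, Real.log τ ≤ -1 := Real.tendsto_log_nhdsGT_zero.eventually_le_atBot _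
  filter_upwards [h] with τ hτ
  exact one_le_pow₀ (by linarith)

theorem tendsto_rpow_nhdsGT_zero {p : ℝ} (hp : 0 < p) :
    Tendsto (fun τ : ℝ => τ ^ p) (𝓝[>] 0) (𝓝 0) := by
  have := (Real.continuousAt_rpow_const 0 p (Or.inr hp.le)).tendsto
  rw [Real.zero_rpow hp.ne'] at this
  exact this.mono_left nhdsWithin_le_nhds

variable {T : ℝ → ℝ} {p G : ℝ} {M : ℕ}

theorem eventually_pos_of_laplace (hG : 0 < G)
    (hT : Tendsto (fun τ => τ ^ p * T τ / (-Real.log τ) ^ M) (𝓝[>] 0) (𝓝 G)) :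
    ∀ᶠ τ in 𝓝[>] (0 : ℝ), 0 < T τ := by
  filter_upwards [hT.eventually (eventually_gt_nhds hG), eventually_one_le_neg_log_pow M,
    self_mem_nhdsWithin] with τ h1 h2 h3
  have h4 : 0 < τ ^ p := Real.rpow_pos_of_pos h3 p
  have h5 := (div_pos_iff_of_pos_right (by linarith)).1 h1
  exact (mul_pos_iff_of_pos_left h4).1 h5

theorem tendsto_atTop_of_laplace (hG : 0 < G) (hp : 0 < p)
    (hT : Tendsto (fun τ => τ ^ p * T τ / (-Real.log τ) ^ M) (𝓝[>] 0) (𝓝 G)) :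
    Tendsto T (𝓝[>] 0) atTop := by
  have h := hT.pos_mul_atTop hG (tendsto_rpow_neg_nhdsGT_zero (neg_lt_zero.2 hp))
  refine tendsto_atTop_mono' _ ?_ h
  filter_upwards [eventually_pos_of_laplace hG hT, eventually_one_le_neg_log_pow M,
    self_mem_nhdsWithin] with τ h1 h2 h3
  have h4 : 0 < τ ^ p := Real.rpow_pos_of_pos h3 p
  rw [Real.rpow_neg (le_of_lt h3), div_mul_eq_mul_div, mul_right_comm, mul_inv_cancel₀ h4.ne', one_mul]
  exact div_le_self h1.le h2

theorem tendsto_mul_exp_of_laplace {K : ℝ} (hK : 0 < K)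
    (hT : Tendsto (fun τ => τ ^ p * T τ / (-Real.log τ) ^ M) (𝓝[>] 0) (𝓝 G)) :
    Tendsto (fun τ => T τ * Real.exp (-(K / τ))) (𝓝[>] 0) (𝓝 0) := by
  have h := (tendsto_rpow_mul_exp_neg_mul_atTop_nhds_zero (M + p) K hK).comp
    (tendsto_inv_nhdsGT_zero (𝕜 := ℝ))
  have h' : Tendsto (fun τ => (-Real.log τ) ^ M * τ ^ (-p) * Real.exp (-(K / τ))) (𝓝[>] 0) (𝓝 0) := by
    refine squeeze_zero' ?_ ?_ h
    · filter_upwards [eventually_one_le_neg_log_pow M, self_mem_nhdsWithin] with τ h2 h3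
      have h3 : (0 : ℝ) < τ := h3
      positivity
    · filter_upwards [eventually_one_le_neg_log_pow 1, self_mem_nhdsWithin] with τ h2 h3
      have h3 : (0 : ℝ) < τ := h3
      rw [Function.comp_apply, Real.rpow_add (by positivity), Real.inv_rpow h3.le p,
        ← Real.rpow_neg h3.le, Real.rpow_natCast, ← div_eq_mul_inv, neg_div]
      have h4 : -Real.log τ ≤ τ⁻¹ := by
        rw [← Real.log_inv]; exact Real.log_le_self (by positivity)
      have h5 : 0 ≤ -Real.log τ := by rw [pow_one] at h2; linarith
      gcongr
  have := hT.mul h'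
  rw [mul_zero] at this
  refine this.congr' ?_
  filter_upwards [eventually_one_le_neg_log_pow M, self_mem_nhdsWithin] with τ h2 h3
  have h4 : 0 < τ ^ p := Real.rpow_pos_of_pos h3 p
  have h5 : (-Real.log τ) ^ M ≠ 0 := by positivity
  rw [Real.rpow_neg (le_of_lt h3)]
  field_simp

theorem tendsto_sq_mul_exp_of_laplace {K C : ℝ} (hK : 0 < K)
    (hT : Tendsto (fun τ => τ ^ p * T τ / (-Real.log τ) ^ M) (𝓝[>] 0) (𝓝 G)) :
    Tendsto (fun τ => (1 + C * T τ) ^ 2 * Real.exp (-(K / τ))) (𝓝[>] 0) (𝓝 0) := by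
  have h1 := (tendsto_mul_exp_of_laplace (half_pos hK) hT).const_mul C
  have h2 : Tendsto (fun τ : ℝ => Real.exp (-(K / 2 / τ))) (𝓝[>] 0) (𝓝 0) := by
    refine Real.tendsto_exp_neg_atTop_nhds_zero.comp ?_
    simp_rw [div_eq_mul_inv _ (_ : ℝ)]
    exact tendsto_inv_nhdsGT_zero.const_mul_atTop (by positivity)
  have := (h2.add h1).pow 2
  simp only [mul_zero, add_zero, ne_eq, OfNat.ofNat_ne_zero, not_false_eq_true, zero_pow] at this
  refine this.congr fun τ => ?_
  rw [show -(K / τ) = -(K / 2 / τ) + -(K / 2 / τ) by ring, Real.exp_add]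
  ring

variable {T₀ T₁ T₂ : ℝ → ℝ} {G₀ G₁ G₂ : ℝ}

theorem tendsto_skew_of_laplace {p q : ℝ} (hpq : 2 * q < 3 * p) (hG₀ : 0 < G₀) (hG₁ : 0 < G₁)
    (h0 : Tendsto (fun τ => τ ^ p * T₀ τ / (-Real.log τ) ^ M) (𝓝[>] 0) (𝓝 G₀))
    (h1 : Tendsto (fun τ => τ ^ q * T₁ τ / (-Real.log τ) ^ M) (𝓝[>] 0) (𝓝 G₁)) :
    Tendsto (fun τ => T₁ τ / √(T₀ τ) ^ 3) (𝓝[>] 0) (𝓝 0) := by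
  have h2 : Tendsto (fun τ : ℝ => τ ^ (3 * p - 2 * q) / (-Real.log τ) ^ M) (𝓝[>] 0) (𝓝 0) := by
    refine squeeze_zero' ?_ ?_ (tendsto_rpow_nhdsGT_zero (sub_pos.2 hpq))
    · filter_upwards [eventually_one_le_neg_log_pow M, self_mem_nhdsWithin] with τ h2 h3
      have h3 : (0 : ℝ) < τ := h3
      positivity
    · filter_upwards [eventually_one_le_neg_log_pow M, self_mem_nhdsWithin] with τ h2 h3
      have h3 : (0 : ℝ) < τ := h3
      exact div_le_self (by positivity) h2
  have h3 := ((h1.pow 2).div (h0.pow 3) (by positivity)).mul h2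
  rw [mul_zero] at h3
  have h4 := (Real.continuous_sqrt.tendsto _).comp h3
  rw [Real.sqrt_zero] at h4
  refine h4.congr' ?_
  filter_upwards [eventually_pos_of_laplace hG₀ h0, eventually_pos_of_laplace hG₁ h1,
    eventually_one_le_neg_log_pow M, self_mem_nhdsWithin] with τ g0 g1 g2 g3
  have g3 : (0 : ℝ) < τ := g3
  have e1 : τ ^ (3 * p - 2 * q) = (τ ^ p) ^ 3 / (τ ^ q) ^ 2 := by
    rw [Real.rpow_sub g3, mul_comm 3, mul_comm 2, Real.rpow_mul g3.le, Real.rpow_mul g3.le]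
    norm_cast
  have e2 : (0:ℝ) < τ ^ p := Real.rpow_pos_of_pos g3 p
  have e3 : (0:ℝ) < τ ^ q := Real.rpow_pos_of_pos g3 q
  have e4 : 0 < (-Real.log τ) ^ M := by linarith
  have e5 : √(T₀ τ) ^ 3 = √(T₀ τ ^ 3) := by
    rw [show T₀ τ ^ 3 = (√(T₀ τ) ^ 3) ^ 2 by rw [← pow_mul, mul_comm 3 2, pow_mul, Real.sq_sqrt g0.le],
      Real.sqrt_sq (by positivity)]
  have e6 : T₁ τ = √(T₁ τ ^ 2) := (Real.sqrt_sq g1.le).symm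
  rw [e5, e6, ← Real.sqrt_div (by positivity), Function.comp_apply, e1]
  congr 1
  simp only [Pi.div_apply]
  field_simp

theorem tendsto_div_of_laplace {p q : ℝ} (hG₀ : 0 < G₀)
    (h0 : Tendsto (fun τ => τ ^ p * T₀ τ / (-Real.log τ) ^ M) (𝓝[>] 0) (𝓝 G₀))
    (h1 : Tendsto (fun τ => τ ^ q * T₁ τ / (-Real.log τ) ^ M) (𝓝[>] 0) (𝓝 G₁)) :
    Tendsto (fun τ => τ ^ (q - p) * T₁ τ / T₀ τ) (𝓝[>] 0) (𝓝 (G₁ / G₀)) := by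
  refine (h1.div h0 hG₀.ne').congr' ?_
  filter_upwards [eventually_pos_of_laplace hG₀ h0,
    eventually_one_le_neg_log_pow M, self_mem_nhdsWithin] with τ g0 g2 g3
  have g3 : (0 : ℝ) < τ := g3
  have e2 : (0:ℝ) < τ ^ p := Real.rpow_pos_of_pos g3 p
  have e4 : 0 < (-Real.log τ) ^ M := by linarith
  rw [Pi.div_apply, Real.rpow_sub g3]
  field_simp

theorem tendsto_corr_of_laplace {p q r : ℝ} (hpr : p + r = 2 * q) (hG₀ : 0 < G₀) (hG₂ : 0 < G₂)
    (h0 : Tendsto (fun τ => τ ^ p * T₀ τ / (-Real.log τ) ^ M) (𝓝[>] 0) (𝓝 G₀))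
    (h1 : Tendsto (fun τ => τ ^ q * T₁ τ / (-Real.log τ) ^ M) (𝓝[>] 0) (𝓝 G₁))
    (h2 : Tendsto (fun τ => τ ^ r * T₂ τ / (-Real.log τ) ^ M) (𝓝[>] 0) (𝓝 G₂)) :
    Tendsto (fun τ => T₁ τ / (√(T₀ τ) * √(T₂ τ))) (𝓝[>] 0) (𝓝 (G₁ / √(G₀ * G₂))) := by
  refine (h1.div ((Real.continuous_sqrt.tendsto _).comp (h0.mul h2)) (by positivity)).congr' ?_
  filter_upwards [eventually_pos_of_laplace hG₀ h0, eventually_pos_of_laplace hG₂ h2,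
    eventually_one_le_neg_log_pow M, self_mem_nhdsWithin] with τ g0 g1 g2 g3
  have g3 : (0 : ℝ) < τ := g3
  have e1 : τ ^ p * τ ^ r = (τ ^ q) ^ 2 := by
    rw [← Real.rpow_add g3, hpr, mul_comm, Real.rpow_mul g3.le]; norm_cast
  have e3 : (0:ℝ) < τ ^ q := Real.rpow_pos_of_pos g3 q
  have e4 : 0 < (-Real.log τ) ^ M := by linarith
  have e5 : τ ^ p * T₀ τ / (-Real.log τ) ^ M * (τ ^ r * T₂ τ / (-Real.log τ) ^ M) =
      (τ ^ q / (-Real.log τ) ^ M) ^ 2 * (T₀ τ * T₂ τ) := by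
    rw [div_pow, ← e1]; field_simp
  rw [Pi.div_apply, Function.comp_apply, e5, Real.sqrt_mul (by positivity), Real.sqrt_sq (by positivity),
    Real.sqrt_mul g0.le]
  field_simp

theorem integral_sq_mul_gaussian : ∫ u : ℝ, u ^ 2 * Real.exp (-(u ^ 2 / 2)) = √(2 * Real.pi) := by
  have h := integral_comp_abs (f := fun u : ℝ => u ^ 2 * Real.exp (-(u ^ 2 / 2)))
  simp only [sq_abs] at h
  have h2 := integral_rpow_mul_exp_neg_mul_rpow (p := 2) (q := 2) (b := 1 / 2) (by norm_num)
    (by norm_num) (by norm_num)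
  have h3 : ∫ u in Set.Ioi (0 : ℝ), u ^ 2 * Real.exp (-(u ^ 2 / 2)) =
      (1 / 2) ^ (-(2 + 1) / 2 : ℝ) * (1 / 2) * Real.Gamma ((2 + 1) / 2) := by
    rw [← h2]
    refine setIntegral_congr_fun measurableSet_Ioi fun u hu => ?_
    simp only [Real.rpow_two]
    ring_nf
  rw [h, h3, show ((2 : ℝ) + 1) / 2 = 1 / 2 + 1 by norm_num, Real.Gamma_add_one (by norm_num),
    Real.Gamma_one_half_eq, show -((2 : ℝ) + 1) / 2 = -1 + -(1 / 2) by norm_num,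
    Real.rpow_add (by norm_num), Real.rpow_neg (by norm_num) (1 / 2), ← Real.sqrt_eq_rpow,
    Real.rpow_neg_one, Real.sqrt_mul (by norm_num), Real.sqrt_div (by norm_num)]
  norm_num
  ring

theorem integral_gaussian_half : ∫ u : ℝ, Real.exp (-(u ^ 2 / 2)) = √(2 * Real.pi) := by
  have h := integral_gaussian (1 / 2)
  rw [show Real.pi / (1 / 2) = 2 * Real.pi by ring] at h
  rw [← h]
  congr 1
  ext u
  ring_nf

theorem integral_gaussian_moment (ℓ : ℝ) :
    (∫ u : ℝ, ((ℓ * u : ℝ) * Complex.I) ^ 0 * Complex.exp ((-(u ^ 2 / 2) : ℝ))) = (√(2 * Real.pi) : ℝ) ∧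
    (∫ u : ℝ, ((ℓ * u : ℝ) * Complex.I) ^ 1 * Complex.exp ((-(u ^ 2 / 2) : ℝ))) = 0 ∧
    (∫ u : ℝ, ((ℓ * u : ℝ) * Complex.I) ^ 2 * Complex.exp ((-(u ^ 2 / 2) : ℝ))) =
      (-(ℓ ^ 2 * √(2 * Real.pi)) : ℝ) := by
  refine ⟨?_, ?_, ?_⟩
  · rw [← integral_gaussian_half, ← integral_complex_ofReal]
    simp
  · have h := integral_neg_eq_self (fun u : ℝ => ((ℓ * u : ℝ) * Complex.I) ^ 1 *
      Complex.exp ((-(u ^ 2 / 2) : ℝ))) volume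
    have h2 : ∀ u : ℝ, ((ℓ * -u : ℝ) * Complex.I) ^ 1 * Complex.exp ((-((-u) ^ 2 / 2) : ℝ)) =
        -(((ℓ * u : ℝ) * Complex.I) ^ 1 * Complex.exp ((-(u ^ 2 / 2) : ℝ))) := fun u => by
      rw [neg_sq]; push_cast; ring
    simp_rw [h2, integral_neg] at h
    exact self_eq_neg.1 h.symm
  · rw [← integral_sq_mul_gaussian, ← integral_const_mul, ← integral_neg, ← integral_complex_ofReal]
    congr 1
    ext u
    rw [mul_pow, Complex.I_sq]
    push_cast
    ring

theorem tendsto_re_saddle {A : ℕ → ℝ} {c α g : ℝ} {M : ℕ} (hc : 0 < c)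
    (hA : ∀ δ : ℕ, c * ((δ : ℝ) + 1) ≤ A δ) (hα : 1 < α) (hg : 0 < g)
    (hsum : ∀ τ > 0, ∀ j : ℕ, Summable fun δ : ℕ => tilt A τ δ * ((δ : ℝ) + 1) ^ j)
    (hlap : ∀ j : ℕ, Tendsto (fun τ : ℝ => τ ^ (α + j - 1) * powMoment (tilt A τ) j /
      (-Real.log τ) ^ M) (𝓝[>] 0) (𝓝 (g * Real.Gamma (α + j - 1)))) {j : ℕ} (hj : j ≤ 2) :
    Tendsto (fun τ => √(powMoment (tilt A τ) 2) / √(powMoment (tilt A τ) 0) ^ j *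
      (∫ θ in (-Real.pi)..Real.pi, saddleIntegrand (tilt A τ) j θ).re) (𝓝[>] 0)
      (𝓝 (∫ u : ℝ, ((√((α - 1) / α) * u : ℝ) * Complex.I) ^ j *
        Complex.exp ((-(u ^ 2 / 2) : ℝ))).re) := by
  have hG : ∀ j : ℕ, 0 < g * Real.Gamma (α + j - 1) := fun j =>
    mul_pos hg (Real.Gamma_pos_of_pos (by have : (0 : ℝ) ≤ j := j.cast_nonneg; linarith))
  have hp : ∀ j : ℕ, 0 < α + j - 1 := fun j => by have : (0 : ℝ) ≤ j := j.cast_nonneg; linarith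
  have hℓ : g * Real.Gamma (α + (1 : ℕ) - 1) / √(g * Real.Gamma (α + (0 : ℕ) - 1) *
      (g * Real.Gamma (α + (2 : ℕ) - 1))) = √((α - 1) / α) := by
    have e1 : Real.Gamma (α + (1 : ℕ) - 1) = (α - 1) * Real.Gamma (α + (0 : ℕ) - 1) := by
      rw [show α + (1 : ℕ) - 1 = (α - 1) + 1 by push_cast; ring, Real.Gamma_add_one (by linarith)]
      simp
    have e2 : Real.Gamma (α + (2 : ℕ) - 1) = α * ((α - 1) * Real.Gamma (α + (0 : ℕ) - 1)) := by
      rw [← e1, show α + (2 : ℕ) - 1 = α + 1 by push_cast; ring, Real.Gamma_add_one (by linarith)]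
      simp
    have h0 : 0 < Real.Gamma (α + (0 : ℕ) - 1) := Real.Gamma_pos_of_pos (hp 0)
    have h1 : 0 < α - 1 := by linarith
    have h2 : 0 < α := by linarith
    rw [e1, e2, ← Real.sqrt_sq (by positivity : 0 ≤ g * ((α - 1) * Real.Gamma (α + (0 : ℕ) - 1))),
      ← Real.sqrt_div (by positivity)]
    congr 1
    field_simp
  have h1 := tendsto_corr_of_laplace (by push_cast; ring) (hG 0) (hG 2) (hlap 0) (hlap 1) (hlap 2)
  rw [hℓ] at h1
  have h2 := tendsto_skew_of_laplace (by push_cast; linarith) (hG 2) (hG 3) (hlap 2) (hlap 3)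
  have h3 := tendsto_div_of_laplace (hG 2) (hlap 2) (hlap 4)
  have e : α + (4 : ℕ) - 1 - (α + (2 : ℕ) - 1) = (2 : ℕ) := by push_cast; ring
  simp only [e, Real.rpow_natCast] at h3
  have := tendsto_saddle hc hA hsum h1 h2 h3 (tendsto_atTop_of_laplace (hG 0) (hp 0) (hlap 0))
    (tendsto_atTop_of_laplace (hG 2) (hp 2) (hlap 2))
    (fun K hK => tendsto_sq_mul_exp_of_laplace hK (hlap 2)) hj
  refine ((Complex.continuous_re.tendsto _).comp this).congr fun τ => ?_
  rw [Function.comp_apply, Complex.re_ofReal_mul]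

theorem tendsto_variance_saddle {A : ℕ → ℝ} {c α g : ℝ} {M : ℕ} (hc : 0 < c)
    (hA : ∀ δ : ℕ, c * ((δ : ℝ) + 1) ≤ A δ) (hα : 1 < α) (hg : 0 < g)
    (hsum : ∀ τ > 0, ∀ j : ℕ, Summable fun δ : ℕ => tilt A τ δ * ((δ : ℝ) + 1) ^ j)
    (hlap : ∀ j : ℕ, Tendsto (fun τ : ℝ => τ ^ (α + j - 1) * powMoment (tilt A τ) j /
      (-Real.log τ) ^ M) (𝓝[>] 0) (𝓝 (g * Real.Gamma (α + j - 1))))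
    {I : ℕ → ℝ → ℝ}
    (hI : ∀ j τ, I j τ = (∫ θ in (-Real.pi)..Real.pi, saddleIntegrand (tilt A τ) j θ).re) :
    (∀ᶠ τ in 𝓝[>] 0, I 0 τ ≠ 0) ∧
    Tendsto (fun τ => (I 2 τ / I 0 τ + powMoment (tilt A τ) 0 + I 1 τ / I 0 τ -
      (I 1 τ / I 0 τ) ^ 2) / powMoment (tilt A τ) 0) (𝓝[>] 0) (𝓝 (1 / α)) := by
  have h := fun j (hj : j ≤ 2) => tendsto_re_saddle hc hA hα hg hsum hlap hj
  obtain ⟨g0, g1, g2⟩ := integral_gaussian_moment (√((α - 1) / α))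
  have h0 := h 0 (by norm_num)
  have h1 := h 1 (by norm_num)
  have h2 := h 2 le_rfl
  simp only [← hI] at h0 h1 h2
  rw [g0, Complex.ofReal_re] at h0
  rw [g1, Complex.zero_re] at h1
  rw [g2, Complex.ofReal_re, Real.sq_sqrt (div_nonneg (by linarith) (by linarith))] at h2
  have hpos : 0 < √(2 * Real.pi) := by have := Real.pi_pos; positivity
  have hG : ∀ j : ℕ, 0 < g * Real.Gamma (α + j - 1) := fun j =>
    mul_pos hg (Real.Gamma_pos_of_pos (by have : (0 : ℝ) ≤ j := j.cast_nonneg; linarith))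
  have hT0 := tendsto_atTop_of_laplace (hG 0) (by push_cast; linarith) (hlap 0)
  have hne : ∀ᶠ τ in 𝓝[>] 0, I 0 τ ≠ 0 := by
    filter_upwards [h0.eventually (eventually_gt_nhds hpos)] with τ hτ h
    simp [h] at hτ
  refine ⟨hne, ?_⟩
  have r2 := h2.div h0 hpos.ne'
  have r1 := h1.div h0 hpos.ne'
  have r3 := r1.mul (tendsto_inv_atTop_zero.comp (Real.tendsto_sqrt_atTop.comp hT0))
  have r := ((r2.add_const 1).add r3).sub (r1.pow 2)
  have e : -((α - 1) / α * √(2 * Real.pi)) / √(2 * Real.pi) + 1 + 0 / √(2 * Real.pi) * 0 -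
      (0 / √(2 * Real.pi)) ^ 2 = 1 / α := by
    have : α ≠ 0 := by linarith
    field_simp
    ring
  rw [e] at r
  refine r.congr' ?_
  filter_upwards [hne, hT0.eventually_gt_atTop 0, eventually_pos_of_laplace (hG 2) (hlap 2)]
    with τ k1 k2 k3
  have k4 : 0 < √(powMoment (tilt A τ) 2) := Real.sqrt_pos.2 k3
  have k5 : 0 < √(powMoment (tilt A τ) 0) := Real.sqrt_pos.2 k2
  have k6 : powMoment (tilt A τ) 0 = √(powMoment (tilt A τ) 0) ^ 2 := (Real.sq_sqrt k2.le).symm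
  simp only [Pi.div_apply, Function.comp_apply]
  set S := √(powMoment (tilt A τ) 0)
  rw [k6]
  field_simp

theorem powMoment_tilt_eq (A : ℕ → ℝ) (τ : ℝ) :
    powMoment (tilt A τ) 1 = ∑' δ : ℕ, A δ * Real.exp (-τ * (δ + 1)) := by
  refine tsum_congr fun δ => ?_
  have : (δ : ℝ) + 1 ≠ 0 := by positivity
  rw [tilt]
  field_simp

theorem antitoneOn_powMoment_tilt {A : ℕ → ℝ} (hA : ∀ δ, 0 ≤ A δ)
    (hs : ∀ τ > 0, Summable fun δ : ℕ => A δ * Real.exp (-τ * (δ + 1))) :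
    AntitoneOn (fun τ => powMoment (tilt A τ) 1) (Set.Ioi 0) := by
  intro s hs0 t ht hst
  simp only [powMoment_tilt_eq]
  refine Summable.tsum_le_tsum (fun δ => ?_) (hs t ht) (hs s hs0)
  have := hA δ
  gcongr

theorem continuousOn_powMoment_tilt {A : ℕ → ℝ} (hA : ∀ δ, 0 ≤ A δ)
    (hs : ∀ τ > 0, Summable fun δ : ℕ => A δ * Real.exp (-τ * (δ + 1)))
    {s : ℝ} (hs0 : 0 < s) :
    ContinuousOn (fun τ => powMoment (tilt A τ) 1) (Set.Ici s) := by
  simp only [powMoment_tilt_eq]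
  refine continuousOn_tsum (fun δ => by fun_prop) (hs s hs0) fun δ t ht => ?_
  have h1 := hA δ
  have h2 : s ≤ t := ht
  rw [Real.norm_of_nonneg (by positivity)]
  gcongr

theorem exists_saddle_point {A : ℕ → ℝ} (hA : ∀ δ, 0 ≤ A δ)
    (hs : ∀ τ > 0, Summable fun δ : ℕ => A δ * Real.exp (-τ * (δ + 1)))
    (h : Tendsto (fun τ => powMoment (tilt A τ) 1) (𝓝[>] 0) atTop) :
    ∃ τ : ℕ → ℝ, Tendsto τ atTop (𝓝[>] 0) ∧ ∀ᶠ n : ℕ in atTop, powMoment (tilt A (τ n)) 1 = n := by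
  have hex : ∀ᶠ n : ℕ in atTop, ∃ t : ℝ, 0 < t ∧ powMoment (tilt A t) 1 = n := by
    filter_upwards [tendsto_natCast_atTop_atTop.eventually_ge_atTop (powMoment (tilt A 1) 1)]
      with n hn
    have hle : ∀ᶠ s : ℝ in 𝓝[>] 0, s ≤ 1 := nhdsWithin_le_nhds (eventually_le_nhds one_pos)
    obtain ⟨s, hs1, hs2, hs3⟩ := ((h.eventually_ge_atTop (n : ℝ)).and
      (hle.and self_mem_nhdsWithin)).exists
    have hs3 : 0 < s := hs3
    obtain ⟨t, ht, ht'⟩ := intermediate_value_Icc' hs2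
      ((continuousOn_powMoment_tilt hA hs hs3).mono Set.Icc_subset_Ici_self) ⟨hn, hs1⟩
    exact ⟨t, hs3.trans_le ht.1, ht'⟩
  choose! τ hτ using fun (n : ℕ) (h : ∃ t : ℝ, 0 < t ∧ powMoment (tilt A t) 1 = n) => h
  refine ⟨τ, ?_, hex.mono fun n hn => (hτ n hn).2⟩
  refine tendsto_nhdsWithin_iff.2 ⟨?_, hex.mono fun n hn => (hτ n hn).1⟩
  refine tendsto_order.2 ⟨fun a ha => hex.mono fun n hn => ha.trans (hτ n hn).1, fun a ha => ?_⟩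
  filter_upwards [hex, tendsto_natCast_atTop_atTop.eventually_gt_atTop (powMoment (tilt A a) 1)]
    with n hn hn'
  by_contra! hle
  have := antitoneOn_powMoment_tilt hA hs ha (hτ n hn).1 hle
  simp only [(hτ n hn).2] at this
  linarith

theorem tendsto_log_div_of_laplace {T : ℝ → ℝ} {p G : ℝ} {M : ℕ} (hG : 0 < G)
    (hT : Tendsto (fun τ => τ ^ p * T τ / (-Real.log τ) ^ M) (𝓝[>] 0) (𝓝 G)) :
    Tendsto (fun τ => Real.log (T τ) / (-Real.log τ)) (𝓝[>] 0) (𝓝 p) := by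
  have hy : Tendsto (fun τ => -Real.log τ) (𝓝[>] 0) atTop :=
    tendsto_neg_atBot_atTop.comp Real.tendsto_log_nhdsGT_zero
  have h1 := ((Real.continuousAt_log hG.ne').tendsto.comp hT).div_atTop hy
  have h2 : Tendsto (fun τ => Real.log (-Real.log τ) / (-Real.log τ)) (𝓝[>] 0) (𝓝 0) :=
    (Real.isLittleO_log_id_atTop.tendsto_div_nhds_zero).comp hy
  have h3 := (h1.add (h2.const_mul (M : ℝ))).add_const p
  simp only [mul_zero, zero_add] at h3
  refine h3.congr' ?_
  filter_upwards [eventually_pos_of_laplace hG hT, eventually_one_le_neg_log_pow 1,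
    self_mem_nhdsWithin] with τ g1 g2 g3
  have g3 : (0 : ℝ) < τ := g3
  rw [pow_one] at g2
  have g4 : 0 < τ ^ p := Real.rpow_pos_of_pos g3 p
  have g5 : 0 < -Real.log τ := by linarith
  rw [Function.comp_apply, Real.log_div (by positivity) (by positivity),
    Real.log_mul g4.ne' g1.ne', Real.log_pow, Real.log_rpow g3]
  generalize Real.log (-Real.log τ) = z
  have : Real.log τ ≠ 0 := by linarith
  field_simp
  ring

theorem tendsto_div_rpow_of_laplace {T₀ T₁ : ℝ → ℝ} {α G₀ G₁ : ℝ} {M : ℕ} (hα : 0 < α)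
    (hG₀ : 0 < G₀) (hG₁ : 0 < G₁)
    (h0 : Tendsto (fun τ => τ ^ (α - 1) * T₀ τ / (-Real.log τ) ^ M) (𝓝[>] 0) (𝓝 G₀))
    (h1 : Tendsto (fun τ => τ ^ α * T₁ τ / (-Real.log τ) ^ M) (𝓝[>] 0) (𝓝 G₁)) :
    Tendsto (fun τ => T₀ τ / (α ^ (-(M / α)) * G₁ ^ (1 / α) * T₁ τ ^ ((α - 1) / α) *
      Real.log (T₁ τ) ^ (M / α))) (𝓝[>] 0) (𝓝 (G₀ / G₁)) := by
  have h2 := (tendsto_log_div_of_laplace hG₁ h1).rpow_const (p := M / α) (Or.inl hα.ne')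
  have h3 := h1.rpow_const (p := (α - 1) / α) (Or.inl hG₁.ne')
  have hpos : 0 < α ^ (M / α) := Real.rpow_pos_of_pos hα _
  have h4 := h0.div ((h3.mul h2).const_mul (α ^ (-(M / α)) * G₁ ^ (1 / α))) (by positivity)
  have e : α ^ (-(M / α)) * G₁ ^ (1 / α) * (G₁ ^ ((α - 1) / α) * α ^ (M / α)) = G₁ := by
    have e1 : G₁ ^ (1 / α) * G₁ ^ ((α - 1) / α) = G₁ := by
      rw [← Real.rpow_add hG₁, show 1 / α + (α - 1) / α = 1 by field_simp; ring, Real.rpow_one]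
    have e2 : α ^ (-(M / α)) * α ^ (M / α) = 1 := by
      rw [← Real.rpow_add hα, neg_add_cancel, Real.rpow_zero]
    linear_combination G₁ ^ (1 / α) * G₁ ^ ((α - 1) / α) * e2 + e1
  rw [e] at h4
  refine h4.congr' ?_
  filter_upwards [eventually_pos_of_laplace hG₀ h0, eventually_pos_of_laplace hG₁ h1,
    eventually_one_le_neg_log_pow 1, self_mem_nhdsWithin,
    (tendsto_log_div_of_laplace hG₁ h1).eventually (eventually_gt_nhds hα)] with τ g0 g1 g2 g3 g4
  have g3 : (0 : ℝ) < τ := g3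
  rw [pow_one] at g2
  have g5 : 0 < -Real.log τ := by linarith
  have g6 : 0 < Real.log (T₁ τ) := (div_pos_iff_of_pos_right g5).1 g4
  have k1 : (τ ^ α) ^ ((α - 1) / α) = τ ^ (α - 1) := by
    rw [← Real.rpow_mul g3.le, mul_div_cancel₀ _ hα.ne']
  have k2 : ((-Real.log τ) ^ M) ^ ((α - 1) / α) * (-Real.log τ) ^ (M / α) = (-Real.log τ) ^ M := by
    rw [← Real.rpow_natCast, ← Real.rpow_mul g5.le, ← Real.rpow_add g5]
    congr 1
    field_simp
    ring
  have k3 : 0 < τ ^ (α - 1) := Real.rpow_pos_of_pos g3 _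
  have k4 : 0 < ((-Real.log τ) ^ M) ^ ((α - 1) / α) := Real.rpow_pos_of_pos (by positivity) _
  have k5 : 0 < (-Real.log τ) ^ (M / α) := Real.rpow_pos_of_pos (by positivity) _
  have k6 : 0 < Real.log (T₁ τ) ^ (M / α) := Real.rpow_pos_of_pos g6 _
  simp only [Pi.div_apply]
  rw [Real.div_rpow (by positivity) (by positivity), Real.mul_rpow (by positivity) g1.le, k1,
    Real.div_rpow g6.le g5.le]
  generalize ((-Real.log τ) ^ M) ^ ((α - 1) / α) = X at *
  rw [← k2]
  field_simp

open Complex in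
theorem integral_saddleIntegrand_eq (a : ℕ → ℝ) {x τ : ℝ} {n : ℕ}
    (hn : powMoment (tilt (fun δ => x * a δ) τ) 1 = n) (j : ℕ) :
    ∫ θ in (-Real.pi)..Real.pi, saddleIntegrand (tilt (fun δ => x * a δ) τ) j θ =
      ((x ^ j : ℝ) : ℂ) * centredMoment (tilt a τ) n x j := by
  have h : ∀ θ, angSum (tilt (fun δ => x * a δ) τ) θ = x * angSum (tilt a τ) θ := fun θ => by
    rw [angSum, angSum, ← tsum_mul_left]
    refine tsum_congr fun δ => ?_
    simp only [tilt]
    push_cast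
    ring
  rw [centredMoment, ← intervalIntegral.integral_const_mul]
  congr 1
  ext θ
  rw [saddleIntegrand, hn, h, h, ← mul_sub, mul_pow]
  push_cast
  ring

end

open Filter Topology

theorem summable_tilt_of_polar {a : ℕ → ℝ} {α : ℝ} {M : ℕ} {μ : ℕ → ℂ} {Φ : ℂ → ℂ}
    (H : HasPolarPart a α M μ Φ) {γ : ℝ} (hγ : 0 < γ) (hμ : μ M = γ) (hα : 1 < α) (x : ℝ) (j : ℕ) :
    (∀ τ > 0, Summable fun δ : ℕ => tilt (fun δ => x * a δ) τ δ * ((δ : ℝ) + 1) ^ j) ∧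
    Tendsto (fun τ : ℝ => τ ^ (α + j - 1) * powMoment (tilt (fun δ => x * a δ) τ) j /
      (-Real.log τ) ^ M) (𝓝[>] 0) (𝓝 (x * (γ / M.factorial) * Real.Gamma (α + j - 1))) := by
  have hj : (0 : ℝ) ≤ j := j.cast_nonneg
  obtain ⟨h1, h2⟩ := H.tendsto_laplace hγ.le hμ (β := α + j - 1) (by linarith)
  have hterm : ∀ (τ : ℝ) (δ : ℕ), tilt (fun δ => x * a δ) τ δ * ((δ : ℝ) + 1) ^ j =
      x * (a δ * ((δ : ℝ) + 1) ^ (α + j - 1 - α) * Real.exp (-τ * (δ + 1))) := fun τ δ => by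
    have hp : (0 : ℝ) < δ + 1 := by positivity
    rw [show α + j - 1 - α = j - 1 by ring, Real.rpow_sub hp, Real.rpow_natCast, Real.rpow_one, tilt]
    ring
  refine ⟨fun τ hτ => ?_, ?_⟩
  · simp only [hterm]
    exact (h1 τ hτ).mul_left x
  · rw [mul_assoc]
    refine (h2.const_mul x).congr fun τ => ?_
    simp only [powMoment, hterm, tsum_mul_left]
    ring

theorem variance_asymptotics
    (G : Type*) [Group G] [Group.FG G]
    (c : ℝ) (hc : 0 < c) (hgrowth : ∀ n : ℕ, 1 ≤ n → c * n ≤ (aCount G n : ℝ))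
    (α : ℝ) (hα : 2 ≤ α) (m : ℕ) (hm : 1 ≤ m) (γ : ℝ) (hγ : 0 < γ)
    (ν : ℕ → ℂ) (Φ : ℂ → ℂ)
    (hΦc : ContinuousOn Φ {s : ℂ | α ≤ s.re})
    (hΦd : DifferentiableOn ℂ Φ {s : ℂ | α < s.re})
    (hsum : ∀ s : ℂ, α < s.re →
      Summable fun δ : ℕ => ‖(aCount G (δ + 1) : ℂ) * ((δ + 1 : ℕ) : ℂ) ^ (-s)‖)
    (hval : ∀ s : ℂ, α < s.re →
      ∑' δ : ℕ, (aCount G (δ + 1) : ℂ) * ((δ + 1 : ℕ) : ℂ) ^ (-s) =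
        (γ : ℂ) / (s - (α : ℂ)) ^ m
          + (∑ j ∈ Finset.Icc 1 (m - 1), ν j / (s - (α : ℂ)) ^ j) + Φ s)
    (x : ℝ) (hx : 0 < x) :
    Asymptotics.IsEquivalent Filter.atTop
      (fun n : ℕ => expVal G n x (fun y => y ^ 2) - (expVal G n x id) ^ 2)
      (fun n : ℕ =>
        (1 / (α * (α - 1))) * α ^ (-(((m : ℝ) - 1) / α)) *
          (x * (Real.Gamma α * γ / (Nat.factorial (m - 1) : ℝ))) ^ (1 / α) *
          (n : ℝ) ^ ((α - 1) / α) * Real.log n ^ (((m : ℝ) - 1) / α)) := by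
  obtain ⟨M, rfl⟩ : ∃ M, m = M + 1 := ⟨m - 1, by omega⟩
  simp only [add_tsub_cancel_right, Nat.cast_add, Nat.cast_one] at hval ⊢
  have hfin : ∀ k, 1 ≤ k → Finite {H : Subgroup G // H.index = k} := fun k hk => by
    have h1 : (0 : ℝ) < aCount G k :=
      lt_of_lt_of_le (by have : (0 : ℝ) < k := by exact_mod_cast hk
                         positivity) (hgrowth k hk)
    exact Nat.finite_of_card_ne_zero (Nat.cast_pos.1 h1).ne'
  set a : ℕ → ℝ := fun δ => aCount G (δ + 1) with ha
  have H : HasPolarPart a α M (fun j => if j = M then (γ : ℂ) else ν (j + 1)) Φ :=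
    { nonneg := fun δ => Nat.cast_nonneg _
      continuousOn := hΦc
      summable := fun s hs => by simpa [ha] using hsum s hs
      tsum_eq := fun s hs => by
        have h := hval s hs
        have e : ∑ j ∈ Finset.range M, (if j = M then (γ : ℂ) else ν (j + 1)) /
            (s - (α : ℂ)) ^ (j + 1) = ∑ j ∈ Finset.Icc 1 M, ν j / (s - (α : ℂ)) ^ j := by
          rw [← Finset.Ico_succ_right_eq_Icc, Finset.sum_Ico_eq_sum_range]
          rw [Order.succ_eq_add_one, add_tsub_cancel_right]
          refine Finset.sum_congr rfl fun j hj => ?_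
          rw [if_neg (Finset.mem_range.1 hj).ne, add_comm 1 j]
        rw [Finset.sum_range_succ, e, if_pos rfl, add_comm (∑ j ∈ _, _)]
        simpa [ha] using h }
  have hlap := summable_tilt_of_polar H hγ (if_pos rfl) (by linarith : 1 < α) x
  set A : ℕ → ℝ := fun δ => x * a δ with hAdef
  set g : ℝ := x * (γ / M.factorial) with hg
  have hg0 : 0 < g := by positivity
  have hA : ∀ δ : ℕ, x * c * ((δ : ℝ) + 1) ≤ A δ := fun δ => by
    have := hgrowth (δ + 1) (by omega)
    push_cast at this
    rw [mul_assoc]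
    exact mul_le_mul_of_nonneg_left this hx.le
  have hA0 : ∀ δ, 0 ≤ A δ := fun δ => le_trans (by positivity) (hA δ)
  have hsA : ∀ τ > 0, Summable fun δ : ℕ => A δ * Real.exp (-τ * (δ + 1)) := fun τ hτ => by
    refine ((hlap 1).1 τ hτ).congr fun δ => ?_
    have : (δ : ℝ) + 1 ≠ 0 := by positivity
    rw [tilt]
    field_simp
  have hGamma : ∀ j : ℕ, 0 < g * Real.Gamma (α + j - 1) := fun j =>
    mul_pos hg0 (Real.Gamma_pos_of_pos (by have : (0 : ℝ) ≤ j := j.cast_nonneg; linarith))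
  obtain ⟨hI0, hIlim⟩ := tendsto_variance_saddle (mul_pos hx hc) hA (by linarith) hg0
    (fun τ hτ j => (hlap j).1 τ hτ) (fun j => (hlap j).2)
    (I := fun j τ => (∫ θ in (-Real.pi)..Real.pi, saddleIntegrand (tilt A τ) j θ).re)
    (fun _ _ => rfl)
  obtain ⟨τ, hτ, hτn⟩ := exists_saddle_point hA0 hsA
    (tendsto_atTop_of_laplace (hGamma 1) (by push_cast; linarith) (hlap 1).2)
  have l0 := (hlap 0).2
  have l1 := (hlap 1).2
  rw [show α + (0 : ℕ) - 1 = α - 1 by simp] at l0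
  rw [show α + (1 : ℕ) - 1 = α by simp] at l1
  have hG0 : 0 < Real.Gamma (α - 1) := Real.Gamma_pos_of_pos (by linarith)
  have hG1 : Real.Gamma α = (α - 1) * Real.Gamma (α - 1) := by
    rw [← Real.Gamma_add_one (by linarith), sub_add_cancel]
  have hα1 : 0 < α - 1 := by linarith
  have hα0 : 0 < α := by linarith
  have hratio := tendsto_div_rpow_of_laplace hα0 (by positivity)
    (by rw [hG1]; positivity) l0 l1
  have hlim := ((hIlim.mul hratio).comp hτ).const_mul (α * (α - 1))
  have e : α * (α - 1) * (1 / α * (g * Real.Gamma (α - 1) / (g * Real.Gamma α))) = 1 := by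
    rw [hG1]; field_simp
  rw [e] at hlim
  have hbase : x * (Real.Gamma α * γ / M.factorial) = g * Real.Gamma α := by rw [hg]; ring
  rw [hbase]
  have hgG : 0 < g * Real.Gamma α := by rw [hG1]; positivity
  refine (Asymptotics.isEquivalent_iff_tendsto_one ?_).2 (hlim.congr' ?_)
  · filter_upwards [eventually_gt_atTop 1] with n hn
    have h1 : (1 : ℝ) < n := by exact_mod_cast hn
    have h2 : 0 < Real.log n := Real.log_pos h1
    positivity
  · have hpos : ∀ᶠ t in 𝓝[>] (0 : ℝ), 0 < powMoment (tilt A t) 0 :=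
      eventually_pos_of_laplace (by positivity) l0
    filter_upwards [hτn, hτ.eventually hI0, hτ.eventually hpos, hτ.eventually self_mem_nhdsWithin]
      with n hn hI0 hT0 hτ0
    have hτ0 : 0 < τ n := hτ0
    have hI : ∀ j, (∫ θ in (-Real.pi)..Real.pi, saddleIntegrand (tilt A (τ n)) j θ).re =
        x ^ j * (centredMoment (tilt a (τ n)) n x j).re := fun j => by
      rw [integral_saddleIntegrand_eq a hn j, Complex.re_ofReal_mul]
    have hsa : Summable fun δ : ℕ => (aCount G (δ + 1) : ℝ) * Real.exp (-τ n * (δ + 1)) := by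
      refine ((hsA (τ n) hτ0).mul_left x⁻¹).congr fun δ => ?_
      simp only [hAdef, ha]
      field_simp
    have hT : powMoment (tilt A (τ n)) 0 = x * ∑' δ, tilt a (τ n) δ := by
      rw [powMoment, ← tsum_mul_left]
      refine tsum_congr fun δ => ?_
      simp only [tilt, hAdef]
      ring
    have hvar := variance_eq_centredMoment G hfin n x (τ n) (b := tilt a (τ n)) (fun δ => by
      have : (δ : ℝ) + 1 ≠ 0 := by positivity
      simp only [tilt, ha]
      field_simp) hsa (by simpa [hI] using hI0)
    simp only [Function.comp_apply, hI, hn, Pi.div_apply]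
    rw [hvar]
    simp only [hT] at hT0 ⊢
    have hr : ∀ j, x ^ j * (centredMoment (tilt a (τ n)) n x j).re /
        (x ^ 0 * (centredMoment (tilt a (τ n)) n x 0).re) =
        x ^ j * ((centredMoment (tilt a (τ n)) n x j).re /
          (centredMoment (tilt a (τ n)) n x 0).re) := fun j => by
      rw [pow_zero, one_mul, mul_div_assoc]
    rw [hr, hr, div_mul_div_cancel₀ hT0.ne']
    simp only [div_eq_mul_inv, mul_inv, inv_inv]
    ring
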